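/- Let d ≥ 2 be an integer, κ > 0, ε > 0, R > 0, let δ be a real with 0 ≤ δ ≤ (d − 2)/2, and let (p, q) be a Schrödinger-admissible pair with p < ∞. Let f : ℝ^d → ℂ be a Schwartz function whose Fourier transform f̂ is supported in the annulus { ξ : R/2 ≤ ‖ξ‖ ≤ 2R }, and for t ∈ ℝ let (e^{itH_ε}f)(x) denote the inverse Fourier transform of ξ ↦ exp( i·t·ω_{ε,κ}(ξ) )·f̂(ξ), where ω_{ε,κ}(ξ) = (1/ε)·‖ξ‖·√(1 + ε²κ²‖ξ‖²). Then there exists a constant C > 0, depending only on d, κ, δ, p and q (and not on ε, R or f), such that ( ∫_ℝ ‖e^{itH_ε}f‖_{L^q(ℝ^d)}^p dt )^{1/p} ≤ C·( εκR/√(1 + ε²κ²R²) )^{δ(1/2 − 1/q)}·‖f‖_{L²(ℝ^d)}. -/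

import Mathlib

open FourierTransform MeasureTheory ENNReal

/-- Young's inequality in trilinear form on the real line. -/
theorem lintegral_young_trilinear {P : ℝ} (hP : 2 ≤ P) {k f g : ℝ → ℝ≥0∞}
    (hk : Measurable k) (hf : Measurable f) (hg : Measurable g) :
    ∫⁻ z : ℝ × ℝ, k (z.2 - z.1) * f z.1 * g z.2 ≤
      (∫⁻ u, k u ^ (P / 2)) ^ (2 / P) * (∫⁻ s, f s ^ (1 - 1 / P)⁻¹) ^ (1 - 1 / P) *
        (∫⁻ t, g t ^ (1 - 1 / P)⁻¹) ^ (1 - 1 / P) := by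
  have hP0 : 0 < P := by linarith
  have hP1 : 1 / P ≤ 1 / 2 := one_div_le_one_div_of_le (by norm_num) hP
  have hP2 : 0 < 1 / P := by positivity
  set a : ℝ := (1 - 1 / P)⁻¹ with ha
  have ha0 : 0 < a := inv_pos.2 (by linarith)
  have ha1 : a * (1 - 2 / P) + a * (1 / P) = 1 := by
    rw [← mul_add, ha]
    have : (1 - 2 / P + 1 / P) = 1 - 1 / P := by ring
    rw [this, inv_mul_cancel₀ (by linarith)]
  have h2P : 0 ≤ 1 - 2 / P := by
    have : 2 / P = 2 * (1 / P) := by ring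
    linarith
  let F : Fin 3 → ℝ × ℝ → ℝ≥0∞ := ![fun z => f z.1 ^ a * g z.2 ^ a,
    fun z => k (z.2 - z.1) ^ (P / 2) * g z.2 ^ a, fun z => k (z.2 - z.1) ^ (P / 2) * f z.1 ^ a]
  let w : Fin 3 → ℝ := ![1 - 2 / P, 1 / P, 1 / P]
  have m1 : AEMeasurable (fun z : ℝ × ℝ => f z.1 ^ a * g z.2 ^ a) volume := by fun_prop
  have m2 : AEMeasurable (fun z : ℝ × ℝ => k (z.2 - z.1) ^ (P / 2) * g z.2 ^ a) volume := by
    fun_prop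
  have m3 : AEMeasurable (fun z : ℝ × ℝ => k (z.2 - z.1) ^ (P / 2) * f z.1 ^ a) volume := by
    fun_prop
  have key := ENNReal.lintegral_prod_norm_pow_le (μ := (volume : Measure (ℝ × ℝ)))
    Finset.univ (f := F) (p := w)
    (by intro i _; fin_cases i; exacts [m1, m2, m3])
    (by simp [w, Fin.sum_univ_three]; field_simp; ring)
    (by intro i _; fin_cases i <;> simp [w] <;> first | positivity | simpa using h2P)
  simp only [Fin.prod_univ_three, F, w, Matrix.cons_val_zero, Matrix.cons_val_one,
    Matrix.cons_val_two, Matrix.head_cons, Matrix.tail_cons] at key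
  have e1 : ∀ z : ℝ × ℝ, k (z.2 - z.1) * f z.1 * g z.2 =
      (f z.1 ^ a * g z.2 ^ a) ^ (1 - 2 / P) * (k (z.2 - z.1) ^ (P / 2) * g z.2 ^ a) ^ (1 / P) *
      (k (z.2 - z.1) ^ (P / 2) * f z.1 ^ a) ^ (1 / P) := by
    intro z
    have hx : ∀ x : ℝ≥0∞, x = (x ^ a) ^ (1 - 2 / P) * (x ^ a) ^ (1 / P) := by
      intro x
      rw [← ENNReal.rpow_mul, ← ENNReal.rpow_mul, ← ENNReal.rpow_add_of_nonneg _ _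
        (by positivity) (by positivity), ha1, ENNReal.rpow_one]
    have hκ : ∀ x : ℝ≥0∞, x = (x ^ (P / 2)) ^ (1 / P) * (x ^ (P / 2)) ^ (1 / P) := by
      intro x
      rw [← ENNReal.rpow_mul, ← ENNReal.rpow_add_of_nonneg _ _
        (by positivity) (by positivity)]
      have : P / 2 * (1 / P) + P / 2 * (1 / P) = 1 := by field_simp; norm_num
      rw [this, ENNReal.rpow_one]
    simp only [ENNReal.mul_rpow_of_nonneg _ _ h2P, ENNReal.mul_rpow_of_nonneg _ _ hP2.le]
    conv_lhs => rw [hx (f z.1), hx (g z.2), hκ (k (z.2 - z.1))]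
    ring
  have i1 : ∫⁻ z : ℝ × ℝ, f z.1 ^ a * g z.2 ^ a = (∫⁻ s, f s ^ a) * ∫⁻ t, g t ^ a :=
    lintegral_prod_mul (hf.pow_const a).aemeasurable (hg.pow_const a).aemeasurable
  have i2 : ∫⁻ z : ℝ × ℝ, k (z.2 - z.1) ^ (P / 2) * g z.2 ^ a =
      (∫⁻ u, k u ^ (P / 2)) * ∫⁻ t, g t ^ a := by
    rw [Measure.volume_eq_prod, lintegral_prod_symm _ (by fun_prop)]
    simp only
    have : ∀ t : ℝ, ∫⁻ s, k (t - s) ^ (P / 2) * g t ^ a = (∫⁻ u, k u ^ (P / 2)) * g t ^ a := by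
      intro t
      rw [lintegral_mul_const _ (by fun_prop), lintegral_sub_left_eq_self (fun u => k u ^ (P / 2)) t]
    simp_rw [this]
    rw [lintegral_const_mul _ (by fun_prop)]
  have i3 : ∫⁻ z : ℝ × ℝ, k (z.2 - z.1) ^ (P / 2) * f z.1 ^ a =
      (∫⁻ u, k u ^ (P / 2)) * ∫⁻ t, f t ^ a := by
    rw [Measure.volume_eq_prod, lintegral_prod _ (by fun_prop)]
    simp only
    have : ∀ s : ℝ, ∫⁻ t, k (t - s) ^ (P / 2) * f s ^ a = (∫⁻ u, k u ^ (P / 2)) * f s ^ a := by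
      intro s
      rw [lintegral_mul_const _ (by fun_prop), lintegral_sub_right_eq_self (fun u => k u ^ (P / 2)) s]
    simp_rw [this]
    rw [lintegral_const_mul _ (by fun_prop)]
  rw [i1, i2, i3] at key
  simp_rw [← e1] at key
  refine key.trans (le_of_eq ?_)
  simp only [ENNReal.mul_rpow_of_nonneg _ _ h2P, ENNReal.mul_rpow_of_nonneg _ _ hP2.le]
  have hx : ∀ x : ℝ≥0∞, x ^ (1 - 1 / P) = x ^ (1 - 2 / P) * x ^ (1 / P) := by
    intro x
    rw [← ENNReal.rpow_add_of_nonneg _ _ (by positivity) (by positivity)]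
    congr 1; ring
  have hκ : ∀ x : ℝ≥0∞, x ^ (2 / P) = x ^ (1 / P) * x ^ (1 / P) := by
    intro x
    rw [← ENNReal.rpow_add_of_nonneg _ _ (by positivity) (by positivity)]
    congr 1; ring
  rw [hx, hx, hκ]
  ring

/-- The `L^{p'}` norm of a nonnegative function of time, `p'` being the exponent dual to `P`. -/
noncomputable def dualNorm (P : ℝ) (f : ℝ → ℝ≥0∞) : ℝ≥0∞ :=
  (∫⁻ s, f s ^ (1 - 1 / P)⁻¹) ^ (1 - 1 / P)

theorem lintegral_Icc_enorm_rpow_le {L : ℝ} (hL : 0 < L) :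
    ∫⁻ u : ℝ, (Set.Icc (-L) L).indicator (fun u => ‖u‖ₑ ^ (-(3 / 4) : ℝ)) u ≤
      8 * ENNReal.ofReal L ^ (1 / 4 : ℝ) := by
  have hpos : ∫⁻ u in Set.Ioc 0 L, ‖u‖ₑ ^ (-(3 / 4) : ℝ) = 4 * ENNReal.ofReal L ^ (1 / 4 : ℝ) := by
    have h1 : ∀ u ∈ Set.Ioc 0 L, ‖u‖ₑ ^ (-(3 / 4) : ℝ) = ENNReal.ofReal (u ^ (-(3 / 4) : ℝ)) := by
      intro u hu
      rw [← ENNReal.ofReal_rpow_of_pos hu.1, Real.enorm_of_nonneg hu.1.le]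
    rw [setLIntegral_congr_fun measurableSet_Ioc h1, ← ofReal_integral_eq_lintegral_ofReal]
    · rw [← intervalIntegral.integral_of_le hL.le, integral_rpow (by left; norm_num)]
      rw [ENNReal.ofReal_rpow_of_pos hL]
      norm_num
      rw [← ENNReal.ofReal_ofNat, ← ENNReal.ofReal_mul (by norm_num)]
      congr 1; ring
    · exact (intervalIntegrable_iff_integrableOn_Ioc_of_le hL.le).1
        (intervalIntegral.intervalIntegrable_rpow' (by norm_num))
    · filter_upwards [ae_restrict_mem measurableSet_Ioc] with u hu
      exact Real.rpow_nonneg hu.1.le _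
  have hneg : ∫⁻ u in Set.Ico (-L) 0, ‖u‖ₑ ^ (-(3 / 4) : ℝ) =
      ∫⁻ u in Set.Ioc 0 L, ‖u‖ₑ ^ (-(3 / 4) : ℝ) := by
    have := (Measure.measurePreserving_neg (volume : Measure ℝ)).setLIntegral_comp_preimage
      (s := Set.Ioc 0 L) measurableSet_Ioc (f := fun u : ℝ => ‖u‖ₑ ^ (-(3 / 4) : ℝ)) (by fun_prop)
    rw [← this]
    simp
  rw [lintegral_indicator measurableSet_Icc]
  have hsub : Set.Icc (-L) L ⊆ Set.Ico (-L) 0 ∪ ({0} ∪ Set.Ioc 0 L) := by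
    intro u hu
    rcases lt_trichotomy u 0 with h | h | h
    · exact Or.inl ⟨hu.1, h⟩
    · exact Or.inr (Or.inl h)
    · exact Or.inr (Or.inr ⟨h, hu.2⟩)
  calc _ ≤ ∫⁻ u in Set.Ico (-L) 0 ∪ ({0} ∪ Set.Ioc 0 L), ‖u‖ₑ ^ (-(3 / 4) : ℝ) :=
        lintegral_mono_set hsub
    _ ≤ _ := (lintegral_union_le _ _ _).trans (add_le_add le_rfl (lintegral_union_le _ _ _))
    _ = _ := by
      rw [hneg, hpos]
      simp only [Measure.restrict_singleton, measure_singleton, zero_smul, lintegral_zero_measure]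
      ring

theorem MeasureTheory.Integrable.inner_fst_snd {H : Type*} [NormedAddCommGroup H] [InnerProductSpace ℂ H]
    {V W : ℝ → H} (hV : Integrable V)
    (hW : Integrable W) : Integrable (fun z : ℝ × ℝ => inner ℂ (V z.1) (W z.2)) := by
  refine Integrable.mono' (hV.norm.mul_prod hW.norm) ?_ ?_
  · exact (hV.1.comp_fst).inner (hW.1.comp_snd)
  · exact Filter.Eventually.of_forall fun z => norm_inner_le_norm _ _

theorem inner_integral_integral {H : Type*} [NormedAddCommGroup H] [InnerProductSpace ℂ H] [CompleteSpace H]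
    {V W : ℝ → H} (hV : Integrable V) (hW : Integrable W) :
    inner ℂ (∫ s, V s) (∫ t, W t) = ∫ z : ℝ × ℝ, inner ℂ (V z.1) (W z.2) := by
  rw [Measure.volume_eq_prod, integral_prod _ (hV.inner_fst_snd hW)]
  simp only
  have h1 : ∀ s, ∫ t, inner ℂ (V s) (W t) = inner ℂ (V s) (∫ t, W t) :=
    fun s => integral_inner hW (V s)
  simp_rw [h1]
  have h2 := integral_inner (𝕜 := ℂ) hV (∫ t, W t)
  rw [← inner_conj_symm (𝕜 := ℂ) (∫ s, V s) (∫ t, W t), ← h2, ← integral_conj]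
  simp_rw [inner_conj_symm]

theorem enorm_integral_sq_le {H : Type*} [NormedAddCommGroup H] [InnerProductSpace ℂ H] [CompleteSpace H]
    {V : ℝ → H} (hV : Integrable V) :
    ‖∫ s, V s‖ₑ ^ 2 ≤ ∫⁻ z : ℝ × ℝ, ‖inner ℂ (V z.1) (V z.2)‖ₑ := by
  have h : ‖∫ s, V s‖ₑ ^ 2 = ‖inner ℂ (∫ s, V s) (∫ s, V s)‖ₑ := by
    rw [inner_self_eq_norm_sq_to_K, enorm_pow]
    simp [enorm_eq_nnnorm]
  rw [h, inner_integral_integral hV hV]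
  exact enorm_integral_le_lintegral_enorm _

theorem enorm_inner_le_geom {H : Type*} [NormedAddCommGroup H] [InnerProductSpace ℂ H]
    {P σ x : ℝ} (hP : 2 ≤ P) (hσ : 2 / P < σ)
    {v w : H} {a b : ℝ≥0∞} {u : ℝ≥0∞}
    (h1 : ‖v‖ₑ ≤ 2 ^ (-x / P) * a) (h1' : ‖w‖ₑ ≤ 2 ^ (-x / P) * b)
    (h2 : ‖inner ℂ v w‖ₑ ≤ 2 ^ ((σ - 2 / P) * x) * u ^ (-σ) * a * b) :
    ‖inner ℂ v w‖ₑ ≤ 2 ^ (-x / (2 * P)) * u ^ (-(3 / (2 * P))) * a * b := by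
  have hP0 : 0 < P := by linarith
  have hσ0 : 0 < σ := lt_trans (by positivity) hσ
  set θ : ℝ := 3 / (2 * P) / σ with hθ
  have hθσ : σ * θ = 3 / (2 * P) := by rw [hθ]; field_simp
  have hθ0 : 0 < θ := by positivity
  have hθ1 : θ < 1 := by
    rw [hθ, div_lt_one hσ0]
    refine lt_of_lt_of_le ?_ hσ.le
    rw [div_lt_div_iff₀ (by positivity) hP0]; nlinarith
  have h0 : ‖inner ℂ v w‖ₑ ≤ 2 ^ (-2 * x / P) * (a * b) := by
    calc ‖inner ℂ v w‖ₑ ≤ ‖v‖ₑ * ‖w‖ₑ := by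
          rw [enorm_eq_nnnorm, enorm_eq_nnnorm, enorm_eq_nnnorm]
          exact_mod_cast nnnorm_inner_le_nnnorm v w
      _ ≤ (2 ^ (-x / P) * a) * (2 ^ (-x / P) * b) := mul_le_mul' h1 h1'
      _ = 2 ^ (-2 * x / P) * (a * b) := by
        have : (2 : ℝ≥0∞) ^ (-2 * x / P) = 2 ^ (-x / P) * 2 ^ (-x / P) := by
          rw [← ENNReal.rpow_add _ _ (by norm_num) (by norm_num)]; congr 1; ring
        rw [this]; ring
  have hsplit : ∀ y : ℝ≥0∞, y ^ (1 - θ) * y ^ θ = y := fun y => by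
    rw [← ENNReal.rpow_add_of_nonneg _ _ (by linarith) hθ0.le]; simp
  calc ‖inner ℂ v w‖ₑ = ‖inner ℂ v w‖ₑ ^ (1 - θ) * ‖inner ℂ v w‖ₑ ^ θ := (hsplit _).symm
    _ ≤ (2 ^ (-2 * x / P) * (a * b)) ^ (1 - θ) *
        (2 ^ ((σ - 2 / P) * x) * u ^ (-σ) * (a * b)) ^ θ := by
        gcongr
        rw [← mul_assoc]; exact h2
    _ = _ := by
      rw [ENNReal.mul_rpow_of_nonneg _ _ (by linarith), ENNReal.mul_rpow_of_nonneg _ _ hθ0.le,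
        ENNReal.mul_rpow_of_nonneg _ _ hθ0.le]
      have e : (2 : ℝ≥0∞) ^ (-x / (2 * P)) =
          (2 ^ (-2 * x / P)) ^ (1 - θ) * (2 ^ ((σ - 2 / P) * x)) ^ θ := by
        rw [← ENNReal.rpow_mul, ← ENNReal.rpow_mul,
          ← ENNReal.rpow_add _ _ (by norm_num) (by norm_num)]
        congr 1
        have : (σ - 2 / P) * x * θ = (σ * θ) * x - 2 / P * x * θ := by ring
        rw [this, hθσ]; field_simp; ring
      have e2 : (u ^ (-σ)) ^ θ = u ^ (-(3 / (2 * P))) := by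
        rw [← ENNReal.rpow_mul]; congr 1; rw [← hθσ]; ring
      rw [e, e2]
      conv_rhs => rw [mul_assoc _ a b, ← hsplit (a * b)]
      ring

/-- Local-in-time estimate on a set of times of diameter at most `L`. -/
theorem enorm_setIntegral_le {H : Type*} [NormedAddCommGroup H] [InnerProductSpace ℂ H] [CompleteSpace H]
    {P σ x L : ℝ} (hP : 2 ≤ P) (hσ : 2 / P < σ) (hL : 0 < L)
    {V : ℝ → H} (hV : Integrable V) {f : ℝ → ℝ≥0∞} (hf : Measurable f)
    (h1 : ∀ t, ‖V t‖ₑ ≤ 2 ^ (-x / P) * f t)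
    (h2 : ∀ s t, ‖inner ℂ (V s) (V t)‖ₑ ≤
      2 ^ ((σ - 2 / P) * x) * ‖t - s‖ₑ ^ (-σ) * f s * f t)
    {I : Set ℝ} (hI : MeasurableSet I) (hIL : ∀ s ∈ I, ∀ t ∈ I, |t - s| ≤ L) :
    ‖∫ s in I, V s‖ₑ ≤ 2 ^ (-x / (4 * P)) * (8 * ENNReal.ofReal L ^ (1 / 4 : ℝ)) ^ (1 / P) *
      dualNorm P (I.indicator f) := by
  have hP0 : 0 < P := by linarith
  set k : ℝ → ℝ≥0∞ := (Set.Icc (-L) L).indicator (fun u => ‖u‖ₑ ^ (-(3 / (2 * P)))) with hk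
  have hkm : Measurable k := Measurable.indicator (by fun_prop) measurableSet_Icc
  have hfI : Measurable (I.indicator f) := hf.indicator hI
  have hsq : ‖∫ s in I, V s‖ₑ ^ 2 ≤ (2 ^ (-x / (4 * P)) *
      (8 * ENNReal.ofReal L ^ (1 / 4 : ℝ)) ^ (1 / P) * dualNorm P (I.indicator f)) ^ 2 := by
    rw [← integral_indicator hI]
    refine (enorm_integral_sq_le (hV.indicator hI)).trans ?_
    calc ∫⁻ z : ℝ × ℝ, ‖inner ℂ (I.indicator V z.1) (I.indicator V z.2)‖ₑ
        ≤ ∫⁻ z : ℝ × ℝ, 2 ^ (-x / (2 * P)) *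
            (k (z.2 - z.1) * I.indicator f z.1 * I.indicator f z.2) := by
          refine lintegral_mono fun z => ?_
          by_cases hs : z.1 ∈ I
          · by_cases ht : z.2 ∈ I
            · have hm : z.2 - z.1 ∈ Set.Icc (-L) L := abs_le.1 (hIL _ hs _ ht)
              simp only [hk, hs, ht, hm, Set.indicator_of_mem]
              have := enorm_inner_le_geom hP hσ (h1 z.1) (h1 z.2) (h2 z.1 z.2)
              refine this.trans (le_of_eq ?_)
              ring
            · simp [ht]
          · simp [hs]
      _ = 2 ^ (-x / (2 * P)) * ∫⁻ z : ℝ × ℝ,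
            (k (z.2 - z.1) * I.indicator f z.1 * I.indicator f z.2) := by
          rw [lintegral_const_mul _ (by fun_prop)]
      _ ≤ 2 ^ (-x / (2 * P)) * ((8 * ENNReal.ofReal L ^ (1 / 4 : ℝ)) ^ (2 / P) *
            dualNorm P (I.indicator f) * dualNorm P (I.indicator f)) := by
          gcongr
          refine (lintegral_young_trilinear hP hkm hfI hfI).trans ?_
          rw [dualNorm]
          gcongr
          refine le_trans (lintegral_mono fun u => ?_) (lintegral_Icc_enorm_rpow_le hL)
          by_cases hu : u ∈ Set.Icc (-L) L
          · simp only [hk, hu, Set.indicator_of_mem]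
            rw [← ENNReal.rpow_mul]
            refine le_of_eq ?_
            congr 1; field_simp
            norm_num
          · simp only [hk, hu, not_false_eq_true, Set.indicator_of_notMem]
            rw [ENNReal.zero_rpow_of_pos (by positivity)]
      _ = _ := by
          have e1 : (2 : ℝ≥0∞) ^ (-x / (2 * P)) = 2 ^ (-x / (4 * P)) * 2 ^ (-x / (4 * P)) := by
            rw [← ENNReal.rpow_add _ _ (by norm_num) (by norm_num)]; congr 1; field_simp; ring
          have e2 : ∀ y : ℝ≥0∞, y ^ (2 / P) = y ^ (1 / P) * y ^ (1 / P) := by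
            intro y
            rw [← ENNReal.rpow_add_of_nonneg _ _ (by positivity) (by positivity)]
            congr 1; ring
          rw [e1, e2]; ring
  exact (ENNReal.pow_le_pow_left_iff two_ne_zero).1 hsq

/-- Pairs of times at distance comparable to `2 ^ j`. -/
def dyadicShell (j : ℤ) : Set (ℝ × ℝ) :=
  {z | (2 : ℝ) ^ j ≤ |z.2 - z.1| ∧ |z.2 - z.1| < (2 : ℝ) ^ (j + 1)}

theorem measurableSet_dyadicShell (j : ℤ) : MeasurableSet (dyadicShell j) := by
  unfold dyadicShell
  measurability

theorem mem_dyadicShell {j : ℤ} {z : ℝ × ℝ} :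
    z ∈ dyadicShell j ↔ (2 : ℝ) ^ j ≤ |z.2 - z.1| ∧ |z.2 - z.1| < (2 : ℝ) ^ (j + 1) := Iff.rfl

theorem pairwise_disjoint_dyadicShell : Pairwise (Function.onFun Disjoint dyadicShell) := by
  have key : ∀ i j : ℤ, i < j → Disjoint (dyadicShell i) (dyadicShell j) := by
    intro i j hij
    refine Set.disjoint_left.2 fun z hi hj => ?_
    have h : (2 : ℝ) ^ (i + 1) ≤ 2 ^ j := zpow_le_zpow_right₀ (by norm_num) (by omega)
    exact absurd (hj.1.trans_lt hi.2) (not_lt.2 h)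
  intro i j hij
  rcases lt_or_gt_of_ne hij with h | h
  exacts [key i j h, (key j i h).symm]

theorem iUnion_dyadicShell : ⋃ j, dyadicShell j = {z | z.1 ≠ z.2} := by
  ext z
  simp only [Set.mem_iUnion, Set.mem_ofPred_eq]
  constructor
  · rintro ⟨j, hj⟩ h
    have : (0 : ℝ) < 2 ^ j := by positivity
    have h2 := hj.1
    rw [h] at h2
    simp at h2
    linarith
  · intro h
    have h0 : 0 < |z.2 - z.1| := abs_pos.2 (sub_ne_zero.2 (Ne.symm h))
    exact exists_mem_Ico_zpow h0 one_lt_two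

theorem ae_ne_diag : ∀ᵐ z : ℝ × ℝ, z.1 ≠ z.2 := by
  rw [Measure.volume_eq_prod]
  have hm : MeasurableSet {z : ℝ × ℝ | z.1 = z.2} := measurableSet_eq_fun measurable_fst measurable_snd
  have : (volume : Measure ℝ).prod volume {z : ℝ × ℝ | z.1 = z.2} = 0 := by
    rw [Measure.prod_apply hm]
    simp [Set.preimage]
  rw [ae_iff]
  simpa using this

theorem enorm_integral_le_tsum_dyadicShell {G : ℝ × ℝ → ℂ} (hG : Integrable G) :
    ‖∫ z, G z‖ₑ ≤ ∑' j, ‖∫ z in dyadicShell j, G z‖ₑ := by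
  have h := hasSum_integral_iUnion (μ := volume) (f := G) measurableSet_dyadicShell
    pairwise_disjoint_dyadicShell hG.integrableOn
  have h2 : ∫ z in ⋃ j, dyadicShell j, G z = ∫ z, G z := by
    rw [iUnion_dyadicShell]
    exact setIntegral_eq_integral_of_ae_compl_eq_zero
      (by filter_upwards [ae_ne_diag] with z hz h using absurd hz h)
  rw [h2] at h
  rw [← h.tsum_eq]
  exact enorm_tsum_le_tsum_enorm

theorem ENNReal.two_zpow_eq_rpow (j : ℤ) : ENNReal.ofReal ((2 : ℝ) ^ j) = 2 ^ (j : ℝ) := by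
  rw [← Real.rpow_intCast, ← ENNReal.ofReal_rpow_of_pos (by norm_num), ENNReal.ofReal_ofNat]

/-- Bound on one dyadic shell from the dispersive decay alone. -/
theorem lintegral_dyadicShell_le_of_decay {P σ x y : ℝ} (hP : 2 ≤ P) (hσ : 0 ≤ σ) (j : ℤ)
    {G : ℝ × ℝ → ℂ} {f g : ℝ → ℝ≥0∞} (hf : Measurable f) (hg : Measurable g)
    (h : ∀ z, ‖G z‖ₑ ≤
      2 ^ ((σ / 2 - 1 / P) * (x + y)) * ‖z.2 - z.1‖ₑ ^ (-σ) * f z.1 * g z.2) :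
    ‖∫ z in dyadicShell j, G z‖ₑ ≤ 4 ^ (2 / P) * 2 ^ ((σ / 2 - 1 / P) * ((x - j) + (y - j))) *
      (dualNorm P f * dualNorm P g) := by
  have hP0 : 0 < P := by linarith
  set k : ℝ → ℝ≥0∞ := (Set.Ioo (-(2 : ℝ) ^ (j + 1)) (2 ^ (j + 1))).indicator (fun _ => 1) with hk
  have hkm : Measurable k := measurable_const.indicator measurableSet_Ioo
  calc ‖∫ z in dyadicShell j, G z‖ₑ ≤ ∫⁻ z in dyadicShell j, ‖G z‖ₑ :=
        enorm_integral_le_lintegral_enorm _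
    _ ≤ ∫⁻ z in dyadicShell j, 2 ^ ((σ / 2 - 1 / P) * (x + y)) * 2 ^ (-(j * σ)) *
          (k (z.2 - z.1) * f z.1 * g z.2) := by
        refine setLIntegral_mono (by fun_prop) fun z hz => ?_
        obtain ⟨hz1, hz2⟩ := mem_dyadicShell.1 hz
        have hkz : k (z.2 - z.1) = 1 := by
          simp only [hk]
          rw [Set.indicator_of_mem]
          exact abs_lt.1 hz2
        refine (h z).trans ?_
        rw [hkz, one_mul]
        have : ‖z.2 - z.1‖ₑ ^ (-σ) ≤ 2 ^ (-(j * σ)) := by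
          rw [ENNReal.rpow_neg, ENNReal.rpow_neg]
          refine ENNReal.inv_le_inv.2 ?_
          rw [ENNReal.rpow_mul, ← ENNReal.two_zpow_eq_rpow]
          refine ENNReal.rpow_le_rpow ?_ hσ
          rw [Real.enorm_eq_ofReal_abs]
          exact ENNReal.ofReal_le_ofReal hz1
        calc _ ≤ 2 ^ ((σ / 2 - 1 / P) * (x + y)) * 2 ^ (-(j * σ)) * f z.1 * g z.2 := by gcongr
          _ = _ := by ring
    _ ≤ ∫⁻ z : ℝ × ℝ, 2 ^ ((σ / 2 - 1 / P) * (x + y)) * 2 ^ (-(j * σ)) *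
          (k (z.2 - z.1) * f z.1 * g z.2) := setLIntegral_le_lintegral _ _
    _ = 2 ^ ((σ / 2 - 1 / P) * (x + y)) * 2 ^ (-(j * σ)) *
          ∫⁻ z : ℝ × ℝ, (k (z.2 - z.1) * f z.1 * g z.2) := by rw [lintegral_const_mul _ (by fun_prop)]
    _ ≤ 2 ^ ((σ / 2 - 1 / P) * (x + y)) * 2 ^ (-(j * σ)) *
          ((4 * 2 ^ (j : ℝ)) ^ (2 / P) * dualNorm P f * dualNorm P g) := by
        gcongr
        refine (lintegral_young_trilinear hP hkm hf hg).trans ?_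
        rw [dualNorm, dualNorm]
        gcongr
        have : ∀ u, k u ^ (P / 2) = k u := by
          intro u
          by_cases hu : u ∈ Set.Ioo (-(2 : ℝ) ^ (j + 1)) (2 ^ (j + 1))
          · simp [hk, hu]
          · simp only [hk, hu, not_false_eq_true, Set.indicator_of_notMem]
            rw [ENNReal.zero_rpow_of_pos (by positivity)]
        simp_rw [this, hk]
        rw [lintegral_indicator measurableSet_Ioo]
        simp only [lintegral_const, one_mul, Measure.restrict_apply, MeasurableSet.univ,
          Set.univ_inter, Real.volume_Ioo]
        rw [← ENNReal.two_zpow_eq_rpow, ← ENNReal.ofReal_ofNat, ← ENNReal.ofReal_mul (by norm_num)]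
        refine ENNReal.ofReal_le_ofReal (le_of_eq ?_)
        rw [zpow_add₀ (by norm_num)]; ring
    _ = _ := by
        rw [ENNReal.mul_rpow_of_nonneg _ _ (by positivity), ← ENNReal.rpow_mul]
        have : (2 : ℝ≥0∞) ^ ((σ / 2 - 1 / P) * ((x - j) + (y - j))) =
            2 ^ ((σ / 2 - 1 / P) * (x + y)) * 2 ^ (-(j * σ)) * 2 ^ (j * (2 / P)) := by
          rw [← ENNReal.rpow_add _ _ (by norm_num) (by norm_num),
            ← ENNReal.rpow_add _ _ (by norm_num) (by norm_num)]
          congr 1; ring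
        rw [this]; ring

/-- Hölder's inequality for a moving window of length `M`. -/
theorem lintegral_dualNorm_indicator_mul_le {P : ℝ} (hP : 2 ≤ P) {M : ℝ≥0∞}
    {E : Set (ℝ × ℝ)} (hE : MeasurableSet E) (hM : ∀ s, volume {t | (s, t) ∈ E} ≤ M)
    {f g : ℝ → ℝ≥0∞} (hf : Measurable f) (hg : Measurable g) :
    ∫⁻ t, dualNorm P ({s | (s, t) ∈ E}.indicator f) * g t ≤
      M ^ (1 / P) * (dualNorm P f * dualNorm P g) := by
  have hP0 : 0 < P := by linarith
  have hP1 : 1 / P ≤ 1 / 2 := one_div_le_one_div_of_le (by norm_num) hP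
  have ha0 : 0 < (1 - 1 / P)⁻¹ := inv_pos.2 (by linarith)
  have hPP : (1 - 1 / P) * P = P - 1 := by field_simp
  have hconj : P.HolderConjugate (1 - 1 / P)⁻¹ := by
    rw [Real.holderConjugate_iff]
    exact ⟨by linarith, by rw [inv_inv]; ring⟩
  set A : ℝ → ℝ≥0∞ := fun t => ∫⁻ s, E.indicator (fun z => f z.1 ^ (1 - 1 / P)⁻¹) (s, t) with hA
  have hEm : Measurable (E.indicator (fun z : ℝ × ℝ => f z.1 ^ (1 - 1 / P)⁻¹)) :=
    Measurable.indicator (by fun_prop) hE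
  have hAm : Measurable A := hEm.lintegral_prod_left'
  have hdA : ∀ t, dualNorm P ({s | (s, t) ∈ E}.indicator f) = A t ^ (1 - 1 / P) := by
    intro t
    simp only [dualNorm, hA]
    congr 1
    refine lintegral_congr fun s => ?_
    by_cases hs : (s, t) ∈ E
    · simp [hs]
    · simp only [hs, not_false_eq_true, Set.indicator_of_notMem, Set.mem_ofPred_eq]
      rw [ENNReal.zero_rpow_of_pos ha0]
  set N := ∫⁻ s, f s ^ (1 - 1 / P)⁻¹ with hN
  have hAN : ∀ t, A t ≤ N := by
    intro t
    refine lintegral_mono fun s => ?_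
    exact Set.indicator_le_self _ _ _
  have hAint : ∫⁻ t, A t ≤ M * N := by
    rw [hA, ← lintegral_lintegral_swap (f := fun s t =>
      E.indicator (fun z => f z.1 ^ (1 - 1 / P)⁻¹) (s, t)) hEm.aemeasurable, hN,
      ← lintegral_const_mul _ (by fun_prop)]
    refine lintegral_mono fun s => ?_
    have : ∀ t, E.indicator (fun z => f z.1 ^ (1 - 1 / P)⁻¹) (s, t) =
        {t | (s, t) ∈ E}.indicator (fun _ => f s ^ (1 - 1 / P)⁻¹) t := fun t => rfl
    simp_rw [this]
    rw [lintegral_indicator (s := {t | (s, t) ∈ E}) (measurable_prodMk_left hE), lintegral_const,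
      Measure.restrict_apply MeasurableSet.univ, Set.univ_inter, mul_comm]
    gcongr
    exact hM s
  have hAP : ∫⁻ t, (A t ^ (1 - 1 / P)) ^ P ≤ M * N ^ (P - 1) := by
    calc ∫⁻ t, (A t ^ (1 - 1 / P)) ^ P ≤ ∫⁻ t, A t * N ^ (P - 2) := by
          refine lintegral_mono fun t => ?_
          rw [← ENNReal.rpow_mul, hPP]
          have : P - 1 = 1 + (P - 2) := by ring
          rw [this, ENNReal.rpow_add_of_nonneg _ _ (by norm_num) (by linarith), ENNReal.rpow_one]
          gcongr
          exact hAN t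
      _ = (∫⁻ t, A t) * N ^ (P - 2) := lintegral_mul_const _ hAm
      _ ≤ M * N * N ^ (P - 2) := by gcongr
      _ = M * N ^ (P - 1) := by
          have : P - 1 = 1 + (P - 2) := by ring
          rw [this, ENNReal.rpow_add_of_nonneg _ _ (by norm_num) (by linarith), ENNReal.rpow_one,
            mul_assoc]
  simp_rw [hdA]
  refine (ENNReal.lintegral_mul_le_Lp_mul_Lq volume hconj (by fun_prop) hg.aemeasurable).trans ?_
  rw [one_div (1 - 1 / P)⁻¹, inv_inv, ← mul_assoc]
  refine mul_le_mul' ?_ le_rfl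
  calc _ ≤ (M * N ^ (P - 1)) ^ (1 / P) := by gcongr
    _ = _ := by
      rw [ENNReal.mul_rpow_of_nonneg _ _ (by positivity), ← ENNReal.rpow_mul, dualNorm]
      congr 2
      field_simp

theorem mem_dyadicShell_swap {j : ℤ} {s t : ℝ} :
    (s, t) ∈ dyadicShell j ↔ (t, s) ∈ dyadicShell j := by
  simp only [mem_dyadicShell, abs_sub_comm]

theorem abs_sub_le_of_mem_dyadicShell {j : ℤ} {s t t' : ℝ} (h : (s, t) ∈ dyadicShell j)
    (h' : (s, t') ∈ dyadicShell j) : |t' - t| ≤ (2 : ℝ) ^ (j + 2) := by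
  have e : (2 : ℝ) ^ (j + 2) = 2 ^ (j + 1) + 2 ^ (j + 1) := by
    rw [zpow_add₀ (by norm_num), zpow_add₀ (by norm_num)]; norm_num; ring
  have h1 := (mem_dyadicShell.1 h).2
  have h2 := (mem_dyadicShell.1 h').2
  have h3 := abs_sub_le t' s t
  rw [abs_sub_comm s t] at h3
  simp only at h1 h2
  linarith

theorem volume_dyadicShell_le (j : ℤ) (s : ℝ) :
    volume {t | (s, t) ∈ dyadicShell j} ≤ 2 ^ ((j : ℝ) + 2) := by
  have hsub : {t | (s, t) ∈ dyadicShell j} ⊆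
      Set.Ioo (s - (2 : ℝ) ^ (j + 1)) (s + (2 : ℝ) ^ (j + 1)) := by
    intro t ht
    have h1 := abs_lt.1 (mem_dyadicShell.1 ht).2
    simp only at h1
    exact ⟨by linarith [h1.1], by linarith [h1.2]⟩
  refine (measure_mono hsub).trans (le_of_eq ?_)
  have : ((j : ℝ) + 2) = ((j + 2 : ℤ) : ℝ) := by push_cast; ring
  rw [Real.volume_Ioo, this, ← ENNReal.two_zpow_eq_rpow]
  congr 1
  rw [zpow_add₀ (by norm_num), zpow_add₀ (by norm_num)]; norm_num; ring

theorem rpow_four_le {P : ℝ} (hP : 2 ≤ P) : (4 : ℝ≥0∞) ^ (2 / P) ≤ 8 := by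
  calc (4 : ℝ≥0∞) ^ (2 / P) ≤ 4 ^ (1 : ℝ) := by
        refine ENNReal.rpow_le_rpow_of_exponent_le (by norm_num) ?_
        rw [div_le_one (by linarith)]; exact hP
    _ ≤ 8 := by rw [ENNReal.rpow_one]; norm_num

theorem window_const_le {P : ℝ} (hP : 2 ≤ P) (j : ℝ) :
    ((8 : ℝ≥0∞) * (2 ^ (j + 2)) ^ (1 / 4 : ℝ)) ^ (1 / P) * (2 ^ (j + 2)) ^ (1 / P) ≤
      8 * 2 ^ (5 * j / (4 * P)) := by
  have hP0 : 0 < P := by linarith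
  have h8 : (8 : ℝ≥0∞) = 2 ^ (3 : ℝ) := by
    rw [show (3 : ℝ) = ((3 : ℕ) : ℝ) by norm_num, ENNReal.rpow_natCast]; norm_num
  have hadd : ∀ a b : ℝ, (2 : ℝ≥0∞) ^ a * 2 ^ b = 2 ^ (a + b) := fun a b =>
    (ENNReal.rpow_add _ _ (by norm_num) (by norm_num)).symm
  rw [h8, ← ENNReal.rpow_mul, hadd, ← ENNReal.rpow_mul, ← ENNReal.rpow_mul, hadd, hadd]
  refine ENNReal.rpow_le_rpow_of_exponent_le (by norm_num) ?_
  have : (3 + (j + 2) * (1 / 4)) * (1 / P) + (j + 2) * (1 / P) =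
    11 / 2 * (1 / P) + 5 * j / (4 * P) := by field_simp; ring
  rw [this]
  have : 1 / P ≤ 1 / 2 := one_div_le_one_div_of_le (by norm_num) hP
  linarith

/-- A family of vectors indexed by time obeying, at scale `2 ^ x`, the energy and the dispersive
bounds with profile `f`. -/
structure IsDispersive {H : Type*} [NormedAddCommGroup H] [InnerProductSpace ℂ H]
    (P σ x : ℝ) (V : ℝ → H) (f : ℝ → ℝ≥0∞) : Prop where
  integrable : Integrable V
  measurable : Measurable f
  energy : ∀ t, ‖V t‖ₑ ≤ 2 ^ (-x / P) * f t
  dispersive : ∀ s t, ‖inner ℂ (V s) (V t)‖ₑ ≤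
    2 ^ ((σ - 2 / P) * x) * ‖t - s‖ₑ ^ (-σ) * f s * f t

section
variable {H : Type*} [NormedAddCommGroup H] [InnerProductSpace ℂ H] [CompleteSpace H]

theorem enorm_dyadicShell_le_right {P σ x y : ℝ} (hP : 2 ≤ P) (hσ : 2 / P < σ) (j : ℤ)
    {V W : ℝ → H} {f g : ℝ → ℝ≥0∞} (hV : IsDispersive P σ x V f) (hW : IsDispersive P σ y W g) :
    ‖∫ z in dyadicShell j, inner ℂ (V z.1) (W z.2)‖ₑ ≤
      8 * 2 ^ (-(x - j) / P - (y - j) / (4 * P)) * (dualNorm P f * dualNorm P g) := by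
  have hP0 : 0 < P := by linarith
  have hG := (hV.integrable.inner_fst_snd hW.integrable)
  have hD := measurableSet_dyadicShell j
  have hL : (0 : ℝ) < 2 ^ (j + 2) := by positivity
  have hLe : ENNReal.ofReal ((2 : ℝ) ^ (j + 2)) = 2 ^ ((j : ℝ) + 2) := by
    rw [ENNReal.two_zpow_eq_rpow]; push_cast; rfl
  have hJ : ∀ s, MeasurableSet {t | (s, t) ∈ dyadicShell j} := fun s => measurable_prodMk_left hD
  have e1 : ∫ z in dyadicShell j, inner ℂ (V z.1) (W z.2) =
      ∫ s, inner ℂ (V s) (∫ t in {t | (s, t) ∈ dyadicShell j}, W t) := by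
    rw [← integral_indicator hD, Measure.volume_eq_prod, integral_prod _ (hG.indicator hD)]
    congr 1
    ext s
    rw [← integral_indicator (hJ s), ← integral_inner (𝕜 := ℂ) (hW.integrable.indicator (hJ s))]
    congr 1
    ext t
    by_cases h : (s, t) ∈ dyadicShell j <;> simp [h]
  rw [e1]
  set K : ℝ≥0∞ := 2 ^ (-x / P) *
    (2 ^ (-y / (4 * P)) * (8 * ENNReal.ofReal (2 ^ (j + 2)) ^ (1 / 4 : ℝ)) ^ (1 / P)) with hK
  calc _ ≤ ∫⁻ s, ‖inner ℂ (V s) (∫ t in {t | (s, t) ∈ dyadicShell j}, W t)‖ₑ :=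
        enorm_integral_le_lintegral_enorm _
    _ ≤ ∫⁻ s, K * (dualNorm P ({t | (t, s) ∈ dyadicShell j}.indicator g) * f s) := by
        refine lintegral_mono fun s => ?_
        have hset : {t | (s, t) ∈ dyadicShell j} = {t | (t, s) ∈ dyadicShell j} := by
          ext t; exact mem_dyadicShell_swap
        have hw := enorm_setIntegral_le hP hσ hL hW.integrable hW.measurable hW.energy
          hW.dispersive (hJ s) (fun t ht t' ht' => abs_sub_le_of_mem_dyadicShell ht ht')
        have hi : ‖inner ℂ (V s) (∫ t in {t | (s, t) ∈ dyadicShell j}, W t)‖ₑ ≤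
            ‖V s‖ₑ * ‖∫ t in {t | (s, t) ∈ dyadicShell j}, W t‖ₑ := by
          rw [enorm_eq_nnnorm, enorm_eq_nnnorm, enorm_eq_nnnorm]
          exact_mod_cast nnnorm_inner_le_nnnorm _ _
        refine (hi.trans (mul_le_mul' (hV.energy s) hw)).trans (le_of_eq ?_)
        rw [hK, hset]
        ring
    _ = K * ∫⁻ s, (dualNorm P ({t | (t, s) ∈ dyadicShell j}.indicator g) * f s) := by
        refine lintegral_const_mul' _ _ ?_
        rw [hK, hLe]
        have h2 : ∀ a : ℝ, (2 : ℝ≥0∞) ^ a ≠ ⊤ := fun a =>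
          ENNReal.rpow_ne_top_of_ne_zero (by norm_num) (by norm_num)
        refine ENNReal.mul_ne_top (h2 _) (ENNReal.mul_ne_top (h2 _) ?_)
        refine ENNReal.rpow_ne_top_of_nonneg (by positivity) (ENNReal.mul_ne_top (by norm_num) ?_)
        exact ENNReal.rpow_ne_top_of_nonneg (by positivity) (h2 _)
    _ ≤ K * ((2 ^ ((j : ℝ) + 2)) ^ (1 / P) * (dualNorm P g * dualNorm P f)) := by
        gcongr
        exact lintegral_dualNorm_indicator_mul_le hP hD (volume_dyadicShell_le j)
          hW.measurable hV.measurable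
    _ = 2 ^ (-x / P) * 2 ^ (-y / (4 * P)) * ((8 * (2 ^ ((j : ℝ) + 2)) ^ (1 / 4 : ℝ)) ^ (1 / P) *
          (2 ^ ((j : ℝ) + 2)) ^ (1 / P)) * (dualNorm P f * dualNorm P g) := by
        rw [hK, hLe]; ring
    _ ≤ 2 ^ (-x / P) * 2 ^ (-y / (4 * P)) * (8 * 2 ^ (5 * j / (4 * P))) *
          (dualNorm P f * dualNorm P g) := by
        exact mul_le_mul' (mul_le_mul' le_rfl (window_const_le hP j)) le_rfl
    _ = _ := by
        have : (2 : ℝ≥0∞) ^ (-(x - j) / P - (y - j) / (4 * P)) =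
            2 ^ (-x / P) * 2 ^ (-y / (4 * P)) * 2 ^ (5 * j / (4 * P)) := by
          rw [← ENNReal.rpow_add _ _ (by norm_num) (by norm_num),
            ← ENNReal.rpow_add _ _ (by norm_num) (by norm_num)]
          congr 1; field_simp; ring
        rw [this]; ring

theorem enorm_dyadicShell_le_left {P σ x y : ℝ} (hP : 2 ≤ P) (hσ : 2 / P < σ) (j : ℤ)
    {V W : ℝ → H} {f g : ℝ → ℝ≥0∞} (hV : IsDispersive P σ x V f) (hW : IsDispersive P σ y W g) :
    ‖∫ z in dyadicShell j, inner ℂ (V z.1) (W z.2)‖ₑ ≤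
      8 * 2 ^ (-(y - j) / P - (x - j) / (4 * P)) * (dualNorm P f * dualNorm P g) := by
  have h := enorm_dyadicShell_le_right hP hσ j hW hV
  have e : ∫ z in dyadicShell j, inner ℂ (W z.1) (V z.2) =
      starRingEnd ℂ (∫ z in dyadicShell j, inner ℂ (V z.1) (W z.2)) := by
    have hD := measurableSet_dyadicShell j
    rw [← integral_conj, ← integral_indicator hD, ← integral_indicator hD,
      Measure.volume_eq_prod, ← integral_prod_swap]
    congr 1
    ext z
    obtain ⟨s, t⟩ := z
    by_cases hz : (s, t) ∈ dyadicShell j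
    · simp [hz, mem_dyadicShell_swap.1 hz]
    · have hz' : (t, s) ∉ dyadicShell j := fun h => hz (mem_dyadicShell_swap.1 h)
      simp [hz, hz']
  rw [e] at h
  rw [mul_comm (dualNorm P f)]
  simpa [enorm_eq_nnnorm] using h
end

theorem exists_exponent_le {P b : ℝ} (hP : 0 < P) (hb : 0 < b) {x y : ℝ} :
    b * (x + y) ≤ -(min (b / 3) (1 / (6 * P)) * (|x| + |y|)) ∨
    -x / P - y / (4 * P) ≤ -(min (b / 3) (1 / (6 * P)) * (|x| + |y|)) ∨
    -y / P - x / (4 * P) ≤ -(min (b / 3) (1 / (6 * P)) * (|x| + |y|)) := by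
  set e := min (b / 3) (1 / (6 * P))
  have e1 : e ≤ b / 3 := min_le_left _ _
  have e2 : e ≤ 1 / (6 * P) := min_le_right _ _
  set r := 1 / P with hr
  have hr0 : 0 < r := by positivity
  have e3 : e ≤ r / 6 := by rw [hr]; convert e2 using 1; field_simp
  have c1 : -x / P - y / (4 * P) = -(r * x + r * y / 4) := by rw [hr]; field_simp; ring
  have c2 : -y / P - x / (4 * P) = -(r * y + r * x / 4) := by rw [hr]; field_simp; ring
  rw [c1, c2]
  rcases le_total 0 x with hx | hx <;> rcases le_total 0 y with hy | hy
  · right; left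
    rw [abs_of_nonneg hx, abs_of_nonneg hy]
    nlinarith
  · rw [abs_of_nonneg hx, abs_of_nonpos hy]
    rcases le_total (2 * x) (-y) with h | h
    · left; nlinarith
    · right; left; nlinarith
  · rw [abs_of_nonpos hx, abs_of_nonneg hy]
    rcases le_total (2 * y) (-x) with h | h
    · left; nlinarith
    · right; right; nlinarith
  · left
    rw [abs_of_nonpos hx, abs_of_nonpos hy]
    nlinarith

theorem ENNReal.mul_le_sq_add_sq (a b : ℝ≥0∞) : a * b ≤ a ^ 2 + b ^ 2 := by
  rcases le_total a b with h | h
  · calc a * b ≤ b * b := by gcongr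
      _ ≤ a ^ 2 + b ^ 2 := by rw [← sq]; exact le_add_self
  · calc a * b ≤ a * a := by gcongr
      _ ≤ a ^ 2 + b ^ 2 := by rw [← sq]; exact le_self_add

/-- The total mass of the two-sided geometric weight. -/
noncomputable def geomMass (e : ℝ) : ℝ≥0∞ := ∑' j : ℤ, (2 : ℝ≥0∞) ^ (-(e * |(j : ℝ)|))

theorem geomMass_ne_top {e : ℝ} (he : 0 < e) : geomMass e ≠ ⊤ := by
  have hr0 : (0 : ℝ) ≤ 2 ^ (-e) := by positivity
  have hr1 : (2 : ℝ) ^ (-e) < 1 := Real.rpow_lt_one_of_one_lt_of_neg (by norm_num) (by linarith)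
  have hs : Summable fun j : ℤ => (2 : ℝ) ^ (-(e * |(j : ℝ)|)) := by
    have hpow : ∀ n : ℕ, (2 : ℝ) ^ (-(e * n)) = ((2 : ℝ) ^ (-e)) ^ n := by
      intro n
      rw [← Real.rpow_natCast, ← Real.rpow_mul (by norm_num)]
      congr 1; ring
    refine Summable.of_nat_of_neg ?_ ?_
    · simpa [hpow] using summable_geometric_of_lt_one hr0 hr1
    · simpa [hpow] using summable_geometric_of_lt_one hr0 hr1
  have h2 : ∀ j : ℤ, (2 : ℝ≥0∞) ^ (-(e * |(j : ℝ)|)) =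
      ENNReal.ofReal ((2 : ℝ) ^ (-(e * |(j : ℝ)|))) := by
    intro j
    rw [← ENNReal.ofReal_rpow_of_pos (by norm_num), ENNReal.ofReal_ofNat]
  rw [geomMass]
  simp_rw [h2]
  exact hs.tsum_ofReal_ne_top

theorem sum_geom_le_geomMass (e : ℝ) (S : Finset ℤ) (j : ℤ) :
    ∑ k ∈ S, (2 : ℝ≥0∞) ^ (-(e * |(k : ℝ) - j|)) ≤ geomMass e := by
  calc ∑ k ∈ S, (2 : ℝ≥0∞) ^ (-(e * |(k : ℝ) - j|))
      ≤ ∑' k : ℤ, (2 : ℝ≥0∞) ^ (-(e * |(k : ℝ) - j|)) := ENNReal.sum_le_tsum S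
    _ = ∑' k : ℤ, (2 : ℝ≥0∞) ^ (-(e * |((k - j : ℤ) : ℝ)|)) := by push_cast; rfl
    _ = geomMass e := (Equiv.subRight j).tsum_eq fun k : ℤ => (2 : ℝ≥0∞) ^ (-(e * |(k : ℝ)|))

theorem tsum_geom_sub (e : ℝ) (k : ℤ) :
    ∑' j : ℤ, (2 : ℝ≥0∞) ^ (-(e * |(k : ℝ) - j|)) = geomMass e := by
  calc ∑' j : ℤ, (2 : ℝ≥0∞) ^ (-(e * |(k : ℝ) - j|))
      = ∑' j : ℤ, (2 : ℝ≥0∞) ^ (-(e * |((k - j : ℤ) : ℝ)|)) := by push_cast; rfl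
    _ = geomMass e := (Equiv.subLeft k).tsum_eq fun k : ℤ => (2 : ℝ≥0∞) ^ (-(e * |(k : ℝ)|))

/-- Schur's test for the doubly geometric kernel. -/
theorem sum_sum_tsum_geom_le (e : ℝ) (S : Finset ℤ) (N : ℤ → ℝ≥0∞) :
    ∑ k ∈ S, ∑ l ∈ S, ∑' j : ℤ, (2 : ℝ≥0∞) ^ (-(e * (|(k : ℝ) - j| + |(l : ℝ) - j|))) *
      (N k * N l) ≤ 2 * geomMass e ^ 2 * ∑ k ∈ S, N k ^ 2 := by
  set w : ℤ → ℤ → ℝ≥0∞ := fun k j => (2 : ℝ≥0∞) ^ (-(e * |(k : ℝ) - j|)) with hw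
  have hww : ∀ k l j : ℤ, (2 : ℝ≥0∞) ^ (-(e * (|(k : ℝ) - j| + |(l : ℝ) - j|))) =
      w k j * w l j := by
    intro k l j
    rw [hw, ← ENNReal.rpow_add _ _ (by norm_num) (by norm_num)]
    congr 1; ring
  have hhalf : ∑ k ∈ S, ∑ l ∈ S, ∑' j : ℤ, w k j * w l j * N k ^ 2 ≤
      geomMass e ^ 2 * ∑ k ∈ S, N k ^ 2 := by
    rw [Finset.mul_sum]
    refine Finset.sum_le_sum fun k _ => ?_
    rw [← Summable.tsum_finsetSum (fun _ _ => ENNReal.summable)]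
    calc ∑' j : ℤ, ∑ l ∈ S, w k j * w l j * N k ^ 2
        = ∑' j : ℤ, w k j * (∑ l ∈ S, w l j) * N k ^ 2 := by
          congr 1; ext j; rw [Finset.mul_sum, Finset.sum_mul]
      _ ≤ ∑' j : ℤ, w k j * geomMass e * N k ^ 2 := by
          refine ENNReal.tsum_le_tsum fun j => ?_
          gcongr
          exact sum_geom_le_geomMass e S j
      _ = _ := by
          rw [ENNReal.tsum_mul_right, ENNReal.tsum_mul_right, tsum_geom_sub]
          ring
  calc _ ≤ ∑ k ∈ S, ∑ l ∈ S, ∑' j : ℤ, (w k j * w l j * N k ^ 2 + w k j * w l j * N l ^ 2) := by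
        refine Finset.sum_le_sum fun k _ => Finset.sum_le_sum fun l _ =>
          ENNReal.tsum_le_tsum fun j => ?_
        rw [hww, ← mul_add]
        gcongr
        exact ENNReal.mul_le_sq_add_sq _ _
    _ = (∑ k ∈ S, ∑ l ∈ S, ∑' j : ℤ, w k j * w l j * N k ^ 2) +
          ∑ k ∈ S, ∑ l ∈ S, ∑' j : ℤ, w k j * w l j * N l ^ 2 := by
        simp_rw [ENNReal.tsum_add, Finset.sum_add_distrib]
    _ = (∑ k ∈ S, ∑ l ∈ S, ∑' j : ℤ, w k j * w l j * N k ^ 2) +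
          ∑ k ∈ S, ∑ l ∈ S, ∑' j : ℤ, w k j * w l j * N k ^ 2 := by
        congr 1
        rw [Finset.sum_comm]
        refine Finset.sum_congr rfl fun k _ => Finset.sum_congr rfl fun l _ => tsum_congr fun j => ?_
        ring
    _ ≤ _ := by
        rw [two_mul, add_mul]
        gcongr

/-- Almost orthogonality of dispersive families living at different dyadic scales. -/
theorem enorm_sum_integral_sq_le {H : Type*} [NormedAddCommGroup H] [InnerProductSpace ℂ H]
    [CompleteSpace H] {P σ : ℝ} (hP : 2 ≤ P) (hσ : 2 / P < σ) (S : Finset ℤ)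
    {V : ℤ → ℝ → H} {f : ℤ → ℝ → ℝ≥0∞} (hV : ∀ k ∈ S, IsDispersive P σ k (V k) (f k))
    (hVV : ∀ k ∈ S, ∀ l ∈ S, ∀ s t, ‖inner ℂ (V k s) (V l t)‖ₑ ≤
      2 ^ ((σ / 2 - 1 / P) * (k + l)) * ‖t - s‖ₑ ^ (-σ) * f k s * f l t) :
    ‖∑ k ∈ S, ∫ s, V k s‖ₑ ^ 2 ≤
      16 * geomMass (min ((σ / 2 - 1 / P) / 3) (1 / (6 * P))) ^ 2 *
        ∑ k ∈ S, dualNorm P (f k) ^ 2 := by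
  have hP0 : 0 < P := by linarith
  have hb : 0 < σ / 2 - 1 / P := by
    have : 2 / P = 2 * (1 / P) := by ring
    linarith
  set e := min ((σ / 2 - 1 / P) / 3) (1 / (6 * P)) with he
  have hpair : ∀ k ∈ S, ∀ l ∈ S, ‖inner ℂ (∫ s, V k s) (∫ s, V l s)‖ₑ ≤
      8 * ∑' j : ℤ, (2 : ℝ≥0∞) ^ (-(e * (|(k : ℝ) - j| + |(l : ℝ) - j|))) *
      (dualNorm P (f k) * dualNorm P (f l)) := by
    intro k hk l hl
    have hG := (hV k hk).integrable.inner_fst_snd (hV l hl).integrable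
    rw [inner_integral_integral (hV k hk).integrable (hV l hl).integrable, ← ENNReal.tsum_mul_left]
    refine (enorm_integral_le_tsum_dyadicShell hG).trans (ENNReal.tsum_le_tsum fun j => ?_)
    rw [← mul_assoc]
    have hmono : ∀ a : ℝ, a ≤ -(e * (|(k : ℝ) - j| + |(l : ℝ) - j|)) →
        8 * (2 : ℝ≥0∞) ^ a * (dualNorm P (f k) * dualNorm P (f l)) ≤
        8 * 2 ^ (-(e * (|(k : ℝ) - j| + |(l : ℝ) - j|))) *
          (dualNorm P (f k) * dualNorm P (f l)) := by
      intro a ha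
      gcongr
      norm_num
    rcases exists_exponent_le hP0 hb (x := (k : ℝ) - j) (y := (l : ℝ) - j) with h | h | h
    · refine le_trans ?_ (hmono _ h)
      refine (lintegral_dyadicShell_le_of_decay hP (lt_trans (by positivity) hσ).le j
        (hV k hk).measurable (hV l hl).measurable (fun z => hVV k hk l hl z.1 z.2)).trans ?_
      gcongr
      exact rpow_four_le hP
    · exact (enorm_dyadicShell_le_right hP hσ j (hV k hk) (hV l hl)).trans (hmono _ h)
    · exact (enorm_dyadicShell_le_left hP hσ j (hV k hk) (hV l hl)).trans (hmono _ h)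
  have hsq : ∀ v : H, ‖v‖ₑ ^ 2 = ‖inner ℂ v v‖ₑ := by
    intro v
    rw [inner_self_eq_norm_sq_to_K, enorm_pow]
    simp [enorm_eq_nnnorm]
  rw [hsq, sum_inner]
  simp_rw [inner_sum]
  calc _ ≤ ∑ k ∈ S, ∑ l ∈ S, ‖inner ℂ (∫ s, V k s) (∫ s, V l s)‖ₑ :=
        (enorm_sum_le _ _).trans (Finset.sum_le_sum fun k _ => enorm_sum_le _ _)
    _ ≤ ∑ k ∈ S, ∑ l ∈ S, 8 * ∑' j : ℤ, (2 : ℝ≥0∞) ^ (-(e * (|(k : ℝ) - j| + |(l : ℝ) - j|))) *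
          (dualNorm P (f k) * dualNorm P (f l)) :=
        Finset.sum_le_sum fun k hk => Finset.sum_le_sum fun l hl => hpair k hk l hl
    _ = 8 * ∑ k ∈ S, ∑ l ∈ S, ∑' j : ℤ, (2 : ℝ≥0∞) ^ (-(e * (|(k : ℝ) - j| + |(l : ℝ) - j|))) *
          (dualNorm P (f k) * dualNorm P (f l)) := by
        simp_rw [Finset.mul_sum]
    _ ≤ 8 * (2 * geomMass e ^ 2 * ∑ k ∈ S, dualNorm P (f k) ^ 2) := by
        gcongr
        exact sum_sum_tsum_geom_le e S _
    _ = _ := by ring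

theorem ENNReal.sum_rpow_le_rpow_sum {ι : Type*} (S : Finset ι) (y : ι → ℝ≥0∞) {s : ℝ}
    (hs : 1 ≤ s) : ∑ k ∈ S, y k ^ s ≤ (∑ k ∈ S, y k) ^ s := by
  have hsplit : ∀ z : ℝ≥0∞, z ^ s = z * z ^ (s - 1) := by
    intro z
    conv_lhs => rw [show s = 1 + (s - 1) by ring]
    rw [ENNReal.rpow_add_of_nonneg _ _ (by norm_num) (by linarith), ENNReal.rpow_one]
  calc ∑ k ∈ S, y k ^ s ≤ ∑ k ∈ S, y k * (∑ k ∈ S, y k) ^ (s - 1) := by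
        refine Finset.sum_le_sum fun k hk => ?_
        rw [hsplit]
        gcongr
        exact Finset.single_le_sum_of_canonicallyOrdered hk
    _ = _ := by rw [← Finset.sum_mul, ← hsplit]

theorem ENNReal.sum_two_rpow_le (T : Finset ℤ) :
    ∀ m : ℤ, (∀ n ∈ T, n < m) → ∑ n ∈ T, (2 : ℝ≥0∞) ^ (n : ℝ) ≤ 2 ^ (m : ℝ) := by
  induction T using Finset.induction_on_max with
  | empty => simp
  | insert a T hT ih =>
    intro m hm
    rw [Finset.sum_insert (fun h => lt_irrefl _ (hT a h))]
    calc (2 : ℝ≥0∞) ^ (a : ℝ) + ∑ n ∈ T, (2 : ℝ≥0∞) ^ (n : ℝ)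
        ≤ 2 ^ (a : ℝ) + 2 ^ (a : ℝ) := by gcongr; exact ih a hT
      _ = 2 ^ ((a : ℝ) + 1) := by
        rw [ENNReal.rpow_add _ _ (by norm_num) (by norm_num), ENNReal.rpow_one, mul_two]
      _ ≤ 2 ^ (m : ℝ) := by
        refine ENNReal.rpow_le_rpow_of_exponent_le (by norm_num) ?_
        have := hm a (Finset.mem_insert_self _ _)
        exact_mod_cast this

theorem ENNReal.rpow_sum_two_rpow_le (T : Finset ℤ) {a : ℝ} (ha : 0 < a) :
    (∑ n ∈ T, (2 : ℝ≥0∞) ^ (n : ℝ)) ^ a ≤ 2 ^ a * ∑ n ∈ T, ((2 : ℝ≥0∞) ^ (n : ℝ)) ^ a := by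
  rcases T.eq_empty_or_nonempty with rfl | hne
  · simp [ENNReal.zero_rpow_of_pos ha]
  · have hmem := T.max'_mem hne
    calc (∑ n ∈ T, (2 : ℝ≥0∞) ^ (n : ℝ)) ^ a ≤ (2 ^ ((T.max' hne + 1 : ℤ) : ℝ)) ^ a := by
          gcongr
          exact ENNReal.sum_two_rpow_le T _ fun n hn => Int.lt_add_one_of_le (T.le_max' n hn)
      _ = 2 ^ a * (2 ^ ((T.max' hne : ℤ) : ℝ)) ^ a := by
          push_cast
          rw [ENNReal.rpow_add _ _ (by norm_num) (by norm_num), ENNReal.rpow_one,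
            ENNReal.mul_rpow_of_nonneg _ _ ha.le, mul_comm]
      _ ≤ _ := by
          gcongr
          exact Finset.single_le_sum_of_canonicallyOrdered
            (f := fun n : ℤ => ((2 : ℝ≥0∞) ^ (n : ℝ)) ^ a) hmem

/-- Minkowski's inequality for a finite sum of integrals. -/
theorem ENNReal.sum_lintegral_rpow_le {α : Type*} [MeasurableSpace α] {μ : Measure α} {ι : Type*}
    (S : Finset ι) {g : ι → α → ℝ≥0∞} (hg : ∀ k, Measurable (g k)) {r : ℝ} (hr : 1 ≤ r) :
    ∑ k ∈ S, (∫⁻ t, g k t ∂μ) ^ r ≤ (∫⁻ t, (∑ k ∈ S, g k t ^ r) ^ (1 / r) ∂μ) ^ r := by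
  have hr0 : 0 < r := by linarith
  rcases hr.eq_or_lt with rfl | hr1
  · simp only [ENNReal.rpow_one, div_one]
    rw [lintegral_finsetSum _ fun k _ => hg k]
  set I : ι → ℝ≥0∞ := fun k => ∫⁻ t, g k t ∂μ with hI
  set J := ∫⁻ t, (∑ k ∈ S, g k t ^ r) ^ (1 / r) ∂μ with hJ
  have hIJ : ∀ k ∈ S, I k ≤ J := by
    intro k hk
    refine lintegral_mono fun t => ?_
    calc g k t = (g k t ^ r) ^ (1 / r) := by
          rw [← ENNReal.rpow_mul, mul_one_div_cancel hr0.ne', ENNReal.rpow_one]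
      _ ≤ _ := by
          gcongr
          exact Finset.single_le_sum_of_canonicallyOrdered (f := fun k => g k t ^ r) hk
  by_cases hJt : J = ⊤
  · rw [hJt, ENNReal.top_rpow_of_pos hr0]; exact le_top
  set D := ∑ k ∈ S, I k ^ r with hD
  have hDt : D ≠ ⊤ := ENNReal.sum_ne_top.2 fun k hk =>
    ENNReal.rpow_ne_top_of_nonneg hr0.le (ne_top_of_le_ne_top hJt (hIJ k hk))
  by_cases hD0 : D = 0
  · rw [hD0]; exact zero_le
  have hconj : r.HolderConjugate (Real.conjExponent r) := Real.HolderConjugate.conjExponent hr1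
  set r' := Real.conjExponent r with hr'
  have hr'0 : 0 < r' := hconj.symm.pos
  have key : D ≤ J * D ^ (1 / r') := by
    calc D = ∑ k ∈ S, I k * I k ^ (r - 1) := by
          refine Finset.sum_congr rfl fun k _ => ?_
          conv_lhs => rw [show r = 1 + (r - 1) by ring]
          rw [ENNReal.rpow_add_of_nonneg _ _ (by norm_num) (by linarith), ENNReal.rpow_one]
      _ = ∫⁻ t, ∑ k ∈ S, g k t * I k ^ (r - 1) ∂μ := by
          rw [lintegral_finsetSum _ fun k _ => (hg k).mul_const _]
          refine Finset.sum_congr rfl fun k _ => ?_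
          rw [lintegral_mul_const _ (hg k)]
      _ ≤ ∫⁻ t, (∑ k ∈ S, g k t ^ r) ^ (1 / r) * D ^ (1 / r') ∂μ := by
          refine lintegral_mono fun t => ?_
          refine (ENNReal.inner_le_Lp_mul_Lq S (fun k => g k t) (fun k => I k ^ (r - 1))
            hconj).trans (le_of_eq ?_)
          have h : ∀ k, (I k ^ (r - 1)) ^ r' = I k ^ r := fun k => by
            rw [← ENNReal.rpow_mul, hconj.sub_one_mul_conj]
          simp_rw [h, hD]
      _ = _ := lintegral_mul_const' _ _ (ENNReal.rpow_ne_top_of_nonneg (by positivity) hDt)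
  have hsum : 1 / r' = 1 - 1 / r := by
    have := hconj.inv_add_inv_eq_one
    simp only [one_div]; linarith
  have hfin : D ^ (1 / r) ≤ J := by
    have h1 : D = D ^ (1 / r) * D ^ (1 / r') := by
      rw [← ENNReal.rpow_add _ _ hD0 hDt, hsum]; simp
    have h2 : D ^ (1 / r) * D ^ (1 / r') ≤ J * D ^ (1 / r') := by rw [← h1]; exact key
    exact (ENNReal.mul_le_mul_iff_left (ENNReal.rpow_pos (pos_iff_ne_zero.2 hD0) hDt).ne'
      (ENNReal.rpow_ne_top_of_nonneg (by positivity) hDt)).1 h2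
  calc D = (D ^ (1 / r)) ^ r := by
        rw [← ENNReal.rpow_mul, one_div_mul_cancel hr0.ne', ENNReal.rpow_one]
    _ ≤ J ^ r := by gcongr

theorem sum_dualNorm_sq_le {P a : ℝ} (hP : 2 ≤ P) (ha : 0 < a) (ha2 : a ≤ 2) (S : Finset ℤ)
    {f : ℤ → ℝ → ℝ≥0∞} (hf : ∀ k, Measurable (f k)) :
    ∑ k ∈ S, dualNorm P (f k) ^ 2 ≤ dualNorm P (fun t => (∑ k ∈ S, f k t ^ a) ^ (1 / a)) ^ 2 := by
  have hP0 : 0 < P := by linarith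
  have hP1 : 1 / P ≤ 1 / 2 := one_div_le_one_div_of_le (by norm_num) hP
  have hP1' : 0 < 1 / P := by positivity
  set c : ℝ := 1 - 1 / P with hc
  have hc0 : 0 < c := by linarith
  have hr : 1 ≤ 2 * c := by linarith
  have hsq : ∀ g : ℝ → ℝ≥0∞, dualNorm P g ^ 2 = (∫⁻ t, g t ^ c⁻¹) ^ (2 * c) := by
    intro g
    rw [dualNorm, ← ENNReal.rpow_natCast, ← ENNReal.rpow_mul]
    congr 1; push_cast; ring
  simp_rw [hsq]
  refine (ENNReal.sum_lintegral_rpow_le S (g := fun k t => f k t ^ c⁻¹)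
    (fun k => (hf k).pow_const _) hr).trans ?_
  gcongr with t
  have h1 : ∑ k ∈ S, (f k t ^ c⁻¹) ^ (2 * c) ≤ (∑ k ∈ S, f k t ^ a) ^ (2 / a) := by
    refine le_trans (le_of_eq ?_) (ENNReal.sum_rpow_le_rpow_sum S (fun k => f k t ^ a)
      (s := 2 / a) ((one_le_div ha).2 ha2))
    refine Finset.sum_congr rfl fun k _ => ?_
    rw [← ENNReal.rpow_mul, ← ENNReal.rpow_mul]
    congr 1; field_simp
  calc _ ≤ ((∑ k ∈ S, f k t ^ a) ^ (2 / a)) ^ (1 / (2 * c)) := by gcongr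
    _ = _ := by
      rw [← ENNReal.rpow_mul, ← ENNReal.rpow_mul]
      congr 1; field_simp

section
variable {X : Type*}

/-- The `n`-th dyadic level set of `F`. -/
def levelSet (F : ℝ × X → ℂ) (n : ℤ) : Set (ℝ × X) :=
  {z | (2 : ℝ≥0∞) ^ (n : ℝ) ≤ ‖F z‖ₑ ∧ ‖F z‖ₑ < 2 ^ ((n : ℝ) + 1)}

theorem mem_levelSet {F : ℝ × X → ℂ} {n : ℤ} {z : ℝ × X} : z ∈ levelSet F n ↔
    (2 : ℝ≥0∞) ^ (n : ℝ) ≤ ‖F z‖ₑ ∧ ‖F z‖ₑ < 2 ^ ((n : ℝ) + 1) := Iff.rfl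

variable [MeasurableSpace X]

/-- Times at which the `n`-th level set has measure comparable to `2 ^ (σ k) / B`. -/
def levelTimes (μ : Measure X) (B : ℝ≥0∞) (σ : ℝ) (F : ℝ × X → ℂ) (k n : ℤ) : Set ℝ :=
  {t | (2 : ℝ≥0∞) ^ (σ * k) ≤ B * μ (Prod.mk t ⁻¹' levelSet F n) ∧
    B * μ (Prod.mk t ⁻¹' levelSet F n) < 2 ^ (σ * (k + 1))}

/-- The part of the `n`-th level set at the times where its measure is of size `2 ^ (σ k) / B`. -/
def atomSet (μ : Measure X) (B : ℝ≥0∞) (σ : ℝ) (F : ℝ × X → ℂ) (k n : ℤ) : Set (ℝ × X) :=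
  levelSet F n ∩ Prod.fst ⁻¹' levelTimes μ B σ F k n

theorem mem_levelTimes {μ : Measure X} {B : ℝ≥0∞} {σ : ℝ} {F : ℝ × X → ℂ} {k n : ℤ} {t : ℝ} :
    t ∈ levelTimes μ B σ F k n ↔ (2 : ℝ≥0∞) ^ (σ * k) ≤ B * μ (Prod.mk t ⁻¹' levelSet F n) ∧
    B * μ (Prod.mk t ⁻¹' levelSet F n) < 2 ^ (σ * (k + 1)) := Iff.rfl

theorem mem_atomSet {μ : Measure X} {B : ℝ≥0∞} {σ : ℝ} {F : ℝ × X → ℂ} {k n : ℤ} {z : ℝ × X} :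
    z ∈ atomSet μ B σ F k n ↔ z ∈ levelSet F n ∧ z.1 ∈ levelTimes μ B σ F k n := Iff.rfl

theorem measurableSet_levelSet {F : ℝ × X → ℂ} (hF : Measurable F) (n : ℤ) :
    MeasurableSet (levelSet F n) := by
  unfold levelSet
  exact (measurableSet_le measurable_const hF.enorm).inter
    (measurableSet_lt hF.enorm measurable_const)

theorem measurableSet_levelTimes {μ : Measure X} [SFinite μ] {B : ℝ≥0∞} {σ : ℝ} {F : ℝ × X → ℂ}
    (hF : Measurable F) (k n : ℤ) : MeasurableSet (levelTimes μ B σ F k n) := by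
  have h : Measurable fun t => B * μ (Prod.mk t ⁻¹' levelSet F n) :=
    (measurable_measure_prodMk_left (measurableSet_levelSet hF n)).const_mul B
  unfold levelTimes
  exact (measurableSet_le measurable_const h).inter (measurableSet_lt h measurable_const)

theorem measurableSet_atomSet {μ : Measure X} [SFinite μ] {B : ℝ≥0∞} {σ : ℝ} {F : ℝ × X → ℂ}
    (hF : Measurable F) (k n : ℤ) : MeasurableSet (atomSet μ B σ F k n) :=
  (measurableSet_levelSet hF n).inter (measurable_fst (measurableSet_levelTimes hF k n))

theorem int_eq_of_rpow_Ico {σ : ℝ} (hσ : 0 < σ) {m n : ℤ} {y : ℝ≥0∞}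
    (hm : (2 : ℝ≥0∞) ^ (σ * m) ≤ y) (hm' : y < 2 ^ (σ * (m + 1)))
    (hn : (2 : ℝ≥0∞) ^ (σ * n) ≤ y) (hn' : y < 2 ^ (σ * (n + 1))) : m = n := by
  have key : ∀ a b : ℤ, (2 : ℝ≥0∞) ^ (σ * a) ≤ y → y < 2 ^ (σ * (b + 1)) → a ≤ b := by
    intro a b ha hb
    by_contra! hlt
    refine absurd (ha.trans_lt hb) (not_lt.2 ?_)
    refine ENNReal.rpow_le_rpow_of_exponent_le (by norm_num) ?_
    have : (b : ℝ) + 1 ≤ a := by exact_mod_cast hlt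
    gcongr
  exact le_antisymm (key _ _ hm hn') (key _ _ hn hm')

theorem atomSet_index_unique {μ : Measure X} {B : ℝ≥0∞} {σ : ℝ} (hσ : 0 < σ) {F : ℝ × X → ℂ}
    {k n k' n' : ℤ} {z : ℝ × X} (h : z ∈ atomSet μ B σ F k n) (h' : z ∈ atomSet μ B σ F k' n') :
    k = k' ∧ n = n' := by
  rw [mem_atomSet, mem_levelSet, mem_levelTimes] at h h'
  obtain ⟨⟨a1, a2⟩, a3, a4⟩ := h
  obtain ⟨⟨b1, b2⟩, b3, b4⟩ := h'
  have hn : n = n' := int_eq_of_rpow_Ico (σ := 1) one_pos (by simpa using a1) (by simpa using a2)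
    (by simpa using b1) (by simpa using b2)
  subst hn
  exact ⟨int_eq_of_rpow_Ico hσ a3 a4 b3 b4, rfl⟩

theorem exists_rpow_Ico {σ : ℝ} (hσ : 0 < σ) {y : ℝ≥0∞} (h0 : y ≠ 0) (ht : y ≠ ⊤) :
    ∃ n : ℤ, (2 : ℝ≥0∞) ^ (σ * n) ≤ y ∧ y < 2 ^ (σ * (n + 1)) := by
  obtain ⟨n, hn⟩ := ENNReal.exists_mem_Ico_zpow h0 ht (y := (2 : ℝ≥0∞) ^ σ)
    (ENNReal.one_lt_rpow (by norm_num) hσ) (ENNReal.rpow_ne_top_of_nonneg hσ.le (by norm_num))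
  refine ⟨n, ?_, ?_⟩
  · rw [ENNReal.rpow_mul, ENNReal.rpow_intCast]; exact hn.1
  · have : ((n : ℝ) + 1) = ((n + 1 : ℤ) : ℝ) := by push_cast; rfl
    rw [this, ENNReal.rpow_mul, ENNReal.rpow_intCast]; exact hn.2

/-- Almost every point where `F` does not vanish belongs to some atom. -/
theorem ae_exists_mem_atomSet {μ : Measure X} [SFinite μ] {B : ℝ≥0∞} (hB0 : B ≠ 0) (hB : B ≠ ⊤)
    {σ : ℝ} (hσ : 0 < σ) {F : ℝ × X → ℂ} (hF : Measurable F)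
    (hFi : Integrable F (volume.prod μ)) :
    ∀ᵐ z ∂(volume.prod μ), F z ≠ 0 → ∃ k n, z ∈ atomSet μ B σ F k n := by
  have hfin : ∀ᵐ z ∂((volume : Measure ℝ).prod μ), ∫⁻ x, ‖F (z.1, x)‖ₑ ∂μ ≠ ⊤ := by
    have h1 : ∀ᵐ t : ℝ, ∫⁻ x, ‖F (t, x)‖ₑ ∂μ ≠ ⊤ := by
      have h2 := hFi.2
      rw [HasFiniteIntegral, lintegral_prod _ hF.enorm.aemeasurable] at h2
      filter_upwards [ae_lt_top (Measurable.lintegral_prod_right' hF.enorm) h2.ne] with t ht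
      exact ht.ne
    exact (Measure.quasiMeasurePreserving_fst (μ := volume) (ν := μ)).ae h1
  have hnull : ∀ᵐ z ∂((volume : Measure ℝ).prod μ), ∀ n : ℤ, z ∈ levelSet F n →
      μ (Prod.mk z.1 ⁻¹' levelSet F n) ≠ 0 := by
    rw [ae_all_iff]
    intro n
    have hm := measurableSet_levelSet hF n
    have hm' : MeasurableSet {z : ℝ × X | μ (Prod.mk z.1 ⁻¹' levelSet F n) = 0} :=
      ((measurable_measure_prodMk_left hm).comp measurable_fst) (measurableSet_singleton 0)
    have : (volume.prod μ) (levelSet F n ∩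
        {z : ℝ × X | μ (Prod.mk z.1 ⁻¹' levelSet F n) = 0}) = 0 := by
      rw [Measure.prod_apply (hm.inter hm')]
      simp only [lintegral_eq_zero_iff (measurable_measure_prodMk_left (hm.inter hm'))]
      refine Filter.Eventually.of_forall fun t => ?_
      by_cases ht : μ (Prod.mk t ⁻¹' levelSet F n) = 0
      · exact measure_mono_null (fun x hx => hx.1) ht
      · have : Prod.mk t ⁻¹' (levelSet F n ∩
            {z : ℝ × X | μ (Prod.mk z.1 ⁻¹' levelSet F n) = 0}) = ∅ := by
          ext x
          simp [ht]
        simp only [this, measure_empty, Pi.zero_apply]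
    rw [ae_iff]
    refine measure_mono_null (fun z hz => ?_) this
    simpa using hz
  filter_upwards [hfin, hnull] with z hz1 hz2 hz
  obtain ⟨n, hn1, hn2⟩ := exists_rpow_Ico (σ := 1) one_pos (y := ‖F z‖ₑ) (by simpa using hz)
    enorm_ne_top
  have hzn : z ∈ levelSet F n := by
    rw [mem_levelSet]
    exact ⟨by simpa using hn1, by simpa using hn2⟩
  have hpos := hz2 n hzn
  have htop : μ (Prod.mk z.1 ⁻¹' levelSet F n) ≠ ⊤ := by
    intro htop
    refine hz1 (top_le_iff.1 ?_)
    have h2 : (2 : ℝ≥0∞) ^ (n : ℝ) ≠ 0 :=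
      (ENNReal.rpow_pos (by norm_num) (by norm_num)).ne'
    calc (⊤ : ℝ≥0∞) = 2 ^ (n : ℝ) * μ (Prod.mk z.1 ⁻¹' levelSet F n) := by
          rw [htop, ENNReal.mul_top h2]
      _ ≤ 2 ^ (n : ℝ) * μ {x | (2 : ℝ≥0∞) ^ (n : ℝ) ≤ ‖F (z.1, x)‖ₑ} := by
          gcongr
          intro x hx
          exact (mem_levelSet.1 hx).1
      _ ≤ _ := mul_meas_ge_le_lintegral (hF.enorm.comp measurable_prodMk_left) _
  obtain ⟨k, hk⟩ := exists_rpow_Ico hσ (y := B * μ (Prod.mk z.1 ⁻¹' levelSet F n))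
    (mul_ne_zero hB0 hpos) (ENNReal.mul_ne_top hB htop)
  exact ⟨k, n, mem_atomSet.2 ⟨hzn, mem_levelTimes.2 hk⟩⟩
end

section
variable {X : Type*} [MeasurableSpace X]

/-- The union of the atoms with measure index `k` and height index at most `K` in absolute value. -/
def atomPiece (μ : Measure X) (B : ℝ≥0∞) (σ : ℝ) (F : ℝ × X → ℂ) (K k : ℤ) : Set (ℝ × X) :=
  ⋃ n ∈ Finset.Icc (-K) K, atomSet μ B σ F k n

open Classical in
/-- The heights `n` that are active at time `t` for the measure index `k`. -/
noncomputable def activeLevels (μ : Measure X) (B : ℝ≥0∞) (σ : ℝ) (F : ℝ × X → ℂ) (K k : ℤ)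
    (t : ℝ) : Finset ℤ :=
  (Finset.Icc (-K) K).filter fun n => t ∈ levelTimes μ B σ F k n

/-- The sum of the active heights. -/
noncomputable def levelSum (μ : Measure X) (B : ℝ≥0∞) (σ : ℝ) (F : ℝ × X → ℂ) (K k : ℤ)
    (t : ℝ) : ℝ≥0∞ :=
  ∑ n ∈ activeLevels μ B σ F K k t, (2 : ℝ≥0∞) ^ (n : ℝ)

variable {μ : Measure X} {B : ℝ≥0∞} {σ : ℝ} {F : ℝ × X → ℂ}

theorem mem_activeLevels {K k n : ℤ} {t : ℝ} : n ∈ activeLevels μ B σ F K k t ↔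
    n ∈ Finset.Icc (-K) K ∧ t ∈ levelTimes μ B σ F k n := by
  simp [activeLevels]

theorem mem_atomPiece {K k : ℤ} {z : ℝ × X} : z ∈ atomPiece μ B σ F K k ↔
    ∃ n ∈ Finset.Icc (-K) K, z ∈ atomSet μ B σ F k n := by
  simp [atomPiece]

theorem measurableSet_atomPiece [SFinite μ] (hF : Measurable F) (K k : ℤ) :
    MeasurableSet (atomPiece μ B σ F K k) :=
  Finset.measurableSet_biUnion _ fun n _ => measurableSet_atomSet hF k n

theorem measurable_levelSum [SFinite μ] (hF : Measurable F) (K k : ℤ) :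
    Measurable (levelSum μ B σ F K k) := by
  classical
  unfold levelSum activeLevels
  simp_rw [Finset.sum_filter]
  refine Finset.measurable_fun_sum _ fun n _ => ?_
  exact Measurable.ite (show MeasurableSet {t | t ∈ levelTimes μ B σ F k n} from
    measurableSet_levelTimes hF k n) measurable_const
    measurable_const

theorem lintegral_atomPiece_rpow_le [SFinite μ] (hB0 : B ≠ 0) (hB : B ≠ ⊤) (hF : Measurable F)
    {a : ℝ} (ha : 0 < a) (K k : ℤ) (t : ℝ) :
    ∫⁻ x, ‖(atomPiece μ B σ F K k).indicator F (t, x)‖ₑ ^ a ∂μ ≤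
      2 ^ a * (2 ^ (σ * (k + 1)) * B⁻¹) *
        ∑ n ∈ activeLevels μ B σ F K k t, ((2 : ℝ≥0∞) ^ (n : ℝ)) ^ a := by
  have hlev : ∀ n, MeasurableSet (Prod.mk t ⁻¹' levelSet F n) := fun n =>
    measurable_prodMk_left (measurableSet_levelSet hF n)
  calc ∫⁻ x, ‖(atomPiece μ B σ F K k).indicator F (t, x)‖ₑ ^ a ∂μ
      ≤ ∫⁻ x, ∑ n ∈ activeLevels μ B σ F K k t, (Prod.mk t ⁻¹' levelSet F n).indicator
          (fun _ => 2 ^ a * ((2 : ℝ≥0∞) ^ (n : ℝ)) ^ a) x ∂μ := by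
        refine lintegral_mono fun x => ?_
        by_cases hx : (t, x) ∈ atomPiece μ B σ F K k
        · obtain ⟨n, hn, hxn⟩ := mem_atomPiece.1 hx
          obtain ⟨h1, h2⟩ := mem_atomSet.1 hxn
          rw [Set.indicator_of_mem hx]
          refine le_trans ?_ (Finset.single_le_sum_of_canonicallyOrdered
            (f := fun n => (Prod.mk t ⁻¹' levelSet F n).indicator
              (fun _ => 2 ^ a * ((2 : ℝ≥0∞) ^ (n : ℝ)) ^ a) x) (mem_activeLevels.2 ⟨hn, h2⟩))
          have hx' : x ∈ Prod.mk t ⁻¹' levelSet F n := h1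
          simp only [hx', Set.indicator_of_mem]
          rw [← ENNReal.mul_rpow_of_nonneg _ _ ha.le]
          gcongr
          refine (mem_levelSet.1 h1).2.le.trans (le_of_eq ?_)
          rw [ENNReal.rpow_add _ _ (by norm_num) (by norm_num), ENNReal.rpow_one, mul_comm]
        · rw [Set.indicator_of_notMem hx, enorm_zero, ENNReal.zero_rpow_of_pos ha]
          exact zero_le
    _ = ∑ n ∈ activeLevels μ B σ F K k t,
          2 ^ a * ((2 : ℝ≥0∞) ^ (n : ℝ)) ^ a * μ (Prod.mk t ⁻¹' levelSet F n) := by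
        rw [lintegral_finsetSum _ fun n _ => measurable_const.indicator (hlev n)]
        refine Finset.sum_congr rfl fun n _ => ?_
        rw [lintegral_indicator (hlev n), lintegral_const, Measure.restrict_apply MeasurableSet.univ,
          Set.univ_inter]
    _ ≤ ∑ n ∈ activeLevels μ B σ F K k t,
          2 ^ a * ((2 : ℝ≥0∞) ^ (n : ℝ)) ^ a * (2 ^ (σ * (k + 1)) * B⁻¹) := by
        refine Finset.sum_le_sum fun n hn => ?_
        gcongr
        have h := (mem_levelTimes.1 (mem_activeLevels.1 hn).2).2.le
        rw [← div_eq_mul_inv, ENNReal.le_div_iff_mul_le (Or.inl hB0) (Or.inl hB), mul_comm]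
        exact h
    _ = _ := by
        rw [Finset.mul_sum]
        exact Finset.sum_congr rfl fun n _ => by ring

theorem sum_activeLevels_le (hσ : 0 < σ) (hF : Measurable F) {a : ℝ} (ha : 0 < a)
    (K : ℤ) (S : Finset ℤ) (t : ℝ) :
    ∑ k ∈ S, ∑ n ∈ activeLevels μ B σ F K k t, 2 ^ (σ * k) * ((2 : ℝ≥0∞) ^ (n : ℝ)) ^ a ≤
      B * ∫⁻ x, ‖F (t, x)‖ₑ ^ a ∂μ := by
  have hlev : ∀ n, MeasurableSet (Prod.mk t ⁻¹' levelSet F n) := fun n =>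
    measurable_prodMk_left (measurableSet_levelSet hF n)
  rw [Finset.sum_sigma']
  calc _ ≤ ∑ i ∈ S.sigma fun k => activeLevels μ B σ F K k t,
          B * ∫⁻ x in Prod.mk t ⁻¹' levelSet F i.2, ‖F (t, x)‖ₑ ^ a ∂μ := by
        refine Finset.sum_le_sum fun i hi => ?_
        have hi2 := (mem_activeLevels.1 (Finset.mem_sigma.1 hi).2).2
        calc 2 ^ (σ * i.1) * ((2 : ℝ≥0∞) ^ (i.2 : ℝ)) ^ a
            ≤ B * μ (Prod.mk t ⁻¹' levelSet F i.2) * ((2 : ℝ≥0∞) ^ (i.2 : ℝ)) ^ a := by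
              gcongr
              exact (mem_levelTimes.1 hi2).1
          _ = B * ∫⁻ x in Prod.mk t ⁻¹' levelSet F i.2, ((2 : ℝ≥0∞) ^ (i.2 : ℝ)) ^ a ∂μ := by
              rw [setLIntegral_const]; ring
          _ ≤ _ := by
              refine mul_le_mul' le_rfl (setLIntegral_mono' (hlev _) fun x hx => ?_)
              gcongr
              exact (mem_levelSet.1 hx).1
    _ = B * ∫⁻ x in ⋃ i ∈ S.sigma fun k => activeLevels μ B σ F K k t,
          Prod.mk t ⁻¹' levelSet F i.2, ‖F (t, x)‖ₑ ^ a ∂μ := by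
        rw [lintegral_biUnion_finset _ (fun i _ => hlev i.2), Finset.mul_sum]
        intro i hi j hj hij
        refine Set.disjoint_left.2 fun x hx hx' => hij ?_
        have hi2 := (mem_activeLevels.1 (Finset.mem_sigma.1 hi).2).2
        have hj2 := (mem_activeLevels.1 (Finset.mem_sigma.1 hj).2).2
        obtain ⟨h1, h2⟩ := atomSet_index_unique hσ (z := (t, x)) (mem_atomSet.2 ⟨hx, hi2⟩)
          (mem_atomSet.2 ⟨hx', hj2⟩)
        obtain ⟨k, n⟩ := i
        obtain ⟨k', n'⟩ := j
        simp only at h1 h2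
        rw [h1, h2]
    _ ≤ _ := by
        gcongr
        exact Measure.restrict_le_self

end

/-- A bounded family of vectors `e (t, x)` whose synthesis operators are contractions on `L²` at
each time, and whose Gram kernel decays like `B |t - s| ^ (-σ)`. -/
structure IsDispersiveFamily {X H : Type*} [MeasurableSpace X] [NormedAddCommGroup H]
    [InnerProductSpace ℂ H] (μ : Measure X) (B : ℝ≥0∞) (σ : ℝ) (e : ℝ × X → H) : Prop where
  stronglyMeasurable : StronglyMeasurable e
  bounded : ∃ M : ℝ, ∀ z, ‖e z‖ ≤ M
  energy : ∀ (t : ℝ) (g : X → ℂ), Integrable g μ →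
    ‖∫ x, g x • e (t, x) ∂μ‖ₑ ^ 2 ≤ ∫⁻ x, ‖g x‖ₑ ^ 2 ∂μ
  dispersive : ∀ s t x y, ‖inner ℂ (e (s, x)) (e (t, y))‖ₑ ≤ B * ‖t - s‖ₑ ^ (-σ)

theorem enorm_inner_integral_smul_le {X H : Type*} [MeasurableSpace X] [NormedAddCommGroup H]
    [InnerProductSpace ℂ H] [CompleteSpace H] {μ : Measure X} {g h : X → ℂ} {e e' : X → H}
    (hg : Integrable (fun x => g x • e x) μ) (hh : Integrable (fun x => h x • e' x) μ) {M : ℝ≥0∞}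
    (hgm : Measurable g) (hhm : Measurable h)
    (hM : ∀ x y, ‖inner ℂ (e x) (e' y)‖ₑ ≤ M) :
    ‖inner ℂ (∫ x, g x • e x ∂μ) (∫ x, h x • e' x ∂μ)‖ₑ ≤
      M * (∫⁻ x, ‖g x‖ₑ ∂μ) * ∫⁻ x, ‖h x‖ₑ ∂μ := by
  have h1 : ∀ y, ‖inner ℂ (∫ x, g x • e x ∂μ) (e' y)‖ₑ ≤ M * ∫⁻ x, ‖g x‖ₑ ∂μ := by
    intro y
    rw [← inner_conj_symm (𝕜 := ℂ), RCLike.enorm_conj, ← integral_inner (𝕜 := ℂ) hg,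
      ← lintegral_const_mul _ hgm.enorm]
    refine (enorm_integral_le_lintegral_enorm _).trans (lintegral_mono fun x => ?_)
    rw [inner_smul_right, enorm_mul, mul_comm, ← inner_conj_symm (𝕜 := ℂ), RCLike.enorm_conj]
    gcongr
    exact hM x y
  rw [← integral_inner (𝕜 := ℂ) hh, ← lintegral_const_mul _ hhm.enorm]
  refine (enorm_integral_le_lintegral_enorm _).trans (lintegral_mono fun x => ?_)
  rw [inner_smul_right, enorm_mul, mul_comm]
  gcongr
  exact h1 x

theorem dualNorm_const_mul {P : ℝ} (hP : 1 < P) {c : ℝ≥0∞} (hc : c ≠ ⊤) (f : ℝ → ℝ≥0∞) :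
    dualNorm P (fun t => c * f t) = c * dualNorm P f := by
  have h1 : 1 / P < 1 := by rw [div_lt_one (by linarith)]; exact hP
  have h0 : 0 < 1 - 1 / P := by linarith
  unfold dualNorm
  simp_rw [ENNReal.mul_rpow_of_nonneg _ _ (inv_pos.2 h0).le]
  rw [lintegral_const_mul' _ _ (ENNReal.rpow_ne_top_of_nonneg (inv_pos.2 h0).le hc),
    ENNReal.mul_rpow_of_nonneg _ _ h0.le, ← ENNReal.rpow_mul, inv_mul_cancel₀ h0.ne',
    ENNReal.rpow_one]

theorem dualNorm_mono {P : ℝ} (hP : 1 < P) {f g : ℝ → ℝ≥0∞} (h : ∀ t, f t ≤ g t) :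
    dualNorm P f ≤ dualNorm P g := by
  have h1 : 1 / P < 1 := by rw [div_lt_one (by linarith)]; exact hP
  have h0 : 0 < 1 - 1 / P := by linarith
  unfold dualNorm
  gcongr with t
  exact h t

section
variable {X : Type*} [MeasurableSpace X] {μ : Measure X} {B : ℝ≥0∞} {σ : ℝ} {F : ℝ × X → ℂ}

/-- The size of the piece of `F` of measure index `k` at time `t`. -/
noncomputable def pieceSize (μ : Measure X) (B : ℝ≥0∞) (σ P : ℝ) (F : ℝ × X → ℂ) (K k : ℤ)
    (t : ℝ) : ℝ≥0∞ :=
  2 * 2 ^ σ * B ^ (-(1 / 2) : ℝ) * 2 ^ ((σ / 2 + 1 / P) * k) * levelSum μ B σ F K k t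

theorem lintegral_atomPiece_le [SFinite μ] (hB0 : B ≠ 0) (hB : B ≠ ⊤) (hF : Measurable F)
    (K k : ℤ) (t : ℝ) :
    ∫⁻ x, ‖(atomPiece μ B σ F K k).indicator F (t, x)‖ₑ ∂μ ≤
      2 * (2 ^ (σ * (k + 1)) * B⁻¹) * levelSum μ B σ F K k t := by
  have := lintegral_atomPiece_rpow_le (μ := μ) (σ := σ) hB0 hB hF one_pos K k t
  simpa [levelSum] using this

theorem lintegral_atomPiece_sq_le [SFinite μ] (hB0 : B ≠ 0) (hB : B ≠ ⊤) (hF : Measurable F)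
    (K k : ℤ) (t : ℝ) :
    ∫⁻ x, ‖(atomPiece μ B σ F K k).indicator F (t, x)‖ₑ ^ 2 ∂μ ≤
      4 * (2 ^ (σ * (k + 1)) * B⁻¹) * levelSum μ B σ F K k t ^ 2 := by
  have := lintegral_atomPiece_rpow_le (μ := μ) (σ := σ) hB0 hB hF two_pos K k t
  have h4 : (2 : ℝ≥0∞) ^ (2 : ℝ) = 4 := by norm_num
  simp only [h4] at this
  refine le_trans (by simpa using this) (mul_le_mul' le_rfl ?_)
  simpa [levelSum] using ENNReal.sum_rpow_le_rpow_sum (activeLevels μ B σ F K k t)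
    (fun n => (2 : ℝ≥0∞) ^ (n : ℝ)) (s := 2) one_le_two

theorem levelSum_ne_top (K k : ℤ) (t : ℝ) : levelSum μ B σ F K k t ≠ ⊤ :=
  ENNReal.sum_ne_top.2 fun _ _ =>
    ENNReal.rpow_ne_top_of_ne_zero (by norm_num) (by norm_num)

theorem integrable_atomPiece [SFinite μ] (hB0 : B ≠ 0) (hB : B ≠ ⊤) (hF : Measurable F)
    (K k : ℤ) (t : ℝ) :
    Integrable (fun x => (atomPiece μ B σ F K k).indicator F (t, x)) μ := by
  refine ⟨((hF.indicator (measurableSet_atomPiece hF K k)).comp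
    measurable_prodMk_left).aestronglyMeasurable, ?_⟩
  refine (lintegral_atomPiece_le hB0 hB hF K k t).trans_lt ?_
  exact ENNReal.mul_lt_top (ENNReal.mul_lt_top (by norm_num) (ENNReal.mul_lt_top
    (ENNReal.rpow_ne_top_of_ne_zero (by norm_num) (by norm_num)).lt_top
    (ENNReal.inv_ne_top.2 hB0).lt_top)) (levelSum_ne_top K k t).lt_top

theorem sum_pieceSize_rpow_le (hσ : 0 < σ) (hF : Measurable F)
    {P a : ℝ} (ha : 0 < a) (haσ : (σ / 2 + 1 / P) * a = σ) (K : ℤ) (S : Finset ℤ) (t : ℝ) :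
    ∑ k ∈ S, pieceSize μ B σ P F K k t ^ a ≤
      (2 * 2 ^ σ * B ^ (-(1 / 2) : ℝ)) ^ a * 2 ^ a * B * ∫⁻ x, ‖F (t, x)‖ₑ ^ a ∂μ := by
  calc ∑ k ∈ S, pieceSize μ B σ P F K k t ^ a
      ≤ ∑ k ∈ S, (2 * 2 ^ σ * B ^ (-(1 / 2) : ℝ)) ^ a * (2 ^ (σ * k) *
          (2 ^ a * ∑ n ∈ activeLevels μ B σ F K k t, ((2 : ℝ≥0∞) ^ (n : ℝ)) ^ a)) := by
        refine Finset.sum_le_sum fun k _ => ?_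
        rw [pieceSize, ENNReal.mul_rpow_of_nonneg _ _ ha.le, ENNReal.mul_rpow_of_nonneg _ _ ha.le,
          ← ENNReal.rpow_mul, mul_assoc]
        have : (σ / 2 + 1 / P) * k * a = σ * k := by linear_combination (k : ℝ) * haσ
        rw [this]
        gcongr
        exact ENNReal.rpow_sum_two_rpow_le _ ha
    _ = (2 * 2 ^ σ * B ^ (-(1 / 2) : ℝ)) ^ a * 2 ^ a * ∑ k ∈ S,
          ∑ n ∈ activeLevels μ B σ F K k t, 2 ^ (σ * k) * ((2 : ℝ≥0∞) ^ (n : ℝ)) ^ a := by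
        rw [Finset.mul_sum]
        refine Finset.sum_congr rfl fun k _ => ?_
        rw [← Finset.mul_sum]; ring
    _ ≤ (2 * 2 ^ σ * B ^ (-(1 / 2) : ℝ)) ^ a * 2 ^ a * (B * ∫⁻ x, ‖F (t, x)‖ₑ ^ a ∂μ) := by
        gcongr
        exact sum_activeLevels_le hσ hF ha K S t
    _ = _ := by ring

end

theorem ENNReal.rpow_neg_half_mul_self {B : ℝ≥0∞} (hB0 : B ≠ 0) (hB : B ≠ ⊤) :
    B ^ (-(1 / 2) : ℝ) * B ^ (-(1 / 2) : ℝ) = B⁻¹ := by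
  rw [← ENNReal.rpow_add _ _ hB0 hB, ← ENNReal.rpow_neg_one]
  norm_num

section
variable {X : Type*} [MeasurableSpace X] {μ : Measure X} {B : ℝ≥0∞} {σ P : ℝ} {F : ℝ × X → ℂ}

theorem measurable_pieceSize [SFinite μ] (hF : Measurable F) (K k : ℤ) :
    Measurable (pieceSize μ B σ P F K k) :=
  (measurable_levelSum hF K k).const_mul _

variable {H : Type*} [NormedAddCommGroup H] [InnerProductSpace ℂ H] {e : ℝ × X → H}

theorem IsDispersiveFamily.integrable_smul (he : IsDispersiveFamily μ B σ e)
    (hF : Integrable F (volume.prod μ)) :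
    Integrable (fun z => F z • e z) (volume.prod μ) := by
  obtain ⟨M, hM⟩ := he.bounded
  refine (hF.norm.mul_const M).mono' (hF.1.smul he.stronglyMeasurable.aestronglyMeasurable) ?_
  refine Filter.Eventually.of_forall fun z => ?_
  rw [norm_smul]
  exact mul_le_mul_of_nonneg_left (hM z) (norm_nonneg _)

theorem IsDispersiveFamily.integrable_smul_section (he : IsDispersiveFamily μ B σ e) (t : ℝ)
    {g : X → ℂ} (hg : Integrable g μ) : Integrable (fun x => g x • e (t, x)) μ := by
  obtain ⟨M, hM⟩ := he.bounded
  refine (hg.norm.mul_const M).mono' (hg.1.smul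
    (he.stronglyMeasurable.comp_measurable measurable_prodMk_left).aestronglyMeasurable) ?_
  refine Filter.Eventually.of_forall fun z => ?_
  rw [norm_smul]
  exact mul_le_mul_of_nonneg_left (hM _) (norm_nonneg _)

theorem IsDispersiveFamily.enorm_inner_pieces_le [SFinite μ] [CompleteSpace H]
    (he : IsDispersiveFamily μ B σ e)
    (hB0 : B ≠ 0) (hB : B ≠ ⊤) (hF : Measurable F) (K k l : ℤ) (s t : ℝ) :
    ‖inner ℂ (∫ x, (atomPiece μ B σ F K k).indicator F (s, x) • e (s, x) ∂μ)
        (∫ x, (atomPiece μ B σ F K l).indicator F (t, x) • e (t, x) ∂μ)‖ₑ ≤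
      2 ^ ((σ / 2 - 1 / P) * (k + l)) * ‖t - s‖ₑ ^ (-σ) *
        pieceSize μ B σ P F K k s * pieceSize μ B σ P F K l t := by
  have hm : ∀ k t, Measurable fun x => (atomPiece μ B σ F K k).indicator F (t, x) := fun k t =>
    (hF.indicator (measurableSet_atomPiece hF K k)).comp measurable_prodMk_left
  have h := enorm_inner_integral_smul_le
    (he.integrable_smul_section s (integrable_atomPiece hB0 hB hF K k s))
    (he.integrable_smul_section t (integrable_atomPiece hB0 hB hF K l t))
    (hm k s) (hm l t) (he.dispersive s t)
  refine h.trans ?_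
  calc _ ≤ B * ‖t - s‖ₑ ^ (-σ) *
        (2 * (2 ^ (σ * (k + 1)) * B⁻¹) * levelSum μ B σ F K k s) *
        (2 * (2 ^ (σ * (l + 1)) * B⁻¹) * levelSum μ B σ F K l t) := by
        gcongr
        · exact lintegral_atomPiece_le hB0 hB hF K k s
        · exact lintegral_atomPiece_le hB0 hB hF K l t
    _ = (B * B⁻¹) * B⁻¹ * (2 ^ (σ * (k + 1)) * 2 ^ (σ * (l + 1))) * (4 * ‖t - s‖ₑ ^ (-σ) *
          levelSum μ B σ F K k s * levelSum μ B σ F K l t) := by ring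
    _ = (B ^ (-(1 / 2) : ℝ) * B ^ (-(1 / 2) : ℝ)) * (2 ^ ((σ / 2 - 1 / P) * (k + l)) *
          2 ^ σ * 2 ^ σ * 2 ^ ((σ / 2 + 1 / P) * k) * 2 ^ ((σ / 2 + 1 / P) * l)) *
          (4 * ‖t - s‖ₑ ^ (-σ) * levelSum μ B σ F K k s * levelSum μ B σ F K l t) := by
        rw [ENNReal.mul_inv_cancel hB0 hB, one_mul, ENNReal.rpow_neg_half_mul_self hB0 hB]
        simp only [← ENNReal.rpow_add _ _ (two_ne_zero) (ofNat_ne_top)]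
        congr 3
        ring
    _ = _ := by unfold pieceSize; ring

theorem IsDispersiveFamily.enorm_piece_le [SFinite μ] [CompleteSpace H]
    (he : IsDispersiveFamily μ B σ e) (hσ : 0 ≤ σ)
    (hB0 : B ≠ 0) (hB : B ≠ ⊤) (hF : Measurable F) (K k : ℤ) (t : ℝ) :
    ‖∫ x, (atomPiece μ B σ F K k).indicator F (t, x) • e (t, x) ∂μ‖ₑ ≤
      2 ^ (-(k : ℝ) / P) * pieceSize μ B σ P F K k t := by
  refine (ENNReal.pow_le_pow_left_iff two_ne_zero).1 ?_
  refine (he.energy t _ (integrable_atomPiece hB0 hB hF K k t)).trans ?_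
  refine (lintegral_atomPiece_sq_le hB0 hB hF K k t).trans ?_
  calc _ = B⁻¹ * 2 ^ (σ * (k + 1)) * (4 * levelSum μ B σ F K k t ^ 2) := by ring
    _ ≤ B⁻¹ * 2 ^ (σ * (k + 2)) * (4 * levelSum μ B σ F K k t ^ 2) := by
        gcongr <;> norm_num
    _ = (B ^ (-(1 / 2) : ℝ) * B ^ (-(1 / 2) : ℝ)) * (2 ^ (-(k : ℝ) / P) * 2 ^ (-(k : ℝ) / P) *
          2 ^ σ * 2 ^ σ * 2 ^ ((σ / 2 + 1 / P) * k) * 2 ^ ((σ / 2 + 1 / P) * k)) *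
          (4 * levelSum μ B σ F K k t ^ 2) := by
        rw [ENNReal.rpow_neg_half_mul_self hB0 hB]
        simp only [← ENNReal.rpow_add _ _ (two_ne_zero) (ofNat_ne_top)]
        congr 3
        ring
    _ = _ := by unfold pieceSize; ring

theorem IsDispersiveFamily.isDispersive [SFinite μ] [CompleteSpace H]
    (he : IsDispersiveFamily μ B σ e) (hσ : 0 ≤ σ)
    (hB0 : B ≠ 0) (hB : B ≠ ⊤) (hF : Measurable F) (hFi : Integrable F (volume.prod μ)) (K k : ℤ) :
    IsDispersive P σ k (fun t => ∫ x, (atomPiece μ B σ F K k).indicator F (t, x) • e (t, x) ∂μ)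
      (pieceSize μ B σ P F K k) where
  integrable := (he.integrable_smul
    (hFi.indicator (measurableSet_atomPiece hF K k))).integral_prod_left
  measurable := measurable_pieceSize hF K k
  energy t := he.enorm_piece_le hσ hB0 hB hF K k t
  dispersive s t := by
    have := he.enorm_inner_pieces_le (P := P) hB0 hB hF K k k s t
    have h2 : (σ - 2 / P) * k = (σ / 2 - 1 / P) * (k + k) := by ring
    rwa [h2]

theorem IsDispersiveFamily.enorm_sum_pieces_le [SFinite μ] [CompleteSpace H]
    (he : IsDispersiveFamily μ B σ e) (hB0 : B ≠ 0) (hB : B ≠ ⊤) (hP : 2 ≤ P) (hσ : 2 / P < σ)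
    {a : ℝ} (ha : 0 < a) (ha2 : a ≤ 2) (haσ : (σ / 2 + 1 / P) * a = σ)
    (hF : Measurable F) (hFi : Integrable F (volume.prod μ)) (K : ℤ) (S : Finset ℤ) :
    ‖∑ k ∈ S, ∫ t, ∫ x, (atomPiece μ B σ F K k).indicator F (t, x) • e (t, x) ∂μ‖ₑ ≤
      16 * geomMass (min ((σ / 2 - 1 / P) / 3) (1 / (6 * P))) * 2 ^ σ * B ^ (1 / a - 1 / 2) *
        dualNorm P (fun t => (∫⁻ x, ‖F (t, x)‖ₑ ^ a ∂μ) ^ (1 / a)) := by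
  have hP1 : 1 < P := by linarith
  have hσ0 : 0 < σ := lt_trans (by positivity) hσ
  refine (ENNReal.pow_le_pow_left_iff two_ne_zero).1 ?_
  refine (enorm_sum_integral_sq_le hP hσ S
    (fun k _ => he.isDispersive hσ0.le hB0 hB hF hFi K k)
    (fun k _ l _ s t => he.enorm_inner_pieces_le hB0 hB hF K k l s t)).trans ?_
  have hc : 4 * 2 ^ σ * B ^ (1 / a - 1 / 2) ≠ ⊤ := ENNReal.mul_ne_top
    (ENNReal.mul_ne_top (by norm_num) (ENNReal.rpow_ne_top_of_ne_zero (by norm_num) (by norm_num)))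
    (ENNReal.rpow_ne_top_of_ne_zero hB0 hB)
  have h1 : ∑ k ∈ S, dualNorm P (pieceSize μ B σ P F K k) ^ 2 ≤
      (4 * 2 ^ σ * B ^ (1 / a - 1 / 2) *
        dualNorm P (fun t => (∫⁻ x, ‖F (t, x)‖ₑ ^ a ∂μ) ^ (1 / a))) ^ 2 := by
    refine (sum_dualNorm_sq_le hP ha ha2 S fun k => measurable_pieceSize hF K k).trans ?_
    rw [← dualNorm_const_mul hP1 hc]
    gcongr
    refine dualNorm_mono hP1 fun t => ?_
    calc _ ≤ ((2 * 2 ^ σ * B ^ (-(1 / 2) : ℝ)) ^ a * 2 ^ a * B *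
          ∫⁻ x, ‖F (t, x)‖ₑ ^ a ∂μ) ^ (1 / a) := by
          gcongr
          exact sum_pieceSize_rpow_le hσ0 hF ha haσ K S t
      _ = 4 * 2 ^ σ * (B ^ (1 / a) * B ^ (-(1 / 2) : ℝ)) *
          (∫⁻ x, ‖F (t, x)‖ₑ ^ a ∂μ) ^ (1 / a) := by
          have ha' : 0 ≤ 1 / a := by positivity
          rw [ENNReal.mul_rpow_of_nonneg _ _ ha', ENNReal.mul_rpow_of_nonneg _ _ ha',
            ENNReal.mul_rpow_of_nonneg _ _ ha', ← ENNReal.rpow_mul, ← ENNReal.rpow_mul,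
            mul_one_div_cancel ha.ne', ENNReal.rpow_one, ENNReal.rpow_one]
          ring
      _ = _ := by
          rw [← ENNReal.rpow_add _ _ hB0 hB, sub_eq_add_neg]
  calc _ ≤ 16 * geomMass (min ((σ / 2 - 1 / P) / 3) (1 / (6 * P))) ^ 2 *
      (4 * 2 ^ σ * B ^ (1 / a - 1 / 2) *
        dualNorm P (fun t => (∫⁻ x, ‖F (t, x)‖ₑ ^ a ∂μ) ^ (1 / a))) ^ 2 := by gcongr
    _ = _ := by ring

end

section
variable {X : Type*} [MeasurableSpace X] {μ : Measure X} {B : ℝ≥0∞} {σ P : ℝ} {F : ℝ × X → ℂ}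

open Classical in
theorem sum_atomPiece_indicator (hσ : 0 < σ) {k₀ n₀ : ℤ} {z : ℝ × X}
    (hz : z ∈ atomSet μ B σ F k₀ n₀) (K : ℤ) :
    ∑ k ∈ Finset.Icc (-K) K, (atomPiece μ B σ F K k).indicator F z =
      if k₀ ∈ Finset.Icc (-K) K ∧ n₀ ∈ Finset.Icc (-K) K then F z else 0 := by
  have hmem : ∀ k, z ∈ atomPiece μ B σ F K k ↔ k = k₀ ∧ n₀ ∈ Finset.Icc (-K) K := by
    intro k
    rw [mem_atomPiece]
    constructor
    · rintro ⟨n, hn, h⟩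
      obtain ⟨rfl, rfl⟩ := atomSet_index_unique hσ h hz
      exact ⟨rfl, hn⟩
    · rintro ⟨rfl, hn⟩
      exact ⟨n₀, hn, hz⟩
  simp only [Set.indicator_apply, hmem]
  by_cases hn : n₀ ∈ Finset.Icc (-K) K
  · simp [hn]
  · simp [hn]

theorem sum_atomPiece_indicator_of_eq_zero {z : ℝ × X} (hz : F z = 0) (K : ℤ) :
    ∑ k ∈ Finset.Icc (-K) K, (atomPiece μ B σ F K k).indicator F z = 0 := by
  refine Finset.sum_eq_zero fun k _ => ?_
  exact Set.indicator_apply_eq_zero.2 fun _ => hz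

variable {H : Type*} [NormedAddCommGroup H] [InnerProductSpace ℂ H] {e : ℝ × X → H}

/-- The inhomogeneous (dual) Strichartz estimate for a dispersive family. -/
theorem IsDispersiveFamily.enorm_integral_smul_le [SFinite μ] [CompleteSpace H]
    (he : IsDispersiveFamily μ B σ e) (hB0 : B ≠ 0) (hB : B ≠ ⊤) (hP : 2 ≤ P) (hσ : 2 / P < σ)
    {a : ℝ} (ha : 0 < a) (ha2 : a ≤ 2) (haσ : (σ / 2 + 1 / P) * a = σ)
    (hF : Measurable F) (hFi : Integrable F (volume.prod μ)) :
    ‖∫ z, F z • e z ∂(volume.prod μ)‖ₑ ≤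
      16 * geomMass (min ((σ / 2 - 1 / P) / 3) (1 / (6 * P))) * 2 ^ σ * B ^ (1 / a - 1 / 2) *
        dualNorm P (fun t => (∫⁻ x, ‖F (t, x)‖ₑ ^ a ∂μ) ^ (1 / a)) := by
  have hσ0 : 0 < σ := lt_trans (by positivity) hσ
  obtain ⟨M, hM⟩ := he.bounded
  have hpi : ∀ K k : ℤ, Integrable (fun z => (atomPiece μ B σ F K k).indicator F z • e z)
      (volume.prod μ) := fun K k =>
    he.integrable_smul (hFi.indicator (measurableSet_atomPiece hF K k))
  have hsum : ∀ K : ℕ, ∑ k ∈ Finset.Icc (-(K : ℤ)) K,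
      ∫ t, ∫ x, (atomPiece μ B σ F K k).indicator F (t, x) • e (t, x) ∂μ =
      ∫ z, (∑ k ∈ Finset.Icc (-(K : ℤ)) K, (atomPiece μ B σ F K k).indicator F z) • e z
        ∂(volume.prod μ) := by
    intro K
    simp_rw [Finset.sum_smul]
    rw [integral_finsetSum _ fun k _ => hpi K k]
    exact Finset.sum_congr rfl fun k _ => (integral_prod _ (hpi K k)).symm
  have hlim : Filter.Tendsto (fun K : ℕ => ∫ z, (∑ k ∈ Finset.Icc (-(K : ℤ)) K,
      (atomPiece μ B σ F K k).indicator F z) • e z ∂(volume.prod μ)) Filter.atTop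
      (nhds (∫ z, F z • e z ∂(volume.prod μ))) := by
    have hae := ae_exists_mem_atomSet hB0 hB hσ0 hF hFi
    refine tendsto_integral_of_dominated_convergence (fun z => ‖F z‖ * M) ?_ (hFi.norm.mul_const M)
      ?_ ?_
    · intro K
      simp_rw [Finset.sum_smul]
      exact (integrable_finsetSum _ fun k _ => hpi K k).1
    · intro K
      filter_upwards [hae] with z hz
      rw [norm_smul]
      refine mul_le_mul ?_ (hM z) (norm_nonneg _) (norm_nonneg _)
      by_cases h0 : F z = 0
      · rw [sum_atomPiece_indicator_of_eq_zero h0]; simp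
      · obtain ⟨k, n, h⟩ := hz h0
        rw [sum_atomPiece_indicator hσ0 h]
        split_ifs <;> simp
    · filter_upwards [hae] with z hz
      by_cases h0 : F z = 0
      · simp_rw [sum_atomPiece_indicator_of_eq_zero h0, h0]
        exact tendsto_const_nhds
      · obtain ⟨k, n, h⟩ := hz h0
        refine tendsto_const_nhds.congr' ?_
        filter_upwards [Filter.eventually_ge_atTop (k.natAbs + n.natAbs)] with K hK
        rw [sum_atomPiece_indicator hσ0 h, if_pos]
        simp only [Finset.mem_Icc]
        omega
  refine le_of_tendsto hlim.enorm (Filter.Eventually.of_forall fun K => ?_)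
  rw [← hsum K]
  exact he.enorm_sum_pieces_le hB0 hB hP hσ ha ha2 haσ hF hFi K _

end

section
variable {X : Type*} [MeasurableSpace X] {μ : Measure X} {B : ℝ≥0∞} {σ P q : ℝ}
variable {H : Type*} [NormedAddCommGroup H] [InnerProductSpace ℂ H] {e : ℝ × X → H}

/-- The constant of the abstract Strichartz estimate. -/
noncomputable def strichartzConst (σ P : ℝ) : ℝ≥0∞ :=
  16 * geomMass (min ((σ / 2 - 1 / P) / 3) (1 / (6 * P))) * 2 ^ σ

theorem strichartzConst_ne_top (hP : 2 ≤ P) (hσ : 2 / P < σ) : strichartzConst σ P ≠ ⊤ := by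
  have h1 : 2 / P = 2 * (1 / P) := by ring
  have h2 : 0 < min ((σ / 2 - 1 / P) / 3) (1 / (6 * P)) :=
    lt_min (by linarith) (by positivity)
  exact ENNReal.mul_ne_top (ENNReal.mul_ne_top (by norm_num) (geomMass_ne_top h2))
    (ENNReal.rpow_ne_top_of_ne_zero (by norm_num) (by norm_num))

theorem IsDispersiveFamily.lintegral_inner_rpow_le_of_finite [SFinite μ] [CompleteSpace H]
    (he : IsDispersiveFamily μ B σ e) (hB0 : B ≠ 0) (hB : B ≠ ⊤) (hP : 2 ≤ P) (hσ : 2 / P < σ)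
    (hq : 2 < q) (hadm : 2 / P = σ * (1 - 2 / q)) (g : H) {T : Set ℝ} {W : Set X}
    (hT : MeasurableSet T) (hTf : volume T ≠ ⊤) (hW : MeasurableSet W) (hWf : μ W ≠ ⊤)
    {c : ℝ≥0∞} (hc : c ≠ 0)
    (hTc : ∀ t ∈ T, c ≤ ∫⁻ x in W, ‖inner ℂ (e (t, x)) g‖ₑ ^ q ∂μ) :
    (∫⁻ t in T, (∫⁻ x in W, ‖inner ℂ (e (t, x)) g‖ₑ ^ q ∂μ) ^ (P / q)) ^ (1 / P) ≤
      strichartzConst σ P * B ^ (1 / 2 - 1 / q) * ‖g‖ₑ := by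
  have hP0 : 0 < P := by linarith
  have hq0 : 0 < q := by linarith
  have hum : Measurable fun z => inner ℂ (e z) g :=
    (he.stronglyMeasurable.inner stronglyMeasurable_const).measurable
  set u : ℝ × X → ℂ := fun z => inner ℂ (e z) g with hu
  obtain ⟨M, hM⟩ := he.bounded
  have hub : ∀ z, ‖u z‖ ≤ M * ‖g‖ := fun z =>
    (norm_inner_le_norm _ _).trans (mul_le_mul_of_nonneg_right (hM z) (norm_nonneg _))
  have hub' : ∀ z, ‖u z‖ₑ ≤ ENNReal.ofReal (M * ‖g‖) := fun z => by
    rw [← ofReal_norm]; exact ENNReal.ofReal_le_ofReal (hub z)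
  set y : ℝ → ℝ≥0∞ := fun t => ∫⁻ x in W, ‖u (t, x)‖ₑ ^ q ∂μ with hy
  have hym : Measurable y := (hum.enorm.pow_const q).lintegral_prod_right'
  set Λ : ℝ≥0∞ := ENNReal.ofReal (M * ‖g‖) ^ q * μ W with hΛ
  have hΛt : Λ ≠ ⊤ := ENNReal.mul_ne_top (ENNReal.rpow_ne_top_of_nonneg hq0.le ofReal_ne_top) hWf
  have hyb : ∀ t, y t ≤ Λ := by
    intro t
    rw [hΛ, ← setLIntegral_const]
    refine lintegral_mono fun x => ?_
    gcongr
    exact hub' _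
  have hyt : ∀ t, y t ≠ ⊤ := fun t => ne_top_of_le_ne_top hΛt (hyb t)
  have hy0 : ∀ t ∈ T, y t ≠ 0 := fun t ht => (lt_of_lt_of_le (pos_iff_ne_zero.2 hc) (hTc t ht)).ne'
  set F₀ : ℝ × X → ℂ := fun z =>
    (((y z.1 ^ (P / q - 1)).toReal * ‖u z‖ ^ (q - 2) : ℝ) : ℂ) * u z with hF₀
  have hF₀m : Measurable F₀ :=
    (Complex.measurable_ofReal.comp ((((hym.comp measurable_fst).pow_const _).ennreal_toReal).mul
      (hum.norm.pow_const _))).mul hum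
  set F : ℝ × X → ℂ := (T ×ˢ W).indicator F₀ with hFdef
  have hTW : MeasurableSet (T ×ˢ W) := hT.prod hW
  have hFm : Measurable F := hF₀m.indicator hTW
  have hyr : ∀ t ∈ T, y t ^ (P / q - 1) ≠ ⊤ := fun t ht =>
    ENNReal.rpow_ne_top_of_ne_zero (hy0 t ht) (hyt t)
  have hF₀n : ∀ z, z.1 ∈ T → ‖F₀ z‖ₑ = y z.1 ^ (P / q - 1) * ‖u z‖ₑ ^ (q - 1) := by
    intro z hz
    have h1 : ‖u z‖ ^ (q - 2) * ‖u z‖ = ‖u z‖ ^ (q - 1) := by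
      by_cases h0 : ‖u z‖ = 0
      · rw [h0, mul_zero, Real.zero_rpow (by linarith)]
      · rw [← Real.rpow_add_one h0]; congr 1; ring
    have h2 : ‖F₀ z‖ = (y z.1 ^ (P / q - 1)).toReal * ‖u z‖ ^ (q - 1) := by
      rw [← h1, hF₀, norm_mul, Complex.norm_real, Real.norm_of_nonneg (by positivity), mul_assoc]
    rw [← ofReal_norm, h2, ENNReal.ofReal_mul ENNReal.toReal_nonneg,
      ENNReal.ofReal_toReal (hyr _ hz), ← ofReal_norm (u z),
      ENNReal.ofReal_rpow_of_nonneg (norm_nonneg _) (by linarith)]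
  have hyle : ∀ t ∈ T, y t ^ (P / q - 1) ≤ Λ ^ (P / q) * c⁻¹ := by
    intro t ht
    rw [ENNReal.rpow_sub _ _ (hy0 t ht) (hyt t), ENNReal.rpow_one, div_eq_mul_inv]
    gcongr
    · exact hyb t
    · exact hTc t ht
  have hFi : Integrable F (volume.prod μ) := by
    rw [hFdef, integrable_indicator_iff hTW]
    refine ⟨hF₀m.aestronglyMeasurable, ?_⟩
    refine (setLIntegral_mono' hTW (g := fun _ => Λ ^ (P / q) * c⁻¹ *
      ENNReal.ofReal (M * ‖g‖) ^ (q - 1)) fun z hz => ?_).trans_lt ?_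
    · rw [hF₀n z hz.1]
      gcongr
      · exact hyle _ hz.1
      · linarith
      · exact hub' _
    · rw [setLIntegral_const, Measure.prod_prod]
      refine ENNReal.mul_lt_top (ENNReal.mul_lt_top (ENNReal.mul_lt_top
        (ENNReal.rpow_ne_top_of_nonneg (by positivity) hΛt).lt_top
        (ENNReal.inv_ne_top.2 hc).lt_top)
        (ENNReal.rpow_ne_top_of_nonneg (by linarith) ofReal_ne_top).lt_top)
        (ENNReal.mul_lt_top hTf.lt_top hWf.lt_top)
  set Y : ℝ≥0∞ := ∫⁻ t in T, y t ^ (P / q) with hY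
  have hYt : Y ≠ ⊤ := by
    refine ne_top_of_le_ne_top (ENNReal.mul_ne_top (b := volume T)
      (ENNReal.rpow_ne_top_of_nonneg (y := P / q) (by positivity) hΛt) hTf) ?_
    rw [← setLIntegral_const]
    refine lintegral_mono fun t => ?_
    gcongr
    exact hyb t
  have hpair : ‖inner ℂ (∫ z, F z • e z ∂(volume.prod μ)) g‖ₑ = Y := by
    have hFe := he.integrable_smul hFi
    have h1 : ∀ z, inner ℂ (F z • e z) g =
        (((T ×ˢ W).indicator (fun z => (y z.1 ^ (P / q - 1)).toReal * ‖u z‖ ^ q) z : ℝ) : ℂ) := by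
      intro z
      by_cases hz : z ∈ T ×ˢ W
      · rw [hFdef, Set.indicator_of_mem hz, Set.indicator_of_mem hz, inner_smul_left]
        have h2 : ‖u z‖ ^ (q - 2) * ‖u z‖ ^ 2 = ‖u z‖ ^ q := by
          by_cases h0 : ‖u z‖ = 0
          · rw [h0, Real.zero_rpow hq0.ne']; simp
          · rw [← Real.rpow_natCast, ← Real.rpow_add (lt_of_le_of_ne (norm_nonneg _) (Ne.symm h0))]
            congr 1; push_cast; ring
        rw [← h2, hF₀]
        simp only [map_mul, Complex.conj_ofReal]
        have h3 : (starRingEnd ℂ) (u z) * u z = ((‖u z‖ ^ 2 : ℝ) : ℂ) := by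
          rw [mul_comm, Complex.mul_conj, Complex.normSq_eq_norm_sq]
        rw [mul_assoc, h3]
        push_cast; ring
      · rw [hFdef, Set.indicator_of_notMem hz, Set.indicator_of_notMem hz]; simp
    have h4 : inner ℂ (∫ z, F z • e z ∂(volume.prod μ)) g =
        ((∫ z, (T ×ˢ W).indicator (fun z => (y z.1 ^ (P / q - 1)).toReal * ‖u z‖ ^ q) z
          ∂(volume.prod μ) : ℝ) : ℂ) := by
      rw [← integral_complex_ofReal]
      simp_rw [← h1]
      rw [← inner_conj_symm (𝕜 := ℂ), ← integral_inner (𝕜 := ℂ) hFe, ← integral_conj]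
      simp_rw [inner_conj_symm]
    have h5 : ∀ z, 0 ≤ (T ×ˢ W).indicator
        (fun z => (y z.1 ^ (P / q - 1)).toReal * ‖u z‖ ^ q) z := fun z =>
      Set.indicator_nonneg (fun _ _ => by positivity) z
    have h6 : Integrable ((T ×ˢ W).indicator
        (fun z => (y z.1 ^ (P / q - 1)).toReal * ‖u z‖ ^ q)) (volume.prod μ) := by
      have : Integrable (fun z => inner ℂ (F z • e z) g) (volume.prod μ) := hFe.inner_const g
      simp_rw [h1] at this
      exact this.re
    rw [h4, ← ofReal_norm, Complex.norm_real, Real.norm_of_nonneg (integral_nonneg h5),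
      ofReal_integral_eq_lintegral_ofReal h6 (Filter.Eventually.of_forall h5)]
    have h7 : ∀ z, ENNReal.ofReal ((T ×ˢ W).indicator
        (fun z => (y z.1 ^ (P / q - 1)).toReal * ‖u z‖ ^ q) z) =
        T.indicator 1 z.1 * (y z.1 ^ (P / q - 1) * W.indicator (fun x => ‖u (z.1, x)‖ₑ ^ q) z.2) := by
      rintro ⟨t, x⟩
      by_cases ht : t ∈ T
      · by_cases hx : x ∈ W
        · rw [Set.indicator_of_mem (Set.mk_mem_prod ht hx)]
          simp only [ht, hx, Set.indicator_of_mem, Pi.one_apply, one_mul]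
          rw [ENNReal.ofReal_mul ENNReal.toReal_nonneg, ENNReal.ofReal_toReal (hyr _ ht),
            ← ENNReal.ofReal_rpow_of_nonneg (norm_nonneg _) hq0.le, ofReal_norm]
        · rw [Set.indicator_of_notMem (fun h => hx h.2)]
          simp [hx]
      · rw [Set.indicator_of_notMem (fun h => ht h.1)]
        simp [ht]
    simp_rw [h7]
    rw [lintegral_prod]
    · have h8 : ∀ t, ∫⁻ x, T.indicator 1 t * (y t ^ (P / q - 1) *
          W.indicator (fun x => ‖u (t, x)‖ₑ ^ q) x) ∂μ = T.indicator (fun t => y t ^ (P / q)) t := by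
        intro t
        have hmx : Measurable (fun x => ‖u (t, x)‖ₑ ^ q) :=
          (hum.comp measurable_prodMk_left).enorm.pow_const q
        rw [lintegral_const_mul _ ((hmx.indicator hW).const_mul _),
          lintegral_const_mul _ (hmx.indicator hW), lintegral_indicator hW]
        by_cases ht : t ∈ T
        · simp only [ht, Set.indicator_of_mem, Pi.one_apply, one_mul]
          change y t ^ (P / q - 1) * y t = _
          nth_rewrite 2 [← ENNReal.rpow_one (y t)]
          rw [← ENNReal.rpow_add _ _ (hy0 t ht) (hyt t)]
          congr 1; ring
        · simp [ht]
      simp_rw [h8]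
      rw [lintegral_indicator hT]
    · simp_rw [← h7]
      exact h6.1.aemeasurable.ennreal_ofReal
  have hq1 : 0 < q - 1 := by linarith
  set a : ℝ := q / (q - 1) with ha
  have ha0 : 0 < a := by positivity
  have hdual : dualNorm P (fun t => (∫⁻ x, ‖F (t, x)‖ₑ ^ a ∂μ) ^ (1 / a)) = Y ^ (1 - 1 / P) := by
    have h1 : ∀ t, (∫⁻ x, ‖F (t, x)‖ₑ ^ a ∂μ) ^ (1 / a) =
        T.indicator (fun t => y t ^ ((P - 1) / q)) t := by
      intro t
      by_cases ht : t ∈ T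
      · have h2 : ∀ x, ‖F (t, x)‖ₑ ^ a = W.indicator (fun x =>
            y t ^ ((P / q - 1) * a) * ‖u (t, x)‖ₑ ^ q) x := by
          intro x
          by_cases hx : x ∈ W
          · rw [hFdef, Set.indicator_of_mem (Set.mk_mem_prod ht hx), Set.indicator_of_mem hx,
              hF₀n _ ht, ENNReal.mul_rpow_of_nonneg _ _ ha0.le, ← ENNReal.rpow_mul,
              ← ENNReal.rpow_mul, ha]
            congr 2; field_simp
          · rw [hFdef, Set.indicator_of_notMem (fun h => hx h.2), Set.indicator_of_notMem hx,
              enorm_zero, ENNReal.zero_rpow_of_pos ha0]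
        simp_rw [h2]
        have hmx : Measurable (fun x => ‖u (t, x)‖ₑ ^ q) :=
          (hum.comp measurable_prodMk_left).enorm.pow_const q
        rw [lintegral_indicator hW, lintegral_const_mul _ hmx, Set.indicator_of_mem ht]
        change (y t ^ ((P / q - 1) * a) * y t) ^ (1 / a) = _
        nth_rewrite 2 [← ENNReal.rpow_one (y t)]
        rw [← ENNReal.rpow_add _ _ (hy0 t ht) (hyt t), ← ENNReal.rpow_mul]
        congr 1
        rw [ha]; field_simp; ring
      · have h2 : ∀ x, ‖F (t, x)‖ₑ ^ a = 0 := by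
          intro x
          rw [hFdef, Set.indicator_of_notMem (fun h => ht h.1), enorm_zero,
            ENNReal.zero_rpow_of_pos ha0]
        simp_rw [h2]
        rw [Set.indicator_of_notMem ht, lintegral_zero, ENNReal.zero_rpow_of_pos (by positivity)]
    have hP1 : 0 < P - 1 := by linarith
    have h3 : 0 < 1 - 1 / P := by
      rw [show 1 - 1 / P = (P - 1) / P by field_simp]; positivity
    unfold dualNorm
    simp_rw [h1]
    congr 1
    rw [hY, ← lintegral_indicator hT]
    refine lintegral_congr fun t => ?_
    by_cases ht : t ∈ T
    · rw [Set.indicator_of_mem ht, Set.indicator_of_mem ht, ← ENNReal.rpow_mul]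
      congr 1
      field_simp
    · rw [Set.indicator_of_notMem ht, Set.indicator_of_notMem ht,
        ENNReal.zero_rpow_of_pos (inv_pos.2 h3)]
  have hmain := he.enorm_integral_smul_le hB0 hB hP hσ (a := a) ha0
    (by rw [ha, div_le_iff₀ hq1]; linarith)
    (by
      have : 1 / P = σ / 2 * (1 - 2 / q) := by linear_combination hadm / 2
      rw [this, ha]; field_simp; ring) hFm hFi
  rw [hdual] at hmain
  have hexp : 1 / a - 1 / 2 = 1 / 2 - 1 / q := by rw [ha]; field_simp; ring
  rw [hexp] at hmain
  have hfin : Y ≤ strichartzConst σ P * B ^ (1 / 2 - 1 / q) * ‖g‖ₑ * Y ^ (1 - 1 / P) := by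
    calc Y ≤ ‖∫ z, F z • e z ∂(volume.prod μ)‖ₑ * ‖g‖ₑ := by
          rw [← hpair]
          simp only [← ofReal_norm]
          rw [← ENNReal.ofReal_mul (norm_nonneg _)]
          exact ENNReal.ofReal_le_ofReal (norm_inner_le_norm _ _)
      _ ≤ strichartzConst σ P * B ^ (1 / 2 - 1 / q) * Y ^ (1 - 1 / P) * ‖g‖ₑ := by
          gcongr
          exact hmain
      _ = _ := by ring
  by_cases hY0 : Y = 0
  · rw [hY0, ENNReal.zero_rpow_of_pos (by positivity)]
    exact zero_le
  have h1 : Y ^ (1 / P) * Y ^ (1 - 1 / P) = Y := by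
    rw [← ENNReal.rpow_add _ _ hY0 hYt]; simp
  refine (ENNReal.mul_le_mul_iff_left
    (ENNReal.rpow_pos (pos_iff_ne_zero.2 hY0) hYt : 0 < Y ^ (1 - 1 / P)).ne'
    (ENNReal.rpow_ne_top_of_ne_zero hY0 hYt)).1 ?_
  rw [h1]
  exact hfin

end

section
variable {X : Type*} [MeasurableSpace X] {μ : Measure X} {B : ℝ≥0∞} {σ P q : ℝ}
variable {H : Type*} [NormedAddCommGroup H] [InnerProductSpace ℂ H] {e : ℝ × X → H}

theorem tendsto_lintegral_spanningSets [SigmaFinite μ] (f : X → ℝ≥0∞) :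
    Filter.Tendsto (fun n => ∫⁻ x in spanningSets μ n, f x ∂μ) Filter.atTop
      (nhds (∫⁻ x, f x ∂μ)) := by
  have hmono : Monotone fun n => ∫⁻ x in spanningSets μ n, f x ∂μ := fun m n hmn =>
    lintegral_mono_set (monotone_spanningSets μ hmn)
  have := setLIntegral_iUnion_of_directed (μ := μ) f (s := spanningSets μ)
    ((monotone_spanningSets μ).directed_le)
  rw [iUnion_spanningSets, Measure.restrict_univ] at this
  rw [this]
  exact tendsto_atTop_iSup hmono

/-- The abstract homogeneous Strichartz estimate. -/
theorem IsDispersiveFamily.lintegral_inner_rpow_le [SigmaFinite μ] [CompleteSpace H]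
    (he : IsDispersiveFamily μ B σ e) (hB0 : B ≠ 0) (hB : B ≠ ⊤) (hP : 2 ≤ P) (hσ : 2 / P < σ)
    (hq : 2 < q) (hadm : 2 / P = σ * (1 - 2 / q)) (g : H) :
    (∫⁻ t, (∫⁻ x, ‖inner ℂ (e (t, x)) g‖ₑ ^ q ∂μ) ^ (P / q)) ^ (1 / P) ≤
      strichartzConst σ P * B ^ (1 / 2 - 1 / q) * ‖g‖ₑ := by
  have hP0 : 0 < P := by linarith
  have hq0 : 0 < q := by linarith
  have hPq : 0 < P / q := by positivity
  have hum : Measurable fun z => ‖inner ℂ (e z) g‖ₑ ^ q :=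
    ((he.stronglyMeasurable.inner stronglyMeasurable_const).measurable).enorm.pow_const q
  set y : ℕ → ℝ → ℝ≥0∞ := fun n t =>
    ∫⁻ x in spanningSets μ n, ‖inner ℂ (e (t, x)) g‖ₑ ^ q ∂μ with hy
  have hym : ∀ n, Measurable (y n) := fun n => hum.lintegral_prod_right'
  set T : ℕ → Set ℝ := fun n => Set.Icc (-(n : ℝ)) n ∩ {t | ((n : ℝ≥0∞) + 1)⁻¹ ≤ y n t} with hT
  have hTm : ∀ n, MeasurableSet (T n) := fun n =>
    measurableSet_Icc.inter (measurableSet_le measurable_const (hym n))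
  have hlim : ∀ t, Filter.Tendsto (fun n => (T n).indicator (fun t => y n t ^ (P / q)) t)
      Filter.atTop (nhds ((∫⁻ x, ‖inner ℂ (e (t, x)) g‖ₑ ^ q ∂μ) ^ (P / q))) := by
    intro t
    have h1 := tendsto_lintegral_spanningSets (μ := μ) fun x => ‖inner ℂ (e (t, x)) g‖ₑ ^ q
    set L := ∫⁻ x, ‖inner ℂ (e (t, x)) g‖ₑ ^ q ∂μ with hL
    have h2 : Filter.Tendsto (fun n => y n t ^ (P / q)) Filter.atTop (nhds (L ^ (P / q))) :=
      (ENNReal.continuous_rpow_const.tendsto _).comp h1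
    by_cases hL0 : L = 0
    · rw [hL0, ENNReal.zero_rpow_of_pos hPq] at h2 ⊢
      refine tendsto_of_tendsto_of_tendsto_of_le_of_le tendsto_const_nhds h2
        (fun n => zero_le) (fun n => Set.indicator_le_self _ _ _)
    · refine h2.congr' ?_
      obtain ⟨c, hc0, hcL⟩ := exists_between (pos_iff_ne_zero.2 hL0)
      have h3 : Filter.Tendsto (fun n : ℕ => ((n : ℝ≥0∞) + 1)⁻¹) Filter.atTop (nhds 0) := by
        have := (Filter.tendsto_add_atTop_iff_nat 1).2 ENNReal.tendsto_inv_nat_nhds_zero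
        simpa using this
      obtain ⟨N, hN⟩ := exists_nat_ge |t|
      filter_upwards [h1.eventually (lt_mem_nhds hcL), h3.eventually (gt_mem_nhds hc0),
        Filter.eventually_ge_atTop N] with n hn1 hn2 hn3
      rw [Set.indicator_of_mem]
      have hn4 : |t| ≤ n := hN.trans (by exact_mod_cast hn3)
      exact ⟨abs_le.1 hn4, (hn2.trans hn1).le⟩
  set C := strichartzConst σ P * B ^ (1 / 2 - 1 / q) * ‖g‖ₑ with hC
  have hle : ∀ n, ∫⁻ t, (T n).indicator (fun t => y n t ^ (P / q)) t ≤ C ^ P := by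
    intro n
    rw [lintegral_indicator (hTm n)]
    have h := he.lintegral_inner_rpow_le_of_finite hB0 hB hP hσ hq hadm g (hTm n)
      (measure_ne_top_of_subset Set.inter_subset_left (by rw [Real.volume_Icc]; exact ofReal_ne_top))
      (measurableSet_spanningSets μ n) (measure_spanningSets_lt_top μ n).ne
      (c := ((n : ℝ≥0∞) + 1)⁻¹) (ENNReal.inv_ne_zero.2 (by finiteness)) (fun t ht => ht.2)
    calc _ = ((∫⁻ t in T n, y n t ^ (P / q)) ^ (1 / P)) ^ P := by
          rw [← ENNReal.rpow_mul, one_div_mul_cancel hP0.ne', ENNReal.rpow_one]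
      _ ≤ C ^ P := by gcongr
  have hfatou : ∫⁻ t, (∫⁻ x, ‖inner ℂ (e (t, x)) g‖ₑ ^ q ∂μ) ^ (P / q) ≤ C ^ P := by
    calc _ = ∫⁻ t, Filter.liminf (fun n => (T n).indicator (fun t => y n t ^ (P / q)) t)
          Filter.atTop := lintegral_congr fun t => (hlim t).liminf_eq.symm
      _ ≤ Filter.liminf (fun n => ∫⁻ t, (T n).indicator (fun t => y n t ^ (P / q)) t)
          Filter.atTop := lintegral_liminf_le fun n => ((hym n).pow_const _).indicator (hTm n)
      _ ≤ C ^ P := Filter.liminf_le_of_frequently_le' (Filter.Frequently.of_forall hle)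
  calc _ ≤ (C ^ P) ^ (1 / P) := by gcongr
    _ = C := by rw [← ENNReal.rpow_mul, mul_one_div_cancel hP0.ne', ENNReal.rpow_one]

end

theorem norm_exp_I_mul_ofReal (x : ℝ) : ‖Complex.exp (Complex.I * x)‖ = 1 := by
  rw [mul_comm]; exact Complex.norm_exp_ofReal_mul_I x

theorem hasDerivAt_exp_I_mul {Φ : ℝ → ℝ} {Φ' x : ℝ} (h : HasDerivAt Φ Φ' x) :
    HasDerivAt (fun x => Complex.exp (Complex.I * (Φ x : ℂ)))
      (Complex.exp (Complex.I * (Φ x : ℂ)) * (Complex.I * (Φ' : ℂ))) x :=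
  ((h.ofReal_comp).const_mul Complex.I).cexp

/-- Non-stationary phase on an interval where the derivative of the phase is monotone. -/
theorem norm_integral_exp_mul_le_of_le_abs {α β : ℝ} (hαβ : α ≤ β) {Φ Φ' Φ'' : ℝ → ℝ}
    {a a' : ℝ → ℂ} (hΦ : ∀ x ∈ Set.Icc α β, HasDerivAt Φ (Φ' x) x)
    (hΦ' : ∀ x ∈ Set.Icc α β, HasDerivAt Φ' (Φ'' x) x)
    (hΦ''c : ContinuousOn Φ'' (Set.Icc α β)) (hΦ'' : ∀ x ∈ Set.Icc α β, 0 ≤ Φ'' x)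
    (ha : ∀ x ∈ Set.Icc α β, HasDerivAt a (a' x) x) (ha'c : ContinuousOn a' (Set.Icc α β))
    {δ A₀ A₁ : ℝ} (hδ : 0 < δ) (hΦδ : ∀ x ∈ Set.Icc α β, δ ≤ |Φ' x|)
    (hA₀ : ∀ x ∈ Set.Icc α β, ‖a x‖ ≤ A₀) (hA₁ : ∀ x ∈ Set.Icc α β, ‖a' x‖ ≤ A₁) :
    ‖∫ x in α..β, Complex.exp (Complex.I * (Φ x : ℂ)) * a x‖ ≤
      δ⁻¹ * (4 * A₀ + (β - α) * A₁) := by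
  have hu : Set.uIcc α β = Set.Icc α β := Set.uIcc_of_le hαβ
  have hΦ0 : ∀ x ∈ Set.Icc α β, Φ' x ≠ 0 := fun x hx h0 => by
    have := hΦδ x hx; rw [h0, abs_zero] at this; linarith
  have hcI : ∀ x ∈ Set.Icc α β, Complex.I * (Φ' x : ℂ) ≠ 0 := fun x hx =>
    mul_ne_zero Complex.I_ne_zero (Complex.ofReal_ne_zero.2 (hΦ0 x hx))
  have hA0 : 0 ≤ A₀ := (norm_nonneg _).trans (hA₀ α (Set.left_mem_Icc.2 hαβ))
  have hA1 : 0 ≤ A₁ := (norm_nonneg _).trans (hA₁ α (Set.left_mem_Icc.2 hαβ))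
  have hΦc : ContinuousOn Φ (Set.Icc α β) := fun x hx => (hΦ x hx).continuousAt.continuousWithinAt
  have hΦ'c : ContinuousOn Φ' (Set.Icc α β) := fun x hx =>
    (hΦ' x hx).continuousAt.continuousWithinAt
  have hac : ContinuousOn a (Set.Icc α β) := fun x hx => (ha x hx).continuousAt.continuousWithinAt
  have hΦ'C : ContinuousOn (fun x => Complex.I * (Φ' x : ℂ)) (Set.Icc α β) :=
    continuousOn_const.mul (Complex.continuous_ofReal.comp_continuousOn hΦ'c)
  have hΦ''C : ContinuousOn (fun x => Complex.I * (Φ'' x : ℂ)) (Set.Icc α β) :=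
    continuousOn_const.mul (Complex.continuous_ofReal.comp_continuousOn hΦ''c)
  have hexpC : ContinuousOn (fun x => Complex.exp (Complex.I * (Φ x : ℂ))) (Set.Icc α β) :=
    (continuousOn_const.mul (Complex.continuous_ofReal.comp_continuousOn hΦc)).cexp
  set w : ℝ → ℂ := fun x => a x / (Complex.I * (Φ' x : ℂ)) with hw
  set w' : ℝ → ℂ := fun x => (a' x * (Complex.I * (Φ' x : ℂ)) - a x * (Complex.I * (Φ'' x : ℂ))) /
    (Complex.I * (Φ' x : ℂ)) ^ 2 with hw'
  have hwd : ∀ x ∈ Set.Icc α β, HasDerivAt w (w' x) x := fun x hx =>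
    (ha x hx).div (((hΦ' x hx).ofReal_comp).const_mul Complex.I) (hcI x hx)
  have hw'c : ContinuousOn w' (Set.Icc α β) :=
    ((ha'c.mul hΦ'C).sub (hac.mul hΦ''C)).div (hΦ'C.pow 2) fun x hx => pow_ne_zero 2 (hcI x hx)
  have hnw : ∀ x ∈ Set.Icc α β, ‖w x‖ ≤ A₀ * δ⁻¹ := fun x hx => by
    rw [hw, norm_div, norm_mul, Complex.norm_I, one_mul, Complex.norm_real, Real.norm_eq_abs,
      div_eq_mul_inv]
    gcongr
    · exact hA₀ x hx
    · exact hΦδ x hx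
  have hparts := intervalIntegral.integral_mul_deriv_eq_deriv_mul (a := α) (b := β) (u := w)
    (u' := w') (v := fun x => Complex.exp (Complex.I * (Φ x : ℂ)))
    (v' := fun x => Complex.exp (Complex.I * (Φ x : ℂ)) * (Complex.I * (Φ' x : ℂ)))
    (by rw [hu]; exact hwd) (by rw [hu]; exact fun x hx => hasDerivAt_exp_I_mul (hΦ x hx))
    (ContinuousOn.intervalIntegrable (by rw [hu]; exact hw'c))
    (ContinuousOn.intervalIntegrable (by rw [hu]; exact hexpC.mul hΦ'C))
  have hinv : ∫ x in α..β, Φ'' x / Φ' x ^ 2 = (Φ' α)⁻¹ - (Φ' β)⁻¹ := by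
    have h1 := intervalIntegral.integral_eq_sub_of_hasDerivAt (a := α) (b := β)
      (f := fun x => -(Φ' x)⁻¹) (f' := fun x => Φ'' x / Φ' x ^ 2)
      (by
        rw [hu]; intro x hx
        have := ((hΦ' x hx).inv (hΦ0 x hx)).neg
        rw [neg_div, neg_neg] at this
        exact this)
      (ContinuousOn.intervalIntegrable (by
        rw [hu]; exact hΦ''c.div (hΦ'c.pow 2) fun x hx => pow_ne_zero 2 (hΦ0 x hx)))
    rw [h1]; ring
  have hinvb : ∀ x ∈ Set.Icc α β, |(Φ' x)⁻¹| ≤ δ⁻¹ := fun x hx => by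
    rw [abs_inv]; exact inv_anti₀ hδ (hΦδ x hx)
  have hrest : ‖∫ x in α..β, w' x * Complex.exp (Complex.I * (Φ x : ℂ))‖ ≤
      (β - α) * (A₁ * δ⁻¹) + A₀ * (2 * δ⁻¹) := by
    have hint : IntervalIntegrable (fun x => A₁ * δ⁻¹ + A₀ * (Φ'' x / Φ' x ^ 2)) volume α β :=
      ContinuousOn.intervalIntegrable (by
        rw [hu]; exact continuousOn_const.add (continuousOn_const.mul
          (hΦ''c.div (hΦ'c.pow 2) fun x hx => pow_ne_zero 2 (hΦ0 x hx))))
    refine (intervalIntegral.norm_integral_le_of_norm_le hαβ (Filter.Eventually.of_forall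
      fun x hx => ?_) hint).trans ?_
    · have hx' := Set.Ioc_subset_Icc_self hx
      rw [norm_mul, norm_exp_I_mul_ofReal, mul_one]
      have e : w' x = a' x / (Complex.I * (Φ' x : ℂ)) -
          a x * (Complex.I * (Φ'' x : ℂ)) / (Complex.I * (Φ' x : ℂ)) ^ 2 := by
        have := hcI x hx'
        rw [hw']; field_simp
      rw [e]
      refine (norm_sub_le _ _).trans ?_
      simp only [norm_div, norm_mul, norm_pow, Complex.norm_I, one_mul, Complex.norm_real,
        Real.norm_eq_abs, sq_abs, abs_of_nonneg (hΦ'' x hx')]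
      refine add_le_add ?_ ?_
      · rw [div_eq_mul_inv]
        gcongr
        · exact hA₁ x hx'
        · exact hΦδ x hx'
      · rw [mul_div_assoc]
        refine mul_le_mul_of_nonneg_right (hA₀ x hx') (div_nonneg (hΦ'' x hx') (sq_nonneg _))
    · rw [intervalIntegral.integral_add intervalIntegrable_const
        (ContinuousOn.intervalIntegrable (by
          rw [hu]; exact continuousOn_const.mul
            (hΦ''c.div (hΦ'c.pow 2) fun x hx => pow_ne_zero 2 (hΦ0 x hx)))),
        intervalIntegral.integral_const, intervalIntegral.integral_const_mul, hinv, smul_eq_mul]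
      gcongr
      have h1 := (abs_le.1 (hinvb α (Set.left_mem_Icc.2 hαβ))).2
      have h2 := (abs_le.1 (hinvb β (Set.right_mem_Icc.2 hαβ))).1
      linarith
  have heq : ∫ x in α..β, Complex.exp (Complex.I * (Φ x : ℂ)) * a x =
      ∫ x in α..β, w x * (Complex.exp (Complex.I * (Φ x : ℂ)) * (Complex.I * (Φ' x : ℂ))) := by
    refine intervalIntegral.integral_congr fun x hx => ?_
    rw [hu] at hx
    have h2 : (Φ' x : ℂ) ≠ 0 := Complex.ofReal_ne_zero.2 (hΦ0 x hx)
    simp only [hw]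
    field_simp
  rw [heq, hparts]
  refine (norm_sub_le _ _).trans ((add_le_add (norm_sub_le _ _) hrest).trans ?_)
  rw [norm_mul, norm_mul, norm_exp_I_mul_ofReal, norm_exp_I_mul_ofReal, mul_one, mul_one]
  have h1 := hnw α (Set.left_mem_Icc.2 hαβ)
  have h2 := hnw β (Set.right_mem_Icc.2 hαβ)
  have h3 : δ⁻¹ * (4 * A₀ + (β - α) * A₁) =
      A₀ * δ⁻¹ + A₀ * δ⁻¹ + ((β - α) * (A₁ * δ⁻¹) + A₀ * (2 * δ⁻¹)) := by ring
  rw [h3]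
  linarith

theorem exists_mul_abs_sub_le_abs {α β ρ : ℝ} (hαβ : α ≤ β) {g g' : ℝ → ℝ}
    (hg : ∀ x ∈ Set.Icc α β, HasDerivAt g (g' x) x) (hg' : ∀ x ∈ Set.Icc α β, ρ ≤ g' x) :
    ∃ x₀ ∈ Set.Icc α β, ∀ x ∈ Set.Icc α β, ρ * |x - x₀| ≤ |g x| := by
  have hgc : ContinuousOn g (Set.Icc α β) := fun x hx => (hg x hx).continuousAt.continuousWithinAt
  have hmv : ∀ x ∈ Set.Icc α β, ∀ y ∈ Set.Icc α β, x ≤ y → ρ * (y - x) ≤ g y - g x := by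
    intro x hx y hy hxy
    refine (convex_Icc α β).mul_sub_le_image_sub_of_le_deriv hgc ?_ ?_ x hx y hy hxy
    · rw [interior_Icc]
      exact fun z hz => (hg z (Set.Ioo_subset_Icc_self hz)).differentiableAt.differentiableWithinAt
    · rw [interior_Icc]
      intro z hz
      rw [(hg z (Set.Ioo_subset_Icc_self hz)).deriv]
      exact hg' z (Set.Ioo_subset_Icc_self hz)
  have hl := Set.left_mem_Icc.2 hαβ
  have hr := Set.right_mem_Icc.2 hαβ
  by_cases h1 : 0 ≤ g α
  · refine ⟨α, hl, fun x hx => ?_⟩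
    rw [abs_of_nonneg (by linarith [hx.1])]
    have := hmv α hl x hx hx.1
    exact le_trans (by linarith) (le_abs_self _)
  by_cases h2 : g β ≤ 0
  · refine ⟨β, hr, fun x hx => ?_⟩
    rw [abs_of_nonpos (by linarith [hx.2])]
    have := hmv x hx β hr hx.2
    exact le_trans (by linarith) (neg_le_abs _)
  obtain ⟨x₀, hx₀, h0⟩ := intermediate_value_Icc hαβ hgc ⟨(not_le.1 h1).le, (not_le.1 h2).le⟩
  refine ⟨x₀, hx₀, fun x hx => ?_⟩
  rcases le_total x₀ x with h | h
  · rw [abs_of_nonneg (by linarith)]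
    have := hmv x₀ hx₀ x hx h
    exact le_trans (by linarith) (le_abs_self _)
  · rw [abs_of_nonpos (by linarith)]
    have := hmv x hx x₀ hx₀ h
    exact le_trans (by linarith) (neg_le_abs _)

/-- Van der Corput's second derivative test with an amplitude. -/
theorem norm_integral_exp_mul_le_of_second_deriv {α β : ℝ} (hαβ : α ≤ β) {Φ Φ' Φ'' : ℝ → ℝ}
    {a a' : ℝ → ℂ} (hΦ : ∀ x ∈ Set.Icc α β, HasDerivAt Φ (Φ' x) x)
    (hΦ' : ∀ x ∈ Set.Icc α β, HasDerivAt Φ' (Φ'' x) x)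
    (hΦ''c : ContinuousOn Φ'' (Set.Icc α β)) {ρ : ℝ} (hρ : 0 < ρ)
    (hΦ'' : ∀ x ∈ Set.Icc α β, ρ ≤ Φ'' x)
    (ha : ∀ x ∈ Set.Icc α β, HasDerivAt a (a' x) x) (ha'c : ContinuousOn a' (Set.Icc α β))
    {A₀ A₁ : ℝ} (hA₀ : ∀ x ∈ Set.Icc α β, ‖a x‖ ≤ A₀) (hA₁ : ∀ x ∈ Set.Icc α β, ‖a' x‖ ≤ A₁) :
    ‖∫ x in α..β, Complex.exp (Complex.I * (Φ x : ℂ)) * a x‖ ≤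
      (√ρ)⁻¹ * (10 * A₀ + 2 * (β - α) * A₁) := by
  obtain ⟨x₀, hx₀, hlow⟩ := exists_mul_abs_sub_le_abs hαβ hΦ' hΦ''
  have hs : 0 < √ρ := Real.sqrt_pos.2 hρ
  have hss : √ρ * √ρ = ρ := Real.mul_self_sqrt hρ.le
  have hA0 : 0 ≤ A₀ := (norm_nonneg _).trans (hA₀ α (Set.left_mem_Icc.2 hαβ))
  have hA1 : 0 ≤ A₁ := (norm_nonneg _).trans (hA₁ α (Set.left_mem_Icc.2 hαβ))
  set δ := (√ρ)⁻¹ with hδ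
  have hδ0 : 0 < δ := inv_pos.2 hs
  have hρδ : ρ * δ = √ρ := by rw [hδ, ← div_eq_mul_inv, div_eq_iff hs.ne', hss]
  set l := max α (x₀ - δ) with hl
  set r := min β (x₀ + δ) with hr
  have h1 : α ≤ l := le_max_left _ _
  have h2 : l ≤ x₀ := max_le hx₀.1 (by linarith)
  have h3 : x₀ ≤ r := le_min hx₀.2 (by linarith)
  have h4 : r ≤ β := min_le_left _ _
  have hcont : ContinuousOn (fun x => Complex.exp (Complex.I * (Φ x : ℂ)) * a x)
      (Set.Icc α β) := by
    refine ContinuousOn.mul (continuousOn_const.mul (Complex.continuous_ofReal.comp_continuousOn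
      fun x hx => (hΦ x hx).continuousAt.continuousWithinAt)).cexp
      fun x hx => (ha x hx).continuousAt.continuousWithinAt
  have hii : ∀ c d, α ≤ c → c ≤ d → d ≤ β → IntervalIntegrable
      (fun x => Complex.exp (Complex.I * (Φ x : ℂ)) * a x) volume c d := fun c d hc hcd hd =>
    ContinuousOn.intervalIntegrable (by
      rw [Set.uIcc_of_le hcd]; exact hcont.mono (Set.Icc_subset_Icc hc hd))
  have hside : ∀ c d, α ≤ c → c ≤ d → d ≤ β → (c < d → ∀ x ∈ Set.Icc c d, δ ≤ |x - x₀|) →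
      ‖∫ x in c..d, Complex.exp (Complex.I * (Φ x : ℂ)) * a x‖ ≤
        δ * (4 * A₀ + (β - α) * A₁) := by
    intro c d hc hcd hd hx
    have hsub : Set.Icc c d ⊆ Set.Icc α β := Set.Icc_subset_Icc hc hd
    rcases hcd.eq_or_lt with rfl | hlt
    · rw [intervalIntegral.integral_same, norm_zero]
      have : 0 ≤ β - α := by linarith
      positivity
    refine (norm_integral_exp_mul_le_of_le_abs hcd (fun x hx => hΦ x (hsub hx))
      (fun x hx => hΦ' x (hsub hx)) (hΦ''c.mono hsub)
      (fun x hx => hρ.le.trans (hΦ'' x (hsub hx))) (fun x hx => ha x (hsub hx)) (ha'c.mono hsub)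
      hs (fun y hy => ?_) (fun x hx => hA₀ x (hsub hx)) (fun x hx => hA₁ x (hsub hx))).trans ?_
    · rw [← hρδ]
      exact (mul_le_mul_of_nonneg_left (hx hlt y hy) hρ.le).trans (hlow y (hsub hy))
    · gcongr
  have hL := hside α l le_rfl h1 (by linarith) (fun hlt x hx => by
    have : l = x₀ - δ := by
      rcases max_choice α (x₀ - δ) with h | h
      · rw [hl, h] at hlt; exact absurd hlt (lt_irrefl _)
      · rw [hl, h]
    rw [abs_of_nonpos (by linarith [hx.2])]; linarith [hx.2])
  have hR := hside r β (by linarith) h4 le_rfl (fun hlt x hx => by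
    have : r = x₀ + δ := by
      rcases min_choice β (x₀ + δ) with h | h
      · rw [hr, h] at hlt; exact absurd hlt (lt_irrefl _)
      · rw [hr, h]
    rw [abs_of_nonneg (by linarith [hx.1])]; linarith [hx.1])
  have hM : ‖∫ x in l..r, Complex.exp (Complex.I * (Φ x : ℂ)) * a x‖ ≤ A₀ * (2 * δ) := by
    refine (intervalIntegral.norm_integral_le_of_norm_le_const (C := A₀) fun x hx => ?_).trans ?_
    · rw [Set.uIoc_of_le (by linarith)] at hx
      rw [norm_mul, norm_exp_I_mul_ofReal, one_mul]
      exact hA₀ x ⟨by linarith [hx.1], by linarith [hx.2]⟩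
    · gcongr
      rw [abs_of_nonneg (by linarith)]
      have h5 : x₀ - δ ≤ l := le_max_right _ _
      have h6 : r ≤ x₀ + δ := min_le_right _ _
      linarith
  have hsplit : ∫ x in α..β, Complex.exp (Complex.I * (Φ x : ℂ)) * a x =
      (∫ x in α..l, Complex.exp (Complex.I * (Φ x : ℂ)) * a x) +
      (∫ x in l..r, Complex.exp (Complex.I * (Φ x : ℂ)) * a x) +
      ∫ x in r..β, Complex.exp (Complex.I * (Φ x : ℂ)) * a x := by
    rw [intervalIntegral.integral_add_adjacent_intervals (hii α l le_rfl h1 (by linarith))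
      (hii l r h1 (by linarith) h4), intervalIntegral.integral_add_adjacent_intervals
      (hii α r le_rfl (by linarith) h4) (hii r β (by linarith) h4 le_rfl)]
  rw [hsplit]
  refine (norm_add₃_le).trans ((add_le_add (add_le_add hL hM) hR).trans (le_of_eq ?_))
  ring

theorem deriv_eq_zero_of_eq_zero_Ici {b : ℝ → ℝ} (hb : Differentiable ℝ b) {L : ℝ}
    (hL : ∀ v, L ≤ v → b v = 0) {v : ℝ} (hv : L ≤ v) : deriv b v = 0 := by
  rw [← (hb v).derivWithin (uniqueDiffWithinAt_Ici v),
    derivWithin_congr (f := fun _ => (0 : ℝ)) (s := Set.Ici v)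
      (fun x hx => hL x (hv.trans hx)) (hL v hv)]
  simp

theorem integral_exp_sq_mul_parts {g g' : ℝ → ℝ} (hg : ∀ x, HasDerivAt g (g' x) x)
    (hg' : Continuous g') {L s : ℝ} (hgL : g L = 0) (hs : 0 < s) :
    ∫ v in (0 : ℝ)..L, Complex.exp (Complex.I * ((s * v ^ 2 : ℝ) : ℂ)) * ((v * g v : ℝ) : ℂ) =
      (-(Complex.I * ((2 * s : ℝ) : ℂ))⁻¹) * (((g 0 : ℝ) : ℂ) +
        ∫ v in (0 : ℝ)..L, Complex.exp (Complex.I * ((s * v ^ 2 : ℝ) : ℂ)) * ((g' v : ℝ) : ℂ)) := by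
  have hΦ : ∀ v : ℝ, HasDerivAt (fun v : ℝ => s * v ^ 2) (2 * s * v) v := fun v => by
    exact ((hasDerivAt_pow 2 v).const_mul s).congr_deriv (by push_cast; ring)
  have hgc : Continuous g := continuous_iff_continuousAt.2 fun x => (hg x).continuousAt
  have hparts := intervalIntegral.integral_mul_deriv_eq_deriv_mul (a := 0) (b := L)
    (u := fun v => ((g v : ℝ) : ℂ)) (u' := fun v => ((g' v : ℝ) : ℂ))
    (v := fun v => Complex.exp (Complex.I * ((s * v ^ 2 : ℝ) : ℂ)))
    (v' := fun v => Complex.exp (Complex.I * ((s * v ^ 2 : ℝ) : ℂ)) *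
      (Complex.I * ((2 * s * v : ℝ) : ℂ)))
    (fun x _ => (hg x).ofReal_comp) (fun x _ => hasDerivAt_exp_I_mul (hΦ x))
    (Continuous.intervalIntegrable (by fun_prop) _ _)
    (Continuous.intervalIntegrable (by fun_prop) _ _)
  have hc : Complex.I * ((2 * s : ℝ) : ℂ) ≠ 0 :=
    mul_ne_zero Complex.I_ne_zero (Complex.ofReal_ne_zero.2 (by positivity))
  have h1 : ∫ v in (0 : ℝ)..L, ((g v : ℝ) : ℂ) * (Complex.exp (Complex.I * ((s * v ^ 2 : ℝ) : ℂ)) *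
      (Complex.I * ((2 * s * v : ℝ) : ℂ))) = (Complex.I * ((2 * s : ℝ) : ℂ)) *
      ∫ v in (0 : ℝ)..L, Complex.exp (Complex.I * ((s * v ^ 2 : ℝ) : ℂ)) *
        ((v * g v : ℝ) : ℂ) := by
    rw [← intervalIntegral.integral_const_mul]
    congr 1; ext v; push_cast; ring
  rw [h1] at hparts
  rw [eq_comm, neg_mul, neg_eq_iff_eq_neg, inv_mul_eq_iff_eq_mul₀ hc, mul_neg, hparts, hgL]
  simp only [mul_comm (Complex.exp _)]
  simp [add_comm]

/-- Decay of Fresnel integrals whose amplitude vanishes to order `n` at the stationary point. -/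
theorem exists_norm_integral_exp_sq_le (n : ℕ) : ∀ b : ℝ → ℝ, ContDiff ℝ (⊤ : ℕ∞) b → ∀ L : ℝ,
    0 ≤ L → (∀ v, L ≤ v → b v = 0) → ∃ C : ℝ, 0 ≤ C ∧ ∀ s : ℝ, 0 < s →
      ‖∫ v in (0 : ℝ)..L, Complex.exp (Complex.I * ((s * v ^ 2 : ℝ) : ℂ)) *
        ((v ^ n * b v : ℝ) : ℂ)‖ ≤ C * s ^ (-(((n : ℝ) + 1) / 2)) := by
  have hbd : ∀ b : ℝ → ℝ, Continuous b → ∀ L : ℝ, ∃ A : ℝ, 0 ≤ A ∧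
      ∀ v ∈ Set.Icc 0 L, ‖((b v : ℝ) : ℂ)‖ ≤ A := by
    intro b hb L
    obtain ⟨A, hA⟩ := isCompact_Icc.exists_bound_of_continuousOn (s := Set.Icc 0 L) hb.continuousOn
    refine ⟨max A 0, le_max_right _ _, fun v hv => ?_⟩
    rw [Complex.norm_real]; exact (hA v hv).trans (le_max_left _ _)
  induction n using Nat.twoStepInduction with
  | zero =>
    intro b hb L hL hbL
    have hbd' : Continuous (deriv b) := hb.continuous_deriv (by simp)
    have hb1 : ∀ x, HasDerivAt b (deriv b x) x := fun x =>
      (hb.differentiable (by simp) x).hasDerivAt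
    obtain ⟨A₀, hA0, hA₀⟩ := hbd b hb.continuous L
    obtain ⟨A₁, hA1, hA₁⟩ := hbd (deriv b) hbd' L
    refine ⟨10 * A₀ + 2 * L * A₁, by positivity, fun s hs => ?_⟩
    have := norm_integral_exp_mul_le_of_second_deriv hL (Φ := fun v => s * v ^ 2)
      (Φ' := fun v => 2 * s * v) (Φ'' := fun _ => 2 * s) (a := fun v => ((b v : ℝ) : ℂ))
      (a' := fun v => ((deriv b v : ℝ) : ℂ)) (ρ := 2 * s)
      (fun x _ => by
        exact ((hasDerivAt_pow 2 x).const_mul s).congr_deriv (by push_cast; ring))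
      (fun x _ => by simpa using (hasDerivAt_id x).const_mul (2 * s))
      continuousOn_const (by positivity) (fun _ _ => le_rfl)
      (fun x _ => (hb1 x).ofReal_comp)
      (by fun_prop) hA₀ hA₁
    simp only [pow_zero, one_mul]
    refine this.trans ?_
    rw [mul_comm, sub_zero, CharP.cast_eq_zero, zero_add, Real.rpow_neg hs.le, ← Real.sqrt_eq_rpow]
    gcongr
    linarith
  | one =>
    intro b hb L hL hbL
    have hbd' : Continuous (deriv b) := hb.continuous_deriv (by simp)
    have hb1 : ∀ x, HasDerivAt b (deriv b x) x := fun x =>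
      (hb.differentiable (by simp) x).hasDerivAt
    obtain ⟨A₁, hA1, hA₁⟩ := hbd (deriv b) hbd' L
    refine ⟨|b 0| + L * A₁, by positivity, fun s hs => ?_⟩
    simp only [pow_one]
    rw [integral_exp_sq_mul_parts hb1 hbd' (hbL L le_rfl) hs, norm_mul, norm_neg, norm_inv,
      norm_mul, Complex.norm_I, one_mul, Complex.norm_real, Real.norm_of_nonneg (by positivity),
      mul_comm]
    have e : -(((1 : ℕ) : ℝ) + 1) / 2 = -1 := by norm_num
    rw [← neg_div, e, Real.rpow_neg_one]
    have h2 : ‖∫ v in (0 : ℝ)..L, Complex.exp (Complex.I * ((s * v ^ 2 : ℝ) : ℂ)) *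
        ((deriv b v : ℝ) : ℂ)‖ ≤ L * A₁ := by
      refine (intervalIntegral.norm_integral_le_of_norm_le_const (C := A₁) fun x hx => ?_).trans ?_
      · rw [Set.uIoc_of_le hL] at hx
        rw [norm_mul, norm_exp_I_mul_ofReal, one_mul]
        exact hA₁ x ⟨hx.1.le, hx.2⟩
      · rw [sub_zero, abs_of_nonneg hL, mul_comm]
    refine mul_le_mul ((norm_add_le _ _).trans (add_le_add ?_ h2)) (inv_anti₀ hs (by linarith))
      (by positivity) (by positivity)
    rw [Complex.norm_real, Real.norm_eq_abs]
  | more n ih _ =>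
    intro b hb L hL hbL
    have hd : Differentiable ℝ b := hb.differentiable (by simp)
    have hb' : ContDiff ℝ (⊤ : ℕ∞) (deriv b) := hb.deriv' 
    obtain ⟨C, hC0, hC⟩ := ih (fun v => (n + 1) * b v + v * deriv b v)
      ((contDiff_const.mul hb).add (contDiff_id.mul hb')) L hL (fun v hv => by
        rw [hbL v hv, deriv_eq_zero_of_eq_zero_Ici hd hbL hv]; ring)
    refine ⟨C, hC0, fun s hs => ?_⟩
    have hg : ∀ v, HasDerivAt (fun v => v ^ (n + 1) * b v)
        (v ^ n * ((n + 1) * b v + v * deriv b v)) v := fun v => by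
      exact ((hasDerivAt_pow (n + 1) v).mul (hd v).hasDerivAt).congr_deriv
        (by push_cast; ring)
    have hb'c : Continuous (deriv b) := hb'.continuous
    have hbc : Continuous b := hb.continuous
    have h := integral_exp_sq_mul_parts hg (by fun_prop) (L := L) (by rw [hbL L le_rfl, mul_zero]) hs
    have e : ∀ v : ℝ, v ^ (n + 2) * b v = v * (v ^ (n + 1) * b v) := fun v => by ring
    simp only [e]
    rw [h, norm_mul, norm_neg, norm_inv, norm_mul, Complex.norm_I, one_mul, Complex.norm_real,
      Real.norm_of_nonneg (by positivity)]
    have e0 : ((0 : ℝ) ^ (n + 1) * b 0 : ℝ) = 0 := by simp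
    rw [e0, Complex.ofReal_zero, zero_add]
    have e2 : s ^ (-((((n + 2 : ℕ) : ℝ) + 1) / 2)) = s⁻¹ * s ^ (-(((n : ℝ) + 1) / 2)) := by
      rw [← Real.rpow_neg_one, ← Real.rpow_add hs]; congr 1; push_cast; ring
    rw [e2, mul_left_comm]
    refine mul_le_mul (inv_anti₀ hs (by linarith)) (hC s hs) (norm_nonneg _) (by positivity)

theorem smoothTransition_add_one_sub (x : ℝ) :
    Real.smoothTransition x + Real.smoothTransition (1 - x) = 1 := by
  have h := Real.smoothTransition.pos_denom x
  rw [Real.smoothTransition, Real.smoothTransition, (by ring : 1 - (1 - x) = x),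
    add_comm (expNegInvGlue (1 - x)), ← add_div, div_self h.ne']

/-- Amplitude of the spherical integral in the coordinate `v = √2 sin (θ / 2)` near the pole. -/
noncomputable def poleAmplitude (n : ℕ) (v : ℝ) : ℝ :=
  2 * Real.smoothTransition (3 / 2 - v ^ 2) * (√(2 - v ^ 2) ^ n / √(2 - v ^ 2))

theorem contDiff_poleAmplitude (n : ℕ) : ContDiff ℝ (⊤ : ℕ∞) (poleAmplitude n) := by
  rw [contDiff_iff_contDiffAt]
  intro v
  by_cases hv : v ^ 2 < 2
  · have hs : ContDiffAt ℝ (⊤ : ℕ∞) (fun v : ℝ => √(2 - v ^ 2)) v :=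
      ContDiffAt.sqrt (by fun_prop) (by linarith)
    have h0 : √(2 - v ^ 2) ≠ 0 := (Real.sqrt_pos.2 (by linarith)).ne'
    have ht : ContDiffAt ℝ (⊤ : ℕ∞) (fun v : ℝ => Real.smoothTransition (3 / 2 - v ^ 2)) v :=
      (Real.smoothTransition.contDiff.comp (by fun_prop :
        ContDiff ℝ (⊤ : ℕ∞) (fun v : ℝ => 3 / 2 - v ^ 2))).contDiffAt
    exact (contDiffAt_const.mul ht).mul ((hs.pow n).div hs h0)
  · have ho : IsOpen {v : ℝ | 3 / 2 < v ^ 2} := isOpen_lt continuous_const (by fun_prop)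
    have hm : v ∈ {v : ℝ | 3 / 2 < v ^ 2} := by
      change 3 / 2 < v ^ 2
      linarith [not_lt.1 hv]
    refine (contDiffAt_const (c := (0 : ℝ))).congr_of_eventuallyEq ?_
    filter_upwards [ho.mem_nhds hm] with w hw
    rw [poleAmplitude, Real.smoothTransition.zero_of_nonpos (by
      have : 3 / 2 < w ^ 2 := hw
      linarith)]
    ring

theorem poleAmplitude_eq_zero {n : ℕ} {v : ℝ} (hv : √2 ≤ v) : poleAmplitude n v = 0 := by
  have : (2 : ℝ) ≤ v ^ 2 := by
    rw [← Real.sq_sqrt (zero_le_two (α := ℝ))]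
    gcongr
  rw [poleAmplitude, Real.smoothTransition.zero_of_nonpos (by linarith)]
  ring

/-- The profile of the spherical integral near a pole. -/
noncomputable def poleProfile (n : ℕ) (s : ℝ) : ℂ :=
  ∫ v in (0 : ℝ)..√2, Complex.exp (Complex.I * ((s * v ^ 2 : ℝ) : ℂ)) *
    ((v ^ n * poleAmplitude n v : ℝ) : ℂ)

noncomputable def poleProfileDeriv (n : ℕ) (s : ℝ) : ℂ :=
  ∫ v in (0 : ℝ)..√2, Complex.exp (Complex.I * ((s * v ^ 2 : ℝ) : ℂ)) *
    (Complex.I * ((v ^ (n + 2) * poleAmplitude n v : ℝ) : ℂ))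

theorem hasDerivAt_poleProfile (n : ℕ) (s : ℝ) :
    HasDerivAt (poleProfile n) (poleProfileDeriv n s) s := by
  have hb : Continuous (poleAmplitude n) := (contDiff_poleAmplitude n).continuous
  refine (intervalIntegral.hasDerivAt_integral_of_dominated_loc_of_deriv_le
    (F := fun s v => Complex.exp (Complex.I * ((s * v ^ 2 : ℝ) : ℂ)) *
      ((v ^ n * poleAmplitude n v : ℝ) : ℂ))
    (F' := fun s v => Complex.exp (Complex.I * ((s * v ^ 2 : ℝ) : ℂ)) *
      (Complex.I * ((v ^ (n + 2) * poleAmplitude n v : ℝ) : ℂ)))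
    (bound := fun v => |v ^ (n + 2) * poleAmplitude n v|) (s := Set.univ) Filter.univ_mem
    (Filter.Eventually.of_forall fun s => (by fun_prop : Continuous _).aestronglyMeasurable)
    (Continuous.intervalIntegrable (by fun_prop) _ _)
    (by fun_prop : Continuous _).aestronglyMeasurable
    (Filter.Eventually.of_forall fun v _ s _ => ?_)
    (Continuous.intervalIntegrable (by fun_prop) _ _)
    (Filter.Eventually.of_forall fun v _ s _ => ?_)).2
  · rw [norm_mul, norm_mul, norm_exp_I_mul_ofReal, Complex.norm_I, Complex.norm_real, one_mul,
      one_mul, Real.norm_eq_abs]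
  · have h1 : HasDerivAt (fun s : ℝ => s * v ^ 2) (v ^ 2) s := by
      simpa using (hasDerivAt_id s).mul_const (v ^ 2)
    refine ((hasDerivAt_exp_I_mul h1).mul_const _).congr_deriv ?_
    push_cast; ring

theorem continuous_poleProfileDeriv (n : ℕ) : Continuous (poleProfileDeriv n) := by
  have hb : Continuous (poleAmplitude n) := (contDiff_poleAmplitude n).continuous
  unfold poleProfileDeriv
  exact intervalIntegral.continuous_parametric_intervalIntegral_of_continuous' (by fun_prop) _ _

theorem exists_norm_poleProfile_le (n : ℕ) : ∃ C : ℝ, 0 ≤ C ∧ ∀ s : ℝ, 0 < s →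
    ‖poleProfile n s‖ ≤ C * s ^ (-(((n : ℝ) + 1) / 2)) ∧
    ‖poleProfileDeriv n s‖ ≤ C * s ^ (-(((n : ℝ) + 3) / 2)) := by
  obtain ⟨C₁, h1, H1⟩ := exists_norm_integral_exp_sq_le n _ (contDiff_poleAmplitude n) (√2)
    (Real.sqrt_nonneg _) fun v hv => poleAmplitude_eq_zero hv
  obtain ⟨C₂, h2, H2⟩ := exists_norm_integral_exp_sq_le (n + 2) _ (contDiff_poleAmplitude n) (√2)
    (Real.sqrt_nonneg _) fun v hv => poleAmplitude_eq_zero hv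
  refine ⟨C₁ + C₂, by positivity, fun s hs => ⟨(H1 s hs).trans ?_, ?_⟩⟩
  · gcongr; linarith
  · have e : poleProfileDeriv n s = Complex.I *
        ∫ v in (0 : ℝ)..√2, Complex.exp (Complex.I * ((s * v ^ 2 : ℝ) : ℂ)) *
          ((v ^ (n + 2) * poleAmplitude n v : ℝ) : ℂ) := by
      rw [← intervalIntegral.integral_const_mul, poleProfileDeriv]
      congr 1; ext v; ring
    rw [e, norm_mul, Complex.norm_I, one_mul]
    refine (H2 s hs).trans ?_
    have e2 : (((n + 2 : ℕ) : ℝ) + 1) / 2 = ((n : ℝ) + 3) / 2 := by push_cast; ring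
    rw [e2]
    gcongr; linarith

theorem integral_pole_eq (n : ℕ) (s : ℝ) :
    ∫ θ in (0 : ℝ)..Real.pi, Complex.exp (Complex.I * ((s * Real.cos θ : ℝ) : ℂ)) *
      ((Real.sin θ ^ n * Real.smoothTransition (1 / 2 + Real.cos θ) : ℝ) : ℂ) =
    Complex.exp (Complex.I * ((s : ℝ) : ℂ)) * poleProfile n (-s) := by
  have hb : Continuous (poleAmplitude n) := (contDiff_poleAmplitude n).continuous
  have hd : ∀ θ : ℝ, HasDerivAt (fun θ : ℝ => √2 * Real.sin (θ / 2)) (√2 / 2 * Real.cos (θ / 2)) θ :=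
    fun θ => by
      have h1 : HasDerivAt (fun θ : ℝ => θ / 2) (1 / 2) θ := by
        simpa using (hasDerivAt_id θ).div_const 2
      exact ((h1.sin).const_mul (√2)).congr_deriv (by ring)
  have hsub := intervalIntegral.integral_deriv_smul_comp (a := 0) (b := Real.pi)
    (f := fun θ : ℝ => √2 * Real.sin (θ / 2)) (f' := fun θ : ℝ => √2 / 2 * Real.cos (θ / 2))
    (g := fun v : ℝ => Complex.exp (Complex.I * ((-s * v ^ 2 : ℝ) : ℂ)) *
      ((v ^ n * poleAmplitude n v : ℝ) : ℂ))
    (fun θ _ => hd θ) (by fun_prop) (by fun_prop)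
  simp only [zero_div, Real.sin_zero, mul_zero, Real.sin_pi_div_two, mul_one] at hsub
  rw [poleProfile, ← hsub, ← intervalIntegral.integral_const_mul]
  refine intervalIntegral.integral_congr fun θ hθ => ?_
  rw [Set.uIcc_of_le Real.pi_pos.le] at hθ
  have hs2 : √2 * √2 = (2 : ℝ) := Real.mul_self_sqrt zero_le_two
  have hcos : Real.cos θ = 1 - 2 * Real.sin (θ / 2) ^ 2 := by
    have := Real.cos_two_mul (θ / 2)
    rw [mul_div_cancel₀ _ two_ne_zero] at this
    linarith [Real.sin_sq_add_cos_sq (θ / 2)]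
  have hsin : Real.sin θ = 2 * Real.sin (θ / 2) * Real.cos (θ / 2) := by
    have := Real.sin_two_mul (θ / 2)
    rwa [mul_div_cancel₀ _ two_ne_zero] at this
  have hv2 : (√2 * Real.sin (θ / 2)) ^ 2 = 1 - Real.cos θ := by rw [hcos, mul_pow, sq, hs2]; ring
  simp only [Function.comp]
  rw [poleAmplitude, hv2, Complex.real_smul]
  have hc0 : 0 ≤ Real.cos (θ / 2) :=
    Real.cos_nonneg_of_mem_Icc ⟨by linarith [hθ.1, Real.pi_pos], by linarith [hθ.2]⟩
  have h2v : 2 - (1 - Real.cos θ) = (√2 * Real.cos (θ / 2)) ^ 2 := by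
    rw [hcos, mul_pow, sq √2, hs2]; linarith [Real.sin_sq_add_cos_sq (θ / 2)]
  rw [h2v, Real.sqrt_sq (by positivity)]
  have hexp : Complex.exp (Complex.I * ((s : ℝ) : ℂ)) *
      Complex.exp (Complex.I * ((-s * (1 - Real.cos θ) : ℝ) : ℂ)) =
      Complex.exp (Complex.I * ((s * Real.cos θ : ℝ) : ℂ)) := by
    rw [← Complex.exp_add]; congr 1; push_cast; ring
  have hreal : Real.sin θ ^ n * Real.smoothTransition (1 / 2 + Real.cos θ) =
      (√2 / 2 * Real.cos (θ / 2)) * ((√2 * Real.sin (θ / 2)) ^ n *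
        (2 * Real.smoothTransition (3 / 2 - (1 - Real.cos θ)) *
          ((√2 * Real.cos (θ / 2)) ^ n / (√2 * Real.cos (θ / 2))))) := by
    have e1 : 3 / 2 - (1 - Real.cos θ) = 1 / 2 + Real.cos θ := by ring
    rw [e1]
    rcases hc0.eq_or_lt with h0 | h0
    · have : Real.cos θ = -1 := by
        have := h2v; rw [← h0] at this; linarith
      rw [this, Real.smoothTransition.zero_of_nonpos (by norm_num)]; ring
    · have e2 : Real.sin θ ^ n = (√2 * Real.sin (θ / 2)) ^ n * (√2 * Real.cos (θ / 2)) ^ n := by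
        rw [hsin, ← mul_pow]; congr 1
        linear_combination (-(Real.sin (θ / 2) * Real.cos (θ / 2))) * hs2
      rw [e2]
      have h2 : √2 ≠ (0 : ℝ) := by positivity
      field_simp
  rw [hreal, ← hexp]
  push_cast
  ring

theorem poleProfile_neg (n : ℕ) (s : ℝ) :
    poleProfile n (-s) = (starRingEnd ℂ) (poleProfile n s) := by
  rw [poleProfile, poleProfile, intervalIntegral.integral_of_le (Real.sqrt_nonneg 2),
    intervalIntegral.integral_of_le (Real.sqrt_nonneg 2), ← integral_conj]
  congr 1; ext v
  rw [map_mul, ← Complex.exp_conj, map_mul, Complex.conj_I, Complex.conj_ofReal,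
    Complex.conj_ofReal]
  congr 2; push_cast; ring

/-- The spherical integral splits into the contributions of the two poles. -/
theorem integral_sphere_eq (n : ℕ) (s : ℝ) :
    ∫ θ in (0 : ℝ)..Real.pi, Complex.exp (Complex.I * ((s * Real.cos θ : ℝ) : ℂ)) *
      ((Real.sin θ ^ n : ℝ) : ℂ) =
    Complex.exp (Complex.I * ((s : ℝ) : ℂ)) * poleProfile n (-s) +
      Complex.exp (Complex.I * ((-s : ℝ) : ℂ)) * poleProfile n s := by
  have hst : Continuous Real.smoothTransition := Real.smoothTransition.continuous
  have h2 := intervalIntegral.integral_comp_sub_left (a := 0) (b := Real.pi)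
    (fun θ : ℝ => Complex.exp (Complex.I * ((-s * Real.cos θ : ℝ) : ℂ)) *
      ((Real.sin θ ^ n * Real.smoothTransition (1 / 2 + Real.cos θ) : ℝ) : ℂ)) Real.pi
  rw [sub_self, sub_zero, integral_pole_eq n (-s)] at h2
  simp only [Real.cos_pi_sub, Real.sin_pi_sub, neg_mul_neg, neg_neg] at h2
  rw [← h2, ← integral_pole_eq, ← intervalIntegral.integral_add
    (Continuous.intervalIntegrable (by fun_prop) _ _)
    (Continuous.intervalIntegrable (by fun_prop) _ _)]
  congr 1; ext θ
  have := smoothTransition_add_one_sub (1 / 2 + Real.cos θ)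
  have e : 1 - (1 / 2 + Real.cos θ) = 1 / 2 + -Real.cos θ := by ring
  rw [e] at this
  rw [← mul_add, ← Complex.ofReal_add, ← mul_add, this, mul_one]

/-- Non-stationary phase to arbitrary order, uniformly in a compact set of parameters. -/
theorem exists_norm_integral_exp_le_pow {Y : Type*} [NormedAddCommGroup Y] [NormedSpace ℝ Y]
    {Ω : Set (Y × ℝ)} (hΩ : IsOpen Ω) {K : Set Y} (hK : IsCompact K) {α α₁ β₁ β : ℝ}
    (hα : α < α₁) (hαβ : α ≤ β) (hβ : β₁ < β) (hKΩ : K ×ˢ Set.Icc α β ⊆ Ω) {φ : Y → ℝ → ℝ}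
    {g : Y × ℝ → ℝ} (hg : ContDiffOn ℝ (⊤ : ℕ∞) g Ω) (hg0 : ∀ z ∈ Ω, g z ≠ 0)
    (hφ : ∀ w ∈ K, ∀ x ∈ Set.Icc α β, HasDerivAt (φ w) (g (w, x)) x) (N : ℕ) :
    ∀ a : Y × ℝ → ℝ, ContDiffOn ℝ (⊤ : ℕ∞) a Ω →
      (∀ z ∈ Ω, z.2 ∉ Set.Icc α₁ β₁ → a z = 0) → ∃ C : ℝ, 0 ≤ C ∧ ∀ w ∈ K, ∀ l : ℝ, 0 < l →
        ‖∫ x in α..β, Complex.exp (Complex.I * ((l * φ w x : ℝ) : ℂ)) * ((a (w, x) : ℝ) : ℂ)‖ ≤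
          C * (l⁻¹) ^ N := by
  have hu : Set.uIcc α β = Set.Icc α β := Set.uIcc_of_le hαβ
  induction N with
  | zero =>
    intro a ha _
    obtain ⟨A, hA⟩ := (hK.prod isCompact_Icc).exists_bound_of_continuousOn
      (ha.continuousOn.mono hKΩ)
    refine ⟨max A 0 * |β - α|, by positivity, fun w hw l _ => ?_⟩
    rw [pow_zero, mul_one]
    refine intervalIntegral.norm_integral_le_of_norm_le_const fun x hx => ?_
    rw [Set.uIoc_of_le hαβ] at hx
    rw [norm_mul, norm_exp_I_mul_ofReal, one_mul, Complex.norm_real]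
    exact (hA (w, x) ⟨hw, Set.Ioc_subset_Icc_self hx⟩).trans (le_max_left _ _)
  | succ N ih =>
    intro a ha hav
    set h : Y × ℝ → ℝ := fun z => a z / g z with hh
    have hhΩ : ContDiffOn ℝ (⊤ : ℕ∞) h Ω := ha.div hg hg0
    set a' : Y × ℝ → ℝ := fun z => fderiv ℝ h z (0, 1) with ha'
    have ha'Ω : ContDiffOn ℝ (⊤ : ℕ∞) a' Ω :=
      (hhΩ.fderiv_of_isOpen hΩ (by simp)).clm_apply contDiffOn_const
    have ha'v : ∀ z ∈ Ω, z.2 ∉ Set.Icc α₁ β₁ → a' z = 0 := fun z hz hz2 => by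
      have ho : IsOpen (Ω ∩ {z : Y × ℝ | z.2 ∉ Set.Icc α₁ β₁}) :=
        hΩ.inter (isClosed_Icc.isOpen_compl.preimage continuous_snd)
      have : h =ᶠ[nhds z] fun _ => 0 := by
        filter_upwards [ho.mem_nhds ⟨hz, hz2⟩] with y hy
        rw [hh]; simp only [hav y hy.1 hy.2, zero_div]
      rw [ha']
      simp only [this.fderiv_eq]
      simp
    obtain ⟨C, hC0, hC⟩ := ih a' ha'Ω ha'v
    refine ⟨C, hC0, fun w hw l hl => ?_⟩
    have hmem : ∀ x ∈ Set.Icc α β, (w, x) ∈ Ω := fun x hx => hKΩ ⟨hw, hx⟩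
    have hline : ∀ x, HasDerivAt (fun x : ℝ => (w, x)) ((0 : Y), (1 : ℝ)) x := fun x =>
      (hasDerivAt_const x w).prodMk (hasDerivAt_id x)
    have hd : ∀ x ∈ Set.Icc α β, HasDerivAt (fun x => h (w, x)) (a' (w, x)) x := fun x hx =>
      (((hhΩ.differentiableOn (by simp)).differentiableAt
        (hΩ.mem_nhds (hmem x hx))).hasFDerivAt).comp_hasDerivAt x (hline x)
    have hpath : ContinuousOn (fun x : ℝ => (w, x)) (Set.Icc α β) := by fun_prop
    have hgc : ContinuousOn (fun x => g (w, x)) (Set.Icc α β) :=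
      hg.continuousOn.comp hpath hmem
    have ha'c : ContinuousOn (fun x => a' (w, x)) (Set.Icc α β) :=
      ha'Ω.continuousOn.comp hpath hmem
    have hφc : ContinuousOn (fun x => φ w x) (Set.Icc α β) := fun x hx =>
      (hφ w hw x hx).continuousAt.continuousWithinAt
    have hexpc : ContinuousOn (fun x => Complex.exp (Complex.I * ((l * φ w x : ℝ) : ℂ)))
        (Set.Icc α β) :=
      (continuousOn_const.mul (Complex.continuous_ofReal.comp_continuousOn
        (continuousOn_const.mul hφc))).cexp
    have hparts := intervalIntegral.integral_mul_deriv_eq_deriv_mul (a := α) (b := β)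
      (u := fun x => ((h (w, x) : ℝ) : ℂ)) (u' := fun x => ((a' (w, x) : ℝ) : ℂ))
      (v := fun x => Complex.exp (Complex.I * ((l * φ w x : ℝ) : ℂ)))
      (v' := fun x => Complex.exp (Complex.I * ((l * φ w x : ℝ) : ℂ)) *
        (Complex.I * ((l * g (w, x) : ℝ) : ℂ)))
      (fun x hx => (hd x (hu ▸ hx)).ofReal_comp)
      (fun x hx => hasDerivAt_exp_I_mul ((hφ w hw x (hu ▸ hx)).const_mul l))
      (ContinuousOn.intervalIntegrable (by
        rw [hu]; exact Complex.continuous_ofReal.comp_continuousOn ha'c))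
      (ContinuousOn.intervalIntegrable (by
        rw [hu]; exact hexpc.mul (continuousOn_const.mul
          (Complex.continuous_ofReal.comp_continuousOn (continuousOn_const.mul hgc)))))
    have h0 : ∀ x ∈ Set.Icc α β, x ∉ Set.Icc α₁ β₁ → h (w, x) = 0 := fun x hx hx2 => by
      rw [hh]; simp only [hav _ (hmem x hx) hx2, zero_div]
    rw [h0 β (Set.right_mem_Icc.2 hαβ) (fun h => absurd h.2 (not_le.2 hβ)),
      h0 α (Set.left_mem_Icc.2 hαβ) (fun h => absurd h.1 (not_le.2 hα))] at hparts
    have hl0 : Complex.I * ((l : ℝ) : ℂ) ≠ 0 :=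
      mul_ne_zero Complex.I_ne_zero (Complex.ofReal_ne_zero.2 hl.ne')
    have heq : ∫ x in α..β, ((h (w, x) : ℝ) : ℂ) *
        (Complex.exp (Complex.I * ((l * φ w x : ℝ) : ℂ)) *
          (Complex.I * ((l * g (w, x) : ℝ) : ℂ))) = (Complex.I * ((l : ℝ) : ℂ)) *
        ∫ x in α..β, Complex.exp (Complex.I * ((l * φ w x : ℝ) : ℂ)) * ((a (w, x) : ℝ) : ℂ) := by
      rw [← intervalIntegral.integral_const_mul]
      refine intervalIntegral.integral_congr fun x hx => ?_
      have hg1 : ((g (w, x) : ℝ) : ℂ) ≠ 0 :=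
        Complex.ofReal_ne_zero.2 (hg0 _ (hmem x (hu ▸ hx)))
      simp only [hh]
      push_cast
      field_simp
    rw [heq] at hparts
    simp only [Complex.ofReal_zero, zero_mul, sub_self, zero_sub] at hparts
    have hfin : ∫ x in α..β, Complex.exp (Complex.I * ((l * φ w x : ℝ) : ℂ)) *
        ((a (w, x) : ℝ) : ℂ) = (Complex.I * ((l : ℝ) : ℂ))⁻¹ *
        -∫ x in α..β, Complex.exp (Complex.I * ((l * φ w x : ℝ) : ℂ)) *
          ((a' (w, x) : ℝ) : ℂ) := by
      rw [eq_inv_mul_iff_mul_eq₀ hl0, hparts]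
      simp only [mul_comm]
    rw [hfin, norm_mul, norm_neg, norm_inv, norm_mul, Complex.norm_I, one_mul, Complex.norm_real,
      Real.norm_of_nonneg hl.le, pow_succ, ← mul_assoc, mul_comm]
    exact mul_le_mul_of_nonneg_right (hC w hw l hl) (by positivity)

/-- The dispersion relation `ρ √(1 - μ + μ ρ²)` in normalised variables. -/
noncomputable def dispersion (μ ρ : ℝ) : ℝ := ρ * √(1 - μ + μ * ρ ^ 2)

noncomputable def dispersionDeriv (μ ρ : ℝ) : ℝ := (1 - μ + 2 * μ * ρ ^ 2) / √(1 - μ + μ * ρ ^ 2)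

noncomputable def dispersionDeriv2 (μ ρ : ℝ) : ℝ :=
  μ * ρ * (3 * (1 - μ) + 2 * μ * ρ ^ 2) / √(1 - μ + μ * ρ ^ 2) ^ 3

theorem hasDerivAt_sqrt_quadratic {μ ρ : ℝ} (h : 0 < 1 - μ + μ * ρ ^ 2) :
    HasDerivAt (fun ρ => √(1 - μ + μ * ρ ^ 2)) (μ * ρ / √(1 - μ + μ * ρ ^ 2)) ρ := by
  have h1 : HasDerivAt (fun ρ : ℝ => 1 - μ + μ * ρ ^ 2) (2 * μ * ρ) ρ :=
    (((hasDerivAt_pow 2 ρ).const_mul μ).const_add (1 - μ)).congr_deriv (by push_cast; ring)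
  have hs : √(1 - μ + μ * ρ ^ 2) ≠ 0 := (Real.sqrt_pos.2 h).ne'
  exact (h1.sqrt h.ne').congr_deriv (by field_simp)

theorem hasDerivAt_dispersion {μ ρ : ℝ} (h : 0 < 1 - μ + μ * ρ ^ 2) :
    HasDerivAt (dispersion μ) (dispersionDeriv μ ρ) ρ := by
  have hs : √(1 - μ + μ * ρ ^ 2) ≠ 0 := (Real.sqrt_pos.2 h).ne'
  have hss : √(1 - μ + μ * ρ ^ 2) ^ 2 = 1 - μ + μ * ρ ^ 2 := Real.sq_sqrt h.le
  refine ((hasDerivAt_id ρ).mul (hasDerivAt_sqrt_quadratic h)).congr_deriv ?_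
  rw [dispersionDeriv]
  simp only [id]
  field_simp
  linear_combination hss

theorem hasDerivAt_dispersionDeriv {μ ρ : ℝ} (h : 0 < 1 - μ + μ * ρ ^ 2) :
    HasDerivAt (dispersionDeriv μ) (dispersionDeriv2 μ ρ) ρ := by
  have hs : √(1 - μ + μ * ρ ^ 2) ≠ 0 := (Real.sqrt_pos.2 h).ne'
  have hss : √(1 - μ + μ * ρ ^ 2) ^ 2 = 1 - μ + μ * ρ ^ 2 := Real.sq_sqrt h.le
  have h1 : HasDerivAt (fun ρ : ℝ => 1 - μ + 2 * μ * ρ ^ 2) (4 * μ * ρ) ρ :=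
    (((hasDerivAt_pow 2 ρ).const_mul (2 * μ)).const_add (1 - μ)).congr_deriv
      (by push_cast; ring)
  refine (h1.div (hasDerivAt_sqrt_quadratic h) hs).congr_deriv ?_
  rw [dispersionDeriv2]
  field_simp
  linear_combination (4 * μ * ρ) * hss

theorem quadratic_bounds {μ ρ : ℝ} (hμ0 : 0 ≤ μ) (hμ1 : μ ≤ 1) (hρ : ρ ∈ Set.Icc (1 / 4 : ℝ) 4) :
    1 / 16 ≤ 1 - μ + μ * ρ ^ 2 ∧ 1 - μ + μ * ρ ^ 2 ≤ 16 := by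
  have h1 : 1 / 16 ≤ ρ ^ 2 := by nlinarith [hρ.1]
  have h2 : ρ ^ 2 ≤ 16 := by nlinarith [hρ.1, hρ.2]
  constructor <;> nlinarith

theorem quarter_le_dispersionDeriv {μ ρ : ℝ} (hμ0 : 0 ≤ μ) (hμ1 : μ ≤ 1)
    (hρ : ρ ∈ Set.Icc (1 / 4 : ℝ) 4) : 1 / 4 ≤ dispersionDeriv μ ρ := by
  obtain ⟨h1, h2⟩ := quadratic_bounds hμ0 hμ1 hρ
  have hq : 0 < 1 - μ + μ * ρ ^ 2 := by linarith
  have hs := Real.sqrt_pos.2 hq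
  rw [dispersionDeriv, le_div_iff₀ hs]
  have hss : √(1 - μ + μ * ρ ^ 2) * √(1 - μ + μ * ρ ^ 2) = 1 - μ + μ * ρ ^ 2 :=
    Real.mul_self_sqrt hq.le
  have h4 : 1 / 4 ≤ √(1 - μ + μ * ρ ^ 2) := Real.le_sqrt_of_sq_le (by linarith)
  nlinarith [mul_nonneg hμ0 (sq_nonneg ρ)]

theorem le_dispersionDeriv2 {μ ρ : ℝ} (hμ0 : 0 ≤ μ) (hμ1 : μ ≤ 1)
    (hρ : ρ ∈ Set.Icc (1 / 4 : ℝ) 4) : μ / 2048 ≤ dispersionDeriv2 μ ρ := by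
  obtain ⟨h1, h2⟩ := quadratic_bounds hμ0 hμ1 hρ
  have hq : 0 < 1 - μ + μ * ρ ^ 2 := by linarith
  have hs := Real.sqrt_pos.2 hq
  have h4 : √(1 - μ + μ * ρ ^ 2) ≤ 4 := Real.sqrt_le_iff.2 ⟨by norm_num, by linarith⟩
  have h3 : √(1 - μ + μ * ρ ^ 2) ^ 3 ≤ 64 :=
    (pow_le_pow_left₀ hs.le h4 3).trans (by norm_num)
  have h5 : 1 / 8 ≤ 3 * (1 - μ) + 2 * μ * ρ ^ 2 := by nlinarith [hρ.1]
  rw [dispersionDeriv2, le_div_iff₀ (by positivity)]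
  calc μ / 2048 * √(1 - μ + μ * ρ ^ 2) ^ 3 ≤ μ / 2048 * 64 := by gcongr
    _ = μ * (1 / 4) * (1 / 8) := by ring
    _ ≤ μ * ρ * (3 * (1 - μ) + 2 * μ * ρ ^ 2) := by
      have h6 : μ * (1 / 4) ≤ μ * ρ := mul_le_mul_of_nonneg_left hρ.1 hμ0
      exact mul_le_mul h6 h5 (by norm_num) (le_trans (by positivity) h6)

theorem continuousOn_dispersionDeriv2 {μ : ℝ} (hμ0 : 0 ≤ μ) (hμ1 : μ ≤ 1) :
    ContinuousOn (dispersionDeriv2 μ) (Set.Icc (1 / 4) 4) := by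
  have : Continuous fun ρ : ℝ => √(1 - μ + μ * ρ ^ 2) ^ 3 := by fun_prop
  refine ContinuousOn.div (by fun_prop) this.continuousOn fun ρ hρ => ?_
  have := (quadratic_bounds hμ0 hμ1 hρ).1
  exact pow_ne_zero 3 (Real.sqrt_pos.2 (by linarith)).ne'

/-- Rapid decay of the radial integral away from the stationary set. -/
theorem exists_norm_radial_integral_le_pow {V : ℝ → ℝ} (hV : ContDiff ℝ (⊤ : ℕ∞) V)
    (hV0 : ∀ ρ, ρ ∉ Set.Icc (1 / 3 : ℝ) 3 → V ρ = 0) (N : ℕ) : ∃ C : ℝ, 0 ≤ C ∧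
      ∀ μ ∈ Set.Icc (0 : ℝ) 1, ∀ b ∈ Set.Icc (-(1 / 8) : ℝ) (1 / 8), ∀ l : ℝ, 0 < l →
        ‖∫ ρ in (1 / 4 : ℝ)..4, Complex.exp (Complex.I * ((l * (dispersion μ ρ + b * ρ) : ℝ) : ℂ)) *
          ((V ρ : ℝ) : ℂ)‖ ≤ C * (l⁻¹) ^ N := by
  set Ω₀ : Set ((ℝ × ℝ) × ℝ) := {z | 0 < 1 - z.1.1 + z.1.1 * z.2 ^ 2} with hΩ₀
  have hΩ₀o : IsOpen Ω₀ := isOpen_lt continuous_const (by fun_prop)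
  set g : (ℝ × ℝ) × ℝ → ℝ := fun z => dispersionDeriv z.1.1 z.2 + z.1.2 with hg
  have hgΩ₀ : ContDiffOn ℝ (⊤ : ℕ∞) g Ω₀ := by
    have h1 : ContDiffOn ℝ (⊤ : ℕ∞)
        (fun z : (ℝ × ℝ) × ℝ => √(1 - z.1.1 + z.1.1 * z.2 ^ 2)) Ω₀ :=
      ContDiffOn.sqrt (by fun_prop) fun z hz => ne_of_gt hz
    refine ContDiffOn.add (ContDiffOn.div (by fun_prop) h1 fun z hz =>
      (Real.sqrt_pos.2 hz).ne') (by fun_prop)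
  have hΩ : IsOpen (Ω₀ ∩ g ⁻¹' {0}ᶜ) :=
    hgΩ₀.continuousOn.isOpen_inter_preimage hΩ₀o isOpen_compl_singleton
  have hsub : (Set.Icc (0 : ℝ) 1 ×ˢ Set.Icc (-(1 / 8) : ℝ) (1 / 8)) ×ˢ Set.Icc (1 / 4 : ℝ) 4 ⊆
      Ω₀ ∩ g ⁻¹' {0}ᶜ := by
    rintro ⟨⟨μ, b⟩, ρ⟩ ⟨⟨hμ, hb⟩, hρ⟩
    refine ⟨?_, ?_⟩
    · have := (quadratic_bounds hμ.1 hμ.2 hρ).1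
      change 0 < 1 - μ + μ * ρ ^ 2
      linarith
    · have h1 := quarter_le_dispersionDeriv hμ.1 hμ.2 hρ
      have h2 : -(1 / 8) ≤ b := hb.1
      change dispersionDeriv μ ρ + b ≠ 0
      intro h0
      linarith
  obtain ⟨C, hC0, hC⟩ := exists_norm_integral_exp_le_pow hΩ
    (isCompact_Icc.prod isCompact_Icc) (α₁ := 1 / 3) (β₁ := 3) (by norm_num) (by norm_num)
    (by norm_num) hsub (φ := fun w ρ => dispersion w.1 ρ + w.2 * ρ)
    (hgΩ₀.mono Set.inter_subset_left) (fun z hz => hz.2)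
    (fun w hw ρ hρ => by
      have := (quadratic_bounds hw.1.1 hw.1.2 hρ).1
      refine (hasDerivAt_dispersion (by linarith)).add ?_
      simpa using (hasDerivAt_id ρ).const_mul w.2) N
    (fun z => V z.2) (hV.comp contDiff_snd).contDiffOn (fun z _ hz => hV0 z.2 hz)
  exact ⟨C, hC0, fun μ hμ b hb l hl => hC (μ, b) ⟨hμ, hb⟩ l hl⟩

theorem norm_poleProfile_neg (n : ℕ) (s : ℝ) : ‖poleProfile n (-s)‖ = ‖poleProfile n s‖ := by
  rw [poleProfile_neg, RCLike.norm_conj]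

theorem norm_poleProfileDeriv_neg (n : ℕ) (s : ℝ) :
    ‖poleProfileDeriv n (-s)‖ = ‖poleProfileDeriv n s‖ := by
  have : poleProfileDeriv n (-s) = -(starRingEnd ℂ) (poleProfileDeriv n s) := by
    rw [poleProfileDeriv, poleProfileDeriv, intervalIntegral.integral_of_le (Real.sqrt_nonneg 2),
      intervalIntegral.integral_of_le (Real.sqrt_nonneg 2), ← integral_conj, ← integral_neg]
    congr 1; ext v
    rw [map_mul, map_mul, ← Complex.exp_conj, map_mul, Complex.conj_I, Complex.conj_ofReal,
      Complex.conj_ofReal, (by push_cast; ring : Complex.I * ((-s * v ^ 2 : ℝ) : ℂ) =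
        -Complex.I * ((s * v ^ 2 : ℝ) : ℂ))]
    ring
  rw [this, norm_neg, RCLike.norm_conj]

theorem exists_norm_radial_pole_le (n : ℕ) {V : ℝ → ℝ} (hV : ContDiff ℝ (⊤ : ℕ∞) V) :
    ∃ C : ℝ, 0 ≤ C ∧ ∀ μ l r ς : ℝ, 0 < μ → μ ≤ 1 → 0 < l → l / 8 ≤ r → (ς = 1 ∨ ς = -1) →
      ‖∫ ρ in (1 / 4 : ℝ)..4, Complex.exp (Complex.I * ((l * dispersion μ ρ + ς * r * ρ : ℝ) : ℂ)) *
        (poleProfile n (-ς * r * ρ) * ((V ρ : ℝ) : ℂ))‖ ≤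
          C * ((√μ)⁻¹ * l ^ (-(((n : ℝ) + 2) / 2))) := by
  obtain ⟨C₁, hC1, hC⟩ := exists_norm_poleProfile_le n
  have hVc := hV.continuous
  have hV'c : Continuous (deriv V) := hV.continuous_deriv (by simp)
  obtain ⟨A, hA⟩ := isCompact_Icc.exists_bound_of_continuousOn (s := Set.Icc (1 / 4 : ℝ) 4)
    hVc.continuousOn
  obtain ⟨A', hA'⟩ := isCompact_Icc.exists_bound_of_continuousOn (s := Set.Icc (1 / 4 : ℝ) 4)
    hV'c.continuousOn
  have hA0 : 0 ≤ A := (norm_nonneg _).trans (hA 1 ⟨by norm_num, by norm_num⟩)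
  have hA'0 : 0 ≤ A' := (norm_nonneg _).trans (hA' 1 ⟨by norm_num, by norm_num⟩)
  set T : ℝ := (1 / 32 : ℝ) ^ (-(((n : ℝ) + 1) / 2)) with hT
  have hT0 : 0 ≤ T := by positivity
  refine ⟨(√(1 / 2048))⁻¹ * (10 * (C₁ * T * A) + 2 * (4 - 1 / 4) *
    (C₁ * T * (4 * A + A'))), by positivity, fun μ l r ς hμ0 hμ1 hl hr hς => ?_⟩
  set D : ℝ := l ^ (-(((n : ℝ) + 1) / 2)) with hD
  have hD0 : 0 ≤ D := by positivity
  have hςn : ‖ς‖ = 1 := by rcases hς with rfl | rfl <;> simp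
  have hr0 : 0 < r := by linarith
  have hnP : ∀ s, ‖poleProfile n (-ς * s)‖ = ‖poleProfile n s‖ := fun s => by
    rcases hς with rfl | rfl
    · rw [neg_one_mul, norm_poleProfile_neg]
    · rw [neg_neg, one_mul]
  have hnP' : ∀ s, ‖poleProfileDeriv n (-ς * s)‖ = ‖poleProfileDeriv n s‖ := fun s => by
    rcases hς with rfl | rfl
    · rw [neg_one_mul, norm_poleProfileDeriv_neg]
    · rw [neg_neg, one_mul]
  have hpow : ∀ ρ ∈ Set.Icc (1 / 4 : ℝ) 4, (r * ρ) ^ (-(((n : ℝ) + 1) / 2)) ≤ T * D := by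
    intro ρ hρ
    rw [hT, hD, ← Real.mul_rpow (by norm_num) hl.le]
    refine Real.rpow_le_rpow_of_nonpos (by positivity) ?_ (neg_nonpos.2 (by positivity))
    nlinarith [hρ.1]
  have hP : ∀ ρ ∈ Set.Icc (1 / 4 : ℝ) 4, ‖poleProfile n (-ς * r * ρ)‖ ≤ C₁ * (T * D) := by
    intro ρ hρ
    rw [mul_assoc, hnP]
    exact (hC _ (mul_pos hr0 (by linarith [hρ.1]))).1.trans
      (mul_le_mul_of_nonneg_left (hpow ρ hρ) hC1)
  have hP' : ∀ ρ ∈ Set.Icc (1 / 4 : ℝ) 4,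
      ‖((-ς * r : ℝ) : ℂ) * poleProfileDeriv n (-ς * r * ρ)‖ ≤ C₁ * (T * D) * 4 := by
    intro ρ hρ
    have hρ0 : 0 < ρ := by linarith [hρ.1]
    have hs : 0 < r * ρ := mul_pos hr0 hρ0
    rw [norm_mul, Complex.norm_real, norm_mul, norm_neg, hςn, one_mul, mul_assoc (-ς), hnP',
      Real.norm_of_nonneg hr0.le]
    have e : (r * ρ) ^ (-(((n : ℝ) + 3) / 2)) = (r * ρ) ^ (-(((n : ℝ) + 1) / 2)) * (r * ρ)⁻¹ := by
      rw [← Real.rpow_neg_one, ← Real.rpow_add hs]; congr 1; ring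
    calc r * ‖poleProfileDeriv n (r * ρ)‖ ≤ r * (C₁ * (r * ρ) ^ (-(((n : ℝ) + 3) / 2))) := by
          gcongr; exact (hC _ hs).2
      _ = C₁ * (r * ρ) ^ (-(((n : ℝ) + 1) / 2)) * ρ⁻¹ := by rw [e]; field_simp
      _ ≤ C₁ * (T * D) * 4 := by
          refine mul_le_mul (mul_le_mul_of_nonneg_left (hpow ρ hρ) hC1) ?_ (by positivity)
            (by positivity)
          rw [inv_le_comm₀ hρ0 (by norm_num)]; linarith [hρ.1]
  have hq : ∀ ρ ∈ Set.Icc (1 / 4 : ℝ) 4, 0 < 1 - μ + μ * ρ ^ 2 := fun ρ hρ => by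
    linarith [(quadratic_bounds hμ0.le hμ1 hρ).1]
  have hPc : Continuous (poleProfile n) :=
    continuous_iff_continuousAt.2 fun s => (hasDerivAt_poleProfile n s).continuousAt
  have hP'c := continuous_poleProfileDeriv n
  have hvdc := norm_integral_exp_mul_le_of_second_deriv (α := 1 / 4) (β := 4) (by norm_num)
    (Φ := fun ρ => l * dispersion μ ρ + ς * r * ρ)
    (Φ' := fun ρ => l * dispersionDeriv μ ρ + ς * r) (Φ'' := fun ρ => l * dispersionDeriv2 μ ρ)
    (a := fun ρ => poleProfile n (-ς * r * ρ) * ((V ρ : ℝ) : ℂ))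
    (a' := fun ρ => ((-ς * r : ℝ) : ℂ) * poleProfileDeriv n (-ς * r * ρ) * ((V ρ : ℝ) : ℂ) +
      poleProfile n (-ς * r * ρ) * ((deriv V ρ : ℝ) : ℂ))
    (ρ := l * μ * (1 / 2048)) (A₀ := C₁ * T * A * D) (A₁ := C₁ * T * (4 * A + A') * D)
    (fun ρ hρ => ((hasDerivAt_dispersion (hq ρ hρ)).const_mul l).add
      (by simpa using (hasDerivAt_id ρ).const_mul (ς * r)))
    (fun ρ hρ => ((hasDerivAt_dispersionDeriv (hq ρ hρ)).const_mul l).add_const _)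
    (continuousOn_const.mul (continuousOn_dispersionDeriv2 hμ0.le hμ1))
    (by positivity)
    (fun ρ hρ => by
      rw [mul_assoc]
      exact mul_le_mul_of_nonneg_left
        (le_of_eq_of_le (by ring) (le_dispersionDeriv2 hμ0.le hμ1 hρ)) hl.le)
    (fun ρ hρ => by
      have h1 : HasDerivAt (fun ρ => -ς * r * ρ) (-ς * r) ρ := by
        simpa using (hasDerivAt_id ρ).const_mul (-ς * r)
      have h2 := (hasDerivAt_poleProfile n (-ς * r * ρ)).scomp ρ h1
      refine (h2.mul ((hV.differentiable (by simp) ρ).hasDerivAt.ofReal_comp)).congr_deriv ?_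
      rw [Complex.real_smul]; rfl)
    (by fun_prop)
    (fun ρ hρ => by
      rw [norm_mul, Complex.norm_real]
      calc _ ≤ C₁ * (T * D) * A := by
            gcongr
            · exact hP ρ hρ
            · exact hA ρ hρ
        _ = _ := by ring)
    (fun ρ hρ => by
      refine (norm_add_le _ _).trans ?_
      rw [norm_mul _ ((V ρ : ℝ) : ℂ), norm_mul _ ((deriv V ρ : ℝ) : ℂ), Complex.norm_real,
        Complex.norm_real]
      calc _ ≤ C₁ * (T * D) * 4 * A + C₁ * (T * D) * A' := by
            gcongr
            · exact hP' ρ hρ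
            · exact hA ρ hρ
            · exact hP ρ hρ
            · exact hA' ρ hρ
        _ = _ := by ring)
  refine hvdc.trans (le_of_eq ?_)
  have e : l ^ (-(((n : ℝ) + 2) / 2)) = (√l)⁻¹ * D := by
    rw [hD, Real.sqrt_eq_rpow, ← Real.rpow_neg hl.le, ← Real.rpow_add hl]; congr 1; ring
  rw [e, Real.sqrt_mul (by positivity), Real.sqrt_mul hl.le, mul_inv, mul_inv]
  ring

/-- Decay of the Fourier transform of a radial wave packet, in polar coordinates. -/
theorem exists_norm_radial_integral_le (n : ℕ) {V : ℝ → ℝ} (hV : ContDiff ℝ (⊤ : ℕ∞) V)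
    (hV0 : ∀ ρ, ρ ∉ Set.Icc (1 / 3 : ℝ) 3 → V ρ = 0) :
    ∃ C : ℝ, 0 ≤ C ∧ ∀ μ l r : ℝ, 0 < μ → μ ≤ 1 → 1 ≤ l → 0 ≤ r →
      ‖∫ ρ in (1 / 4 : ℝ)..4, Complex.exp (Complex.I * ((l * dispersion μ ρ : ℝ) : ℂ)) *
        ((V ρ : ℝ) : ℂ) * ∫ θ in (0 : ℝ)..Real.pi,
          Complex.exp (Complex.I * ((r * ρ * Real.cos θ : ℝ) : ℂ)) * ((Real.sin θ ^ n : ℝ) : ℂ)‖ ≤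
          C * ((√μ)⁻¹ * l ^ (-(((n : ℝ) + 2) / 2))) := by
  obtain ⟨C₁, h1, H1⟩ := exists_norm_radial_pole_le n hV
  obtain ⟨C₂, h2, H2⟩ := exists_norm_radial_integral_le_pow hV hV0 (n + 2)
  have hVc := hV.continuous
  refine ⟨2 * C₁ + C₂ * Real.pi, by positivity, fun μ l r hμ0 hμ1 hl hr => ?_⟩
  have hl0 : 0 < l := by linarith
  have hdc : Continuous (dispersion μ) := by unfold dispersion; fun_prop
  have hPc : Continuous (poleProfile n) :=
    continuous_iff_continuousAt.2 fun s => (hasDerivAt_poleProfile n s).continuousAt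
  set D := (√μ)⁻¹ * l ^ (-(((n : ℝ) + 2) / 2)) with hD
  have hD0 : 0 ≤ D := by positivity
  rcases le_total (l / 8) r with hr8 | hr8
  · have hsplit : ∫ ρ in (1 / 4 : ℝ)..4, Complex.exp (Complex.I * ((l * dispersion μ ρ : ℝ) : ℂ)) *
        ((V ρ : ℝ) : ℂ) * ∫ θ in (0 : ℝ)..Real.pi,
          Complex.exp (Complex.I * ((r * ρ * Real.cos θ : ℝ) : ℂ)) * ((Real.sin θ ^ n : ℝ) : ℂ) =
        (∫ ρ in (1 / 4 : ℝ)..4,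
          Complex.exp (Complex.I * ((l * dispersion μ ρ + 1 * r * ρ : ℝ) : ℂ)) *
            (poleProfile n (-1 * r * ρ) * ((V ρ : ℝ) : ℂ))) +
        ∫ ρ in (1 / 4 : ℝ)..4,
          Complex.exp (Complex.I * ((l * dispersion μ ρ + -1 * r * ρ : ℝ) : ℂ)) *
            (poleProfile n (-(-1) * r * ρ) * ((V ρ : ℝ) : ℂ)) := by
      rw [← intervalIntegral.integral_add (Continuous.intervalIntegrable (by fun_prop) _ _)
        (Continuous.intervalIntegrable (by fun_prop) _ _)]
      congr 1; ext ρ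
      rw [integral_sphere_eq]
      simp only [one_mul, neg_mul, neg_neg, Complex.ofReal_add, Complex.ofReal_neg, mul_add,
        Complex.exp_add]
      ring
    rw [hsplit]
    refine (norm_add_le _ _).trans ((add_le_add (H1 μ l r 1 hμ0 hμ1 hl0 hr8 (Or.inl rfl))
      (H1 μ l r (-1) hμ0 hμ1 hl0 hr8 (Or.inr rfl))).trans ?_)
    have : 0 ≤ C₂ * Real.pi * D := by positivity
    linarith
  · have hswap : ∫ ρ in (1 / 4 : ℝ)..4, Complex.exp (Complex.I * ((l * dispersion μ ρ : ℝ) : ℂ)) *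
        ((V ρ : ℝ) : ℂ) * ∫ θ in (0 : ℝ)..Real.pi,
          Complex.exp (Complex.I * ((r * ρ * Real.cos θ : ℝ) : ℂ)) * ((Real.sin θ ^ n : ℝ) : ℂ) =
        ∫ θ in (0 : ℝ)..Real.pi, ((Real.sin θ ^ n : ℝ) : ℂ) * ∫ ρ in (1 / 4 : ℝ)..4,
          Complex.exp (Complex.I * ((l * (dispersion μ ρ + r / l * Real.cos θ * ρ) : ℝ) : ℂ)) *
          ((V ρ : ℝ) : ℂ) := by
      simp only [← intervalIntegral.integral_const_mul]
      rw [intervalIntegral_intervalIntegral_swap]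
      · congr 1; ext θ; congr 1; ext ρ
        have e : l * (dispersion μ ρ + r / l * Real.cos θ * ρ) =
            l * dispersion μ ρ + r * ρ * Real.cos θ := by field_simp
        rw [e, Complex.ofReal_add, mul_add, Complex.exp_add]
        ring
      · refine IntegrableOn.mono_set (t := Set.uIcc (1 / 4) 4 ×ˢ Set.uIcc 0 Real.pi)
          (ContinuousOn.integrableOn_compact (isCompact_uIcc.prod isCompact_uIcc)
            (Continuous.continuousOn ?_))
          (Set.prod_mono Set.uIoc_subset_uIcc Set.uIoc_subset_uIcc)
        simp only [Function.uncurry_def]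
        fun_prop
    rw [hswap]
    have hb : ∀ θ : ℝ, r / l * Real.cos θ ∈ Set.Icc (-(1 / 8) : ℝ) (1 / 8) := fun θ => by
      have h3 : r / l ≤ 1 / 8 := by rw [div_le_iff₀ hl0]; linarith
      have h4 : 0 ≤ r / l := by positivity
      constructor <;> nlinarith [Real.neg_one_le_cos θ, Real.cos_le_one θ]
    have hle : (l⁻¹) ^ (n + 2) ≤ D := by
      rw [hD, inv_pow, ← Real.rpow_natCast, ← Real.rpow_neg hl0.le]
      have h5 : l ^ (-((n + 2 : ℕ) : ℝ)) ≤ l ^ (-(((n : ℝ) + 2) / 2)) := by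
        refine Real.rpow_le_rpow_of_exponent_le hl ?_
        have : (0 : ℝ) ≤ n := Nat.cast_nonneg n
        push_cast; linarith
      have h6 : 1 ≤ (√μ)⁻¹ :=
        (one_le_inv₀ (Real.sqrt_pos.2 hμ0)).2 (Real.sqrt_le_one.2 hμ1)
      exact h5.trans (le_mul_of_one_le_left (by positivity) h6)
    refine (intervalIntegral.norm_integral_le_of_norm_le_const (C := C₂ * D) fun θ _ => ?_).trans ?_
    · rw [norm_mul, Complex.norm_real, norm_pow]
      have h7 : ‖Real.sin θ‖ ^ n ≤ 1 := pow_le_one₀ (norm_nonneg _) (Real.abs_sin_le_one θ)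
      refine (mul_le_of_le_one_left (norm_nonneg _) h7).trans
        ((H2 μ ⟨hμ0.le, hμ1⟩ _ (hb θ) l hl0).trans ?_)
      gcongr
    · rw [sub_zero, abs_of_pos Real.pi_pos]
      have : 0 ≤ C₁ * D := by positivity
      linarith

lemma exists_linearIsometryEquiv_withLp_prod (n : ℕ) (x : EuclideanSpace ℝ (Fin (n + 2))) :
    ∃ Ψ : WithLp 2 (ℝ × EuclideanSpace ℝ (Fin (n + 1))) ≃ₗᵢ[ℝ] EuclideanSpace ℝ (Fin (n + 2)),
      Ψ (WithLp.toLp 2 (‖x‖, 0)) = x := by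
  have hfin : Module.finrank ℝ (WithLp 2 (ℝ × EuclideanSpace ℝ (Fin (n + 1)))) = n + 2 := by
    rw [(WithLp.linearEquiv 2 ℝ (ℝ × EuclideanSpace ℝ (Fin (n + 1)))).finrank_eq]
    simp
    ring
  let Φ : WithLp 2 (ℝ × EuclideanSpace ℝ (Fin (n + 1))) ≃ₗᵢ[ℝ] EuclideanSpace ℝ (Fin (n + 2)) :=
    (stdOrthonormalBasis ℝ _).equiv (EuclideanSpace.basisFun (Fin (n + 2)) ℝ) (finCongr hfin)
  set v := Φ (WithLp.toLp 2 (‖x‖, 0)) with hv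
  have hnorm : ‖v‖ = ‖x‖ := by
    rw [hv, LinearIsometryEquiv.norm_map, WithLp.prod_norm_eq_of_L2]
    simp
  refine ⟨Φ.trans (Submodule.reflection (ℝ ∙ (v - x))ᗮ), ?_⟩
  simpa using Submodule.reflection_sub hnorm

lemma integrable_of_continuous_of_support_subset {X : Type*} [NormedAddCommGroup X]
    [InnerProductSpace ℝ X] [FiniteDimensional ℝ X] [MeasurableSpace X] [BorelSpace X]
    {μ : Measure X} [IsFiniteMeasureOnCompacts μ] {f : X → ℂ} (hf : Continuous f) {r : ℝ}
    (h : ∀ x, r < ‖x‖ → f x = 0) : Integrable f μ :=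
  hf.integrable_of_hasCompactSupport <| HasCompactSupport.intro (isCompact_closedBall 0 r)
    fun x hx => h x (by simpa using hx)

lemma integral_withLp_prod_exp_mul (n : ℕ) {G : ℝ → ℂ} (hG : Continuous G)
    (hG0 : ∀ ρ, ρ ∉ Set.Icc (1/3 : ℝ) 3 → G ρ = 0) (r : ℝ) :
    ∫ z : WithLp 2 (ℝ × EuclideanSpace ℝ (Fin (n + 1))),
        Complex.exp (Complex.I * ((r * z.fst : ℝ) : ℂ)) * G ‖z‖ =
      ((n + 1) * volume.real (Metric.ball (0 : EuclideanSpace ℝ (Fin (n + 1))) 1) : ℝ) *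
        ∫ s : ℝ, ∫ t in Set.Ioi (0 : ℝ), Complex.exp (Complex.I * ((r * s : ℝ) : ℂ)) *
          ((t ^ n : ℝ) : ℂ) * G √(s ^ 2 + t ^ 2) := by
  have hcont : Continuous fun z : WithLp 2 (ℝ × EuclideanSpace ℝ (Fin (n + 1))) =>
      Complex.exp (Complex.I * ((r * z.fst : ℝ) : ℂ)) * G ‖z‖ := by
    have : Continuous fun z : WithLp 2 (ℝ × EuclideanSpace ℝ (Fin (n + 1))) => z.fst :=
      (WithLp.fstL 2 ℝ ℝ (EuclideanSpace ℝ (Fin (n + 1)))).continuous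
    fun_prop
  have hint := integrable_of_continuous_of_support_subset (μ := volume) hcont (r := 3) fun z hz => by
    rw [hG0 _ fun h => (h.2.trans_lt hz).false, mul_zero]
  have hmp := WithLp.volume_preserving_toLp ℝ (EuclideanSpace ℝ (Fin (n + 1)))
  have hemb := (MeasurableEquiv.toLp 2 (ℝ × EuclideanSpace ℝ (Fin (n + 1)))).measurableEmbedding
  rw [← hmp.integral_comp hemb]
  rw [← hmp.integrable_comp_emb hemb] at hint
  rw [Measure.volume_eq_prod] at hint ⊢
  rw [Function.comp_def] at hint
  rw [integral_prod _ hint, ← integral_const_mul]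
  congr 1 with s
  simp only [WithLp.prod_norm_eq_of_L2, WithLp.toLp_fst, WithLp.toLp_snd, Real.norm_eq_abs, sq_abs]
  rw [integral_fun_norm_addHaar volume (fun t : ℝ =>
    Complex.exp (Complex.I * ((r * s : ℝ) : ℂ)) * G √(s ^ 2 + t ^ 2))]
  simp only [finrank_euclideanSpace, Fintype.card_fin, add_tsub_cancel_right]
  rw [nsmul_eq_mul, Complex.real_smul]
  push_cast
  rw [mul_assoc]
  congr 2
  refine integral_congr_ae (.of_forall fun t => ?_)
  simp only [Complex.real_smul, Complex.ofReal_pow]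
  ring

lemma integral_upper_half_plane_polar (n : ℕ) {G : ℝ → ℂ} (hG : Continuous G)
    (hG0 : ∀ ρ, ρ ∉ Set.Icc (1/3 : ℝ) 3 → G ρ = 0) (r : ℝ) :
    ∫ s : ℝ, ∫ t in Set.Ioi (0 : ℝ), Complex.exp (Complex.I * ((r * s : ℝ) : ℂ)) *
          ((t ^ n : ℝ) : ℂ) * G √(s ^ 2 + t ^ 2) =
      ∫ ρ in (1/4 : ℝ)..4, G ρ * ((ρ ^ (n + 1) : ℝ) : ℂ) *
        ∫ θ in (0:ℝ)..Real.pi, Complex.exp (Complex.I * ((r * ρ * Real.cos θ : ℝ) : ℂ)) *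
          ((Real.sin θ ^ n : ℝ) : ℂ) := by
  set F : ℝ × ℝ → ℂ := fun z => Complex.exp (Complex.I * ((r * z.1 : ℝ) : ℂ)) *
          ((z.2 ^ n : ℝ) : ℂ) * G √(z.1 ^ 2 + z.2 ^ 2) with hF
  have hFc : Continuous F := by fun_prop
  have hFi : Integrable F := by
    refine hFc.integrable_of_hasCompactSupport <|
      HasCompactSupport.intro (isCompact_closedBall 0 3) fun z hz => ?_
    have hz' : 3 < ‖z‖ := by simpa using hz
    have : 3 < √(z.1 ^ 2 + z.2 ^ 2) := by
      refine hz'.trans_le (Real.le_sqrt_of_sq_le ?_)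
      rw [Prod.norm_def]
      rcases max_cases ‖z.1‖ ‖z.2‖ with h | h <;> rw [h.1, Real.norm_eq_abs, sq_abs] <;> nlinarith
    simp only [hF]
    rw [hG0 _ fun h => (h.2.trans_lt this).false, mul_zero]
  have hmeas : MeasurableSet (Set.univ ×ˢ Set.Ioi (0:ℝ) : Set (ℝ × ℝ)) :=
    MeasurableSet.univ.prod measurableSet_Ioi
  calc
    _ = ∫ z in Set.univ ×ˢ Set.Ioi (0:ℝ), F z := by
      rw [Measure.volume_eq_prod, setIntegral_prod _ (by
        rw [← Measure.volume_eq_prod]; exact hFi.integrableOn)]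
      simp only [hF, Measure.restrict_univ]
    _ = ∫ z, (Set.univ ×ˢ Set.Ioi (0:ℝ)).indicator F z := (integral_indicator hmeas).symm
    _ = ∫ z in Set.Ioi (0:ℝ) ×ˢ Set.Ioo (-Real.pi) Real.pi,
          z.1 • (Set.univ ×ˢ Set.Ioi (0:ℝ)).indicator F (polarCoord.symm z) := by
      rw [← integral_comp_polarCoord_symm]; rfl
    _ = ∫ z in Set.Icc (1/4:ℝ) 4 ×ˢ Set.Ioo 0 Real.pi, (G z.1 * ((z.1 ^ (n + 1) : ℝ) : ℂ)) *
          (Complex.exp (Complex.I * ((r * z.1 * Real.cos z.2 : ℝ) : ℂ)) *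
          ((Real.sin z.2 ^ n : ℝ) : ℂ)) := by
      rw [← integral_indicator (measurableSet_Ioi.prod measurableSet_Ioo),
        ← integral_indicator (measurableSet_Icc.prod measurableSet_Ioo)]
      congr 1 with z
      obtain ⟨ρ, θ⟩ := z
      simp only [Set.indicator_apply, Set.mem_prod, Set.mem_univ, true_and, Set.mem_Ioi,
        Set.mem_Ioo, Set.mem_Icc, polarCoord_symm_apply]
      by_cases hρ : ρ ∈ Set.Icc (1/3 : ℝ) 3
      · have hρ0 : 0 < ρ := by linarith [hρ.1]
        have h1 : 1/4 ≤ ρ := by linarith [hρ.1]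
        have h2 : ρ ≤ 4 := by linarith [hρ.2]
        have hsq : √((ρ * Real.cos θ) ^ 2 + (ρ * Real.sin θ) ^ 2) = ρ := by
          rw [(by linear_combination ρ ^ 2 * Real.cos_sq_add_sin_sq θ :
            (ρ * Real.cos θ) ^ 2 + (ρ * Real.sin θ) ^ 2 = ρ ^ 2), Real.sqrt_sq hρ0.le]
        simp only [hρ0, h1, h2, true_and, and_self]
        by_cases hθ : 0 < θ ∧ θ < Real.pi
        · have : 0 < Real.sin θ := Real.sin_pos_of_pos_of_lt_pi hθ.1 hθ.2
          have h3 : -Real.pi < θ ∧ θ < Real.pi := ⟨by linarith [Real.pi_pos, hθ.1], hθ.2⟩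
          rw [if_pos h3, if_pos hθ, if_pos (mul_pos hρ0 this)]
          simp only [hF, hsq, Complex.real_smul]
          rw [mul_assoc r]
          push_cast
          ring
        · rw [if_neg hθ]
          split_ifs with h3 h4
          · exfalso
            refine hθ ⟨?_, h3.2⟩
            by_contra! h5
            have := Real.sin_nonpos_of_nonpos_of_neg_pi_le h5 h3.1.le
            nlinarith
          · simp
          · rfl
      · rw [hG0 _ hρ]
        simp only [zero_mul, ite_self]
        split_ifs with h3 h4
        · have hsq : √((ρ * Real.cos θ) ^ 2 + (ρ * Real.sin θ) ^ 2) = ρ := by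
            rw [(by linear_combination ρ ^ 2 * Real.cos_sq_add_sin_sq θ :
              (ρ * Real.cos θ) ^ 2 + (ρ * Real.sin θ) ^ 2 = ρ ^ 2), Real.sqrt_sq h3.1.le]
          simp only [hF, hsq, hG0 _ hρ, mul_zero, smul_zero]
        · simp
        · rfl
    _ = _ := by
      rw [Measure.volume_eq_prod, setIntegral_prod _ ?_]
      · rw [intervalIntegral.integral_of_le (by norm_num), integral_Icc_eq_integral_Ioc]
        refine integral_congr_ae (.of_forall fun ρ => ?_)
        simp only
        rw [integral_const_mul, intervalIntegral.integral_of_le Real.pi_pos.le,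
          integral_Ioc_eq_integral_Ioo]
      · rw [← Measure.volume_eq_prod]
        refine IntegrableOn.mono_set (t := Set.Icc (1/4:ℝ) 4 ×ˢ Set.Icc 0 Real.pi)
          (ContinuousOn.integrableOn_compact (isCompact_Icc.prod isCompact_Icc)
            (Continuous.continuousOn ?_)) ?_
        · fun_prop
        · exact Set.prod_mono le_rfl Set.Ioo_subset_Icc_self

lemma integral_exp_inner_mul_norm (n : ℕ) {G : ℝ → ℂ} (hG : Continuous G)
    (hG0 : ∀ ρ, ρ ∉ Set.Icc (1/3 : ℝ) 3 → G ρ = 0) (x : EuclideanSpace ℝ (Fin (n + 2))) :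
    ∫ ξ, Complex.exp (Complex.I * ((inner ℝ x ξ : ℝ) : ℂ)) * G ‖ξ‖ =
      ((n + 1) * volume.real (Metric.ball (0 : EuclideanSpace ℝ (Fin (n + 1))) 1) : ℝ) *
      ∫ ρ in (1/4 : ℝ)..4, G ρ * ((ρ ^ (n + 1) : ℝ) : ℂ) *
        ∫ θ in (0:ℝ)..Real.pi, Complex.exp (Complex.I * ((‖x‖ * ρ * Real.cos θ : ℝ) : ℂ)) *
          ((Real.sin θ ^ n : ℝ) : ℂ) := by
  obtain ⟨Ψ, hΨ⟩ := exists_linearIsometryEquiv_withLp_prod n x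
  rw [← integral_upper_half_plane_polar n hG hG0, ← integral_withLp_prod_exp_mul n hG hG0,
    ← Ψ.measurePreserving.integral_comp Ψ.toMeasurableEquiv.measurableEmbedding]
  congr 1 with z
  rw [Ψ.norm_map]
  congr 4
  conv_lhs => rw [← hΨ, Ψ.inner_map_map, WithLp.prod_inner_apply]
  simp [mul_comm]

lemma continuous_dispersion (μ : ℝ) : Continuous (dispersion μ) := by
  unfold dispersion
  fun_prop

/-- The dispersive estimate for the rescaled acoustic propagator, localized to unit
frequencies. -/
theorem exists_norm_dispersive_integral_le (n : ℕ) {W : ℝ → ℝ} (hW : ContDiff ℝ (⊤ : ℕ∞) W)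
    (hW0 : ∀ ρ, ρ ∉ Set.Icc (1/3 : ℝ) 3 → W ρ = 0) :
    ∃ C, 0 ≤ C ∧ ∀ μ l, 0 < μ → μ ≤ 1 → l ≠ 0 → ∀ x : EuclideanSpace ℝ (Fin (n + 2)),
      ‖∫ ξ, Complex.exp (Complex.I * ((inner ℝ x ξ : ℝ) : ℂ)) *
        (Complex.exp (Complex.I * ((l * dispersion μ ‖ξ‖ : ℝ) : ℂ)) * ((W ‖ξ‖ : ℝ) : ℂ))‖ ≤
      C * ((√μ)⁻¹ * |l| ^ (-(((n:ℝ)+2)/2))) := by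
  obtain ⟨C₁, hC₁, h₁⟩ := exists_norm_radial_integral_le n (V := fun ρ => W ρ * ρ ^ (n + 1))
    (by fun_prop) (fun ρ hρ => by simp [hW0 ρ hρ])
  set c : ℝ := (n + 1) * volume.real (Metric.ball (0 : EuclideanSpace ℝ (Fin (n + 1))) 1)
  have hc : 0 ≤ c := by positivity
  set C₂ : ℝ := ∫ ξ : EuclideanSpace ℝ (Fin (n + 2)), |W ‖ξ‖| with hC₂
  have hC₂0 : 0 ≤ C₂ := integral_nonneg fun _ => abs_nonneg _
  have hpos : ∀ μ l, 0 < μ → μ ≤ 1 → 0 < l → ∀ x : EuclideanSpace ℝ (Fin (n + 2)),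
      ‖∫ ξ, Complex.exp (Complex.I * ((inner ℝ x ξ : ℝ) : ℂ)) *
        (Complex.exp (Complex.I * ((l * dispersion μ ‖ξ‖ : ℝ) : ℂ)) * ((W ‖ξ‖ : ℝ) : ℂ))‖ ≤
      (c * C₁ + C₂) * ((√μ)⁻¹ * l ^ (-(((n:ℝ)+2)/2))) := by
    intro μ l hμ hμ1 hl x
    have hA : 0 ≤ (√μ)⁻¹ * l ^ (-(((n:ℝ)+2)/2)) := by positivity
    rcases le_or_gt 1 l with h | h
    · have hd := continuous_dispersion μ
      have hWc := hW.continuous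
      rw [integral_exp_inner_mul_norm n
        (G := fun ρ => Complex.exp (Complex.I * ((l * dispersion μ ρ : ℝ) : ℂ)) * ((W ρ : ℝ) : ℂ))
        (by fun_prop) (fun ρ hρ => by simp [hW0 ρ hρ]), norm_mul, Complex.norm_real,
        Real.norm_of_nonneg hc]
      have := h₁ μ l ‖x‖ hμ hμ1 h (norm_nonneg _)
      simp only [Complex.ofReal_mul, ← mul_assoc] at this ⊢
      calc _ ≤ c * (C₁ * (√μ)⁻¹ * l ^ (-(((n:ℝ)+2)/2))) := mul_le_mul_of_nonneg_left this hc
        _ ≤ _ := by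
          rw [mul_assoc _ (√μ)⁻¹, mul_assoc _ (√μ)⁻¹]
          nlinarith
    · have h1 : 1 ≤ (√μ)⁻¹ * l ^ (-(((n:ℝ)+2)/2)) := by
        have h2 : 1 ≤ (√μ)⁻¹ := (one_le_inv₀ (by positivity)).2 (Real.sqrt_le_one.2 hμ1)
        have h3 : 1 ≤ l ^ (-(((n:ℝ)+2)/2)) :=
          Real.one_le_rpow_of_pos_of_le_one_of_nonpos hl h.le
            (by have : (0:ℝ) ≤ n := n.cast_nonneg
                linarith)
        nlinarith
      calc _ ≤ C₂ := by
            refine (norm_integral_le_integral_norm _).trans_eq ?_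
            rw [hC₂]
            congr 1 with ξ
            rw [norm_mul, norm_mul, norm_exp_I_mul_ofReal, norm_exp_I_mul_ofReal, one_mul, one_mul,
              Complex.norm_real, Real.norm_eq_abs]
        _ ≤ _ := by nlinarith [mul_nonneg hc hC₁]
  refine ⟨c * C₁ + C₂, by positivity, fun μ l hμ hμ1 hl x => ?_⟩
  rcases hl.lt_or_gt with h | h
  · rw [abs_of_neg h, ← Complex.norm_conj, ← integral_conj]
    refine le_of_eq_of_le ?_ (hpos μ (-l) hμ hμ1 (neg_pos.2 h) (-x))
    congr 2 with ξ
    simp only [map_mul, ← Complex.exp_conj, Complex.conj_I, Complex.conj_ofReal, inner_neg_left]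
    push_cast
    ring_nf
  · rw [abs_of_pos h]
    exact hpos μ l hμ hμ1 h x

/-- The scaled Bogoliubov dispersion relation, as a function of the modulus of the frequency. -/
noncomputable def bogoliubov (ε κ ρ : ℝ) : ℝ := 1 / ε * ρ * √(1 + ε ^ 2 * κ ^ 2 * ρ ^ 2)

/-- The symbol of the smoothing operator at frequency `R`. -/
noncomputable def smoothingSymbol (ε κ R : ℝ) : ℝ := ε * κ * R / √(1 + ε ^ 2 * κ ^ 2 * R ^ 2)

lemma continuous_bogoliubov (ε κ : ℝ) : Continuous (bogoliubov ε κ) := by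
  unfold bogoliubov
  fun_prop

lemma smoothingSymbol_pos {ε κ R : ℝ} (hε : 0 < ε) (hκ : 0 < κ) (hR : 0 < R) :
    0 < smoothingSymbol ε κ R := by
  unfold smoothingSymbol
  positivity

lemma smoothingSymbol_sq (ε κ R : ℝ) :
    smoothingSymbol ε κ R ^ 2 = ε ^ 2 * κ ^ 2 * R ^ 2 / (1 + ε ^ 2 * κ ^ 2 * R ^ 2) := by
  rw [smoothingSymbol, div_pow, Real.sq_sqrt (by positivity)]
  ring

lemma smoothingSymbol_le_one {ε κ R : ℝ} (hε : 0 < ε) (hκ : 0 < κ) (hR : 0 < R) :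
    smoothingSymbol ε κ R ≤ 1 := by
  rw [← sq_le_one_iff₀ (smoothingSymbol_pos hε hκ hR).le, smoothingSymbol_sq,
    div_le_one (by positivity)]
  linarith

lemma bogoliubov_mul {ε κ R : ℝ} (hε : 0 < ε) (hκ : 0 < κ) (hR : 0 < R) (ρ : ℝ) :
    bogoliubov ε κ (R * ρ) =
      κ * R ^ 2 / smoothingSymbol ε κ R * dispersion (smoothingSymbol ε κ R ^ 2) ρ := by
  have h1 : 0 < 1 + ε ^ 2 * κ ^ 2 * R ^ 2 := by positivity
  have h2 : 1 - smoothingSymbol ε κ R ^ 2 + smoothingSymbol ε κ R ^ 2 * ρ ^ 2 =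
      (1 + ε ^ 2 * κ ^ 2 * (R * ρ) ^ 2) / (1 + ε ^ 2 * κ ^ 2 * R ^ 2) := by
    rw [smoothingSymbol_sq]
    field_simp
    ring
  rw [dispersion, h2, Real.sqrt_div (by positivity), smoothingSymbol, bogoliubov]
  have := Real.sqrt_pos.2 h1
  field_simp

/-- The dispersive estimate for the acoustic propagator, localized to frequencies of size `R`. -/
theorem exists_norm_bogoliubov_integral_le (n : ℕ) {W : ℝ → ℝ} (hW : ContDiff ℝ (⊤ : ℕ∞) W)
    (hW0 : ∀ ρ, ρ ∉ Set.Icc (1/3 : ℝ) 3 → W ρ = 0) {κ : ℝ} (hκ : 0 < κ) :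
    ∃ C, 0 ≤ C ∧ ∀ ε R t, 0 < ε → 0 < R → t ≠ 0 → ∀ x : EuclideanSpace ℝ (Fin (n + 2)),
      ‖∫ ξ, Complex.exp (Complex.I * ((inner ℝ x ξ : ℝ) : ℂ)) *
        (Complex.exp (Complex.I * ((t * bogoliubov ε κ ‖ξ‖ : ℝ) : ℂ)) *
          ((W (‖ξ‖ / R) : ℝ) : ℂ))‖ ≤
      C * smoothingSymbol ε κ R ^ ((n:ℝ)/2) * |t| ^ (-(((n:ℝ)+2)/2)) := by
  obtain ⟨C, hC, h⟩ := exists_norm_dispersive_integral_le n hW hW0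
  refine ⟨C * κ ^ (-(((n:ℝ)+2)/2)), by positivity, fun ε R t hε hR ht x => ?_⟩
  set m := smoothingSymbol ε κ R with hm
  have hm0 : 0 < m := smoothingSymbol_pos hε hκ hR
  set l : ℝ := t * (κ * R ^ 2 / m) with hl
  have hl0 : l ≠ 0 := by positivity
  have hscale := Measure.integral_comp_smul (volume : Measure (EuclideanSpace ℝ (Fin (n + 2))))
    (fun ξ => Complex.exp (Complex.I * ((inner ℝ x ξ : ℝ) : ℂ)) *
        (Complex.exp (Complex.I * ((t * bogoliubov ε κ ‖ξ‖ : ℝ) : ℂ)) *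
          ((W (‖ξ‖ / R) : ℝ) : ℂ))) R
  rw [finrank_euclideanSpace, Fintype.card_fin, abs_of_pos (by positivity),
    eq_inv_smul_iff₀ (by positivity)] at hscale
  rw [← hscale, norm_smul, Real.norm_of_nonneg (by positivity)]
  have hbound := h (m ^ 2) l (by positivity)
    (pow_le_one₀ hm0.le (smoothingSymbol_le_one hε hκ hR)) hl0 (R • x)
  rw [Real.sqrt_sq hm0.le] at hbound
  have heq : ∀ ξ : EuclideanSpace ℝ (Fin (n + 2)),
      Complex.exp (Complex.I * ((inner ℝ x (R • ξ) : ℝ) : ℂ)) *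
        (Complex.exp (Complex.I * ((t * bogoliubov ε κ ‖R • ξ‖ : ℝ) : ℂ)) *
          ((W (‖R • ξ‖ / R) : ℝ) : ℂ)) =
      Complex.exp (Complex.I * ((inner ℝ (R • x) ξ : ℝ) : ℂ)) *
        (Complex.exp (Complex.I * ((l * dispersion (m ^ 2) ‖ξ‖ : ℝ) : ℂ)) *
          ((W ‖ξ‖ : ℝ) : ℂ)) := fun ξ => by
    rw [norm_smul, Real.norm_of_nonneg hR.le, bogoliubov_mul hε hκ hR, mul_div_cancel_left₀ _ hR.ne',
      inner_smul_left, inner_smul_right, hl, mul_assoc t, ← hm]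
    simp
  simp only [heq]
  refine (mul_le_mul_of_nonneg_left hbound (by positivity)).trans_eq ?_
  rw [hl, abs_mul, abs_of_pos (by positivity : 0 < κ * R ^ 2 / m),
    Real.mul_rpow (abs_nonneg _) (by positivity), Real.div_rpow (by positivity) hm0.le,
    Real.mul_rpow hκ.le (by positivity), ← Real.rpow_natCast R 2, ← Real.rpow_mul hR.le,
    (by push_cast; ring : ((2 : ℕ) : ℝ) * (-(((n:ℝ)+2)/2)) = -((n + 2 : ℕ) : ℝ)),
    Real.rpow_neg hR.le, Real.rpow_natCast, Real.rpow_neg hm0.le (((n:ℝ)+2)/2),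
    (by ring : ((n:ℝ)+2)/2 = (n:ℝ)/2 + 1), Real.rpow_add_one hm0.ne']
  have := (pow_pos hR (n + 2)).ne'
  have := (Real.rpow_pos_of_pos hm0 ((n:ℝ)/2)).ne'
  generalize R ^ (n + 2) = a at *
  generalize m ^ ((n:ℝ)/2) = b at *
  field_simp

section WavePacket

variable {V : Type*} [NormedAddCommGroup V] [InnerProductSpace ℝ V]

/-- The frequency profile of the wave packet centred at the space-time point `z`, for the
evolution with symbol `φ` and the frequency cutoff `ψ`. -/
noncomputable def wavePacketFun (ψ φ : V → ℝ) (z : ℝ × V) (ξ : V) : ℂ :=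
  (ψ ξ : ℂ) * Complex.exp (-(Complex.I * ((2 * Real.pi * inner ℝ z.2 ξ + z.1 * φ ξ : ℝ) : ℂ)))

lemma norm_exp_neg_I_mul_ofReal (x : ℝ) : ‖Complex.exp (-(Complex.I * (x : ℂ)))‖ = 1 := by
  rw [← mul_neg, ← Complex.ofReal_neg, mul_comm, Complex.norm_exp_ofReal_mul_I]

lemma norm_wavePacketFun (ψ φ : V → ℝ) (z : ℝ × V) (ξ : V) :
    ‖wavePacketFun ψ φ z ξ‖ = |ψ ξ| := by
  rw [wavePacketFun, norm_mul, norm_exp_neg_I_mul_ofReal, mul_one, Complex.norm_real,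
    Real.norm_eq_abs]

lemma continuous_wavePacketFun {ψ φ : V → ℝ} (hψ : Continuous ψ) (hφ : Continuous φ) :
    Continuous fun w : (ℝ × V) × V => wavePacketFun ψ φ w.1 w.2 := by
  unfold wavePacketFun
  fun_prop

variable [MeasurableSpace V] [BorelSpace V] [FiniteDimensional ℝ V]

lemma memLp_wavePacketFun {ψ φ : V → ℝ} (hψ : Continuous ψ) (hφ : Continuous φ)
    (hc : HasCompactSupport ψ) (z : ℝ × V) : MemLp (wavePacketFun ψ φ z) 2 volume := by
  refine ((hψ.memLp_of_hasCompactSupport hc (p := 2) (μ := volume)).norm).of_le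
    ((continuous_wavePacketFun hψ hφ).comp (by fun_prop :
      Continuous fun ξ : V => (z, ξ))).aestronglyMeasurable (.of_forall fun ξ => ?_)
  rw [norm_wavePacketFun]
  simp

/-- The wave packet `wavePacketFun` as an element of `L²`. -/
noncomputable def wavePacket {ψ φ : V → ℝ} (hψ : Continuous ψ) (hφ : Continuous φ)
    (hc : HasCompactSupport ψ) (z : ℝ × V) : Lp (α := V) ℂ 2 :=
  (memLp_wavePacketFun hψ hφ hc z).toLp _

lemma coeFn_wavePacket {ψ φ : V → ℝ} (hψ : Continuous ψ) (hφ : Continuous φ)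
    (hc : HasCompactSupport ψ) (z : ℝ × V) :
    wavePacket hψ hφ hc z =ᵐ[volume] wavePacketFun ψ φ z :=
  (memLp_wavePacketFun hψ hφ hc z).coeFn_toLp

lemma norm_wavePacket {ψ φ : V → ℝ} (hψ : Continuous ψ) (hφ : Continuous φ)
    (hc : HasCompactSupport ψ) (z : ℝ × V) :
    ‖wavePacket hψ hφ hc z‖ = (eLpNorm ψ 2 volume).toReal := by
  rw [wavePacket, Lp.norm_toLp]
  congr 1
  exact eLpNorm_congr_norm_ae (.of_forall fun ξ => by rw [norm_wavePacketFun, Real.norm_eq_abs])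

lemma continuous_wavePacket {ψ φ : V → ℝ} (hψ : Continuous ψ) (hφ : Continuous φ)
    (hc : HasCompactSupport ψ) : Continuous (wavePacket hψ hφ hc) := by
  have hw := continuous_wavePacketFun hψ hφ
  refine continuous_iff_continuousAt.2 fun z₀ => ?_
  refine (Lp.tendsto_Lp_iff_tendsto_eLpNorm'' _ (fun z => memLp_wavePacketFun hψ hφ hc z) _
    (memLp_wavePacketFun hψ hφ hc z₀)).2 ?_
  simp only [eLpNorm_eq_lintegral_rpow_enorm_toReal two_ne_zero ENNReal.ofNat_ne_top,
    ENNReal.toReal_ofNat, Pi.sub_apply]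
  rw [← ENNReal.zero_rpow_of_pos (by norm_num : (0:ℝ) < 1 / 2)]
  refine (ENNReal.continuous_rpow_const.tendsto _).comp ?_
  rw [← lintegral_zero (μ := (volume : Measure V))]
  refine tendsto_lintegral_filter_of_dominated_convergence
    (fun ξ => (2 * ‖ψ ξ‖ₑ) ^ (2:ℝ)) (.of_forall fun z => ?_) (.of_forall fun z => ?_) ?_ ?_
  · have : Continuous fun ξ => wavePacketFun ψ φ z ξ - wavePacketFun ψ φ z₀ ξ :=
      (hw.comp (by fun_prop : Continuous fun ξ : V => (z, ξ))).sub
        (hw.comp (by fun_prop : Continuous fun ξ : V => (z₀, ξ)))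
    exact this.measurable.enorm.pow_const _
  · refine .of_forall fun ξ => ENNReal.rpow_le_rpow ?_ (by norm_num)
    refine (enorm_sub_le).trans_eq ?_
    rw [two_mul]
    congr 1 <;> exact enorm_eq_iff_norm_eq.2 (norm_wavePacketFun _ _ _ _)
  · simp only [ENNReal.mul_rpow_of_nonneg _ _ (zero_le_two : (0:ℝ) ≤ 2)]
    rw [lintegral_const_mul _ (by fun_prop)]
    refine ENNReal.mul_ne_top (by simp) ?_
    have := lintegral_rpow_enorm_lt_top_of_eLpNorm_lt_top two_ne_zero ENNReal.ofNat_ne_top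
      (hψ.memLp_of_hasCompactSupport hc (p := 2) (μ := volume)).2
    simpa using this.ne
  · refine .of_forall fun ξ => ?_
    have : Continuous fun z => ‖wavePacketFun ψ φ z ξ - wavePacketFun ψ φ z₀ ξ‖ₑ ^ (2:ℝ) :=
      ENNReal.continuous_rpow_const.comp
        ((hw.comp (by fun_prop : Continuous fun z : ℝ × V => (z, ξ))).sub continuous_const).enorm
    simpa using this.tendsto z₀

lemma inner_wavePacket_left {ψ φ : V → ℝ} (hψ : Continuous ψ) (hφ : Continuous φ)
    (hc : HasCompactSupport ψ) (z : ℝ × V) {g : V → ℂ} (hg : MemLp g 2 volume) :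
    inner ℂ (wavePacket hψ hφ hc z) (hg.toLp g) =
      ∫ ξ, Complex.exp (Complex.I * ((2 * Real.pi * inner ℝ z.2 ξ + z.1 * φ ξ : ℝ) : ℂ)) *
        ((ψ ξ : ℂ) * g ξ) := by
  rw [L2.inner_def]
  refine integral_congr_ae ?_
  filter_upwards [coeFn_wavePacket hψ hφ hc z, hg.coeFn_toLp] with ξ h1 h2
  rw [h1, h2, wavePacketFun, RCLike.inner_apply, map_mul, Complex.conj_ofReal, ← Complex.exp_conj,
    map_neg, map_mul, Complex.conj_I, Complex.conj_ofReal]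
  ring_nf

lemma inner_wavePacket_wavePacket {ψ φ : V → ℝ} (hψ : Continuous ψ) (hφ : Continuous φ)
    (hc : HasCompactSupport ψ) (s t : ℝ) (x y : V) :
    inner ℂ (wavePacket hψ hφ hc (s, x)) (wavePacket hψ hφ hc (t, y)) =
      ∫ ξ, Complex.exp (Complex.I * ((inner ℝ ((2 * Real.pi) • (x - y)) ξ : ℝ) : ℂ)) *
        (Complex.exp (Complex.I * (((s - t) * φ ξ : ℝ) : ℂ)) * ((ψ ξ ^ 2 : ℝ) : ℂ)) := by
  rw [wavePacket.eq_def hψ hφ hc (t, y), inner_wavePacket_left]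
  congr 1 with ξ
  rw [wavePacketFun, mul_left_comm, ← mul_assoc, mul_left_comm, ← mul_assoc, ← mul_assoc,
    ← mul_assoc, ← Complex.exp_add, mul_right_comm, mul_assoc, ← Complex.exp_add, mul_comm]
  simp only [inner_smul_left, inner_sub_left]
  push_cast
  congr 1
  · simp only [conj_trivial]
    push_cast
    ring_nf
  · ring

end WavePacket

lemma lintegral_enorm_mul_le_eLpNorm_two {X : Type*} [MeasurableSpace X] {μ : Measure X}
    {f g : X → ℂ} (hf : AEStronglyMeasurable f μ) (hg : AEStronglyMeasurable g μ) :
    ∫⁻ x, ‖f x‖ₑ * ‖g x‖ₑ ∂μ ≤ eLpNorm f 2 μ * eLpNorm g 2 μ := by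
  have := ENNReal.lintegral_mul_le_Lp_mul_Lq μ Real.HolderConjugate.two_two hf.enorm hg.enorm
  simpa only [eLpNorm_eq_lintegral_rpow_enorm_toReal two_ne_zero ENNReal.ofNat_ne_top,
    ENNReal.toReal_ofNat, Pi.mul_apply] using this

lemma contDiff_exp_mul_cutoff {V : Type*} [NormedAddCommGroup V] [InnerProductSpace ℝ V]
    {ψ φ : V → ℝ} (hψ : ContDiff ℝ (⊤ : ℕ∞) ψ)
    (hφ : ∀ ξ ∈ tsupport ψ, ContDiffAt ℝ (⊤ : ℕ∞) φ ξ) (t : ℝ) {h : V → ℂ}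
    (hh : ContDiff ℝ (⊤ : ℕ∞) h) : ContDiff ℝ (⊤ : ℕ∞) fun ξ =>
      Complex.exp (Complex.I * ((t * φ ξ : ℝ) : ℂ)) * ((ψ ξ : ℂ) * h ξ) := by
  refine contDiff_iff_contDiffAt.2 fun ξ => ?_
  by_cases hξ : ξ ∈ tsupport ψ
  · have h1 : ContDiffAt ℝ (⊤ : ℕ∞) (fun ξ => ((t * φ ξ : ℝ) : ℂ)) ξ :=
      Complex.ofRealCLM.contDiff.contDiffAt.comp ξ (contDiffAt_const.mul (hφ ξ hξ))
    have h2 : ContDiffAt ℝ (⊤ : ℕ∞) (fun ξ => (ψ ξ : ℂ)) ξ :=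
      Complex.ofRealCLM.contDiff.contDiffAt.comp ξ hψ.contDiffAt
    exact (contDiffAt_const.mul h1).cexp.mul (h2.mul hh.contDiffAt)
  · refine (contDiffAt_const (c := (0:ℂ))).congr_of_eventuallyEq ?_
    filter_upwards [notMem_tsupport_iff_eventuallyEq.1 hξ] with η hη
    simp [hη]

section WavePacket

variable {V : Type*} [NormedAddCommGroup V] [InnerProductSpace ℝ V] [MeasurableSpace V]
  [BorelSpace V] [FiniteDimensional ℝ V]

lemma SchwartzMap.eLpNorm_fourierInv (k : SchwartzMap V ℂ) :
    eLpNorm (𝓕⁻ (k : V → ℂ)) 2 volume = eLpNorm k 2 volume := by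
  have h : ‖(𝓕⁻ k).toLp 2 volume‖ = ‖k.toLp 2 volume‖ := by
    rw [← SchwartzMap.norm_fourier_toL2_eq, fourier_fourierInv_eq]
  rw [SchwartzMap.norm_toLp, SchwartzMap.norm_toLp, SchwartzMap.fourierInv_coe] at h
  have hfin := SchwartzMap.eLpNorm_lt_top (𝓕⁻ k) 2 volume
  rw [SchwartzMap.fourierInv_coe] at hfin
  exact (ENNReal.toReal_eq_toReal_iff' hfin.ne (SchwartzMap.eLpNorm_lt_top k 2 volume).ne).1 h

lemma SchwartzMap.eLpNorm_fourier (k : SchwartzMap V ℂ) :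
    eLpNorm (𝓕 (k : V → ℂ)) 2 volume = eLpNorm k 2 volume := by
  rw [← SchwartzMap.fourier_coe, ← SchwartzMap.eLpNorm_fourierInv, ← SchwartzMap.fourierInv_coe,
    fourierInv_fourier_eq]

lemma inner_wavePacket_eq_fourierInv {ψ φ : V → ℝ} (hψ : Continuous ψ) (hφ : Continuous φ)
    (hc : HasCompactSupport ψ) (t : ℝ) (x : V) {g : V → ℂ} (hg : MemLp g 2 volume) :
    inner ℂ (wavePacket hψ hφ hc (t, x)) (hg.toLp g) =
      𝓕⁻ (fun ξ => Complex.exp (Complex.I * ((t * φ ξ : ℝ) : ℂ)) * ((ψ ξ : ℂ) * g ξ)) x := by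
  rw [inner_wavePacket_left, Real.fourierInv_eq']
  congr 1 with ξ
  rw [smul_eq_mul, ← mul_assoc (Complex.exp _) (Complex.exp _), ← Complex.exp_add,
    real_inner_comm]
  push_cast
  ring_nf

/-- The energy estimate for superpositions of wave packets. -/
lemma enorm_integral_smul_wavePacket_sq_le {ψ φ : V → ℝ} (hψ : ContDiff ℝ (⊤ : ℕ∞) ψ)
    (hφ : Continuous φ) (hc : HasCompactSupport ψ) (hψ1 : ∀ ξ, |ψ ξ| ≤ 1)
    (hφψ : ∀ ξ ∈ tsupport ψ, ContDiffAt ℝ (⊤ : ℕ∞) φ ξ) (t : ℝ) {g : V → ℂ}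
    (hg : Integrable g) :
    ‖∫ x, g x • wavePacket hψ.continuous hφ hc (t, x)‖ₑ ^ 2 ≤ ∫⁻ x, ‖g x‖ₑ ^ 2 := by
  set e := fun x => wavePacket hψ.continuous hφ hc (t, x) with he
  have hec : Continuous e := (continuous_wavePacket hψ.continuous hφ hc).comp (by fun_prop)
  have hint : Integrable fun x => g x • e x :=
    hg.smul_bdd (eLpNorm ψ 2 volume).toReal hec.aestronglyMeasurable
      (.of_forall fun x => (norm_wavePacket _ _ _ _).le)
  have hsq : ∫⁻ x, ‖g x‖ₑ ^ 2 = eLpNorm g 2 volume ^ 2 := by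
    rw [eLpNorm_eq_lintegral_rpow_enorm_toReal two_ne_zero ENNReal.ofNat_ne_top,
      ← ENNReal.rpow_natCast _ 2, ← ENNReal.rpow_mul]
    simp
  rw [hsq]
  refine pow_le_pow_left' ?_ 2
  rcases eq_or_ne (eLpNorm g 2 volume) ⊤ with htop | htop
  · rw [htop]
    exact le_top
  set A := (eLpNorm g 2 volume).toReal
  have key : ∀ h : Lp (α := V) ℂ 2, ‖inner ℂ h (∫ x, g x • e x)‖ ≤ A * ‖h‖ := by
    intro h
    refine (SchwartzMap.denseRange_toLpCLM (F := ℂ) (E := V) (p := 2) (μ := volume)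
      ENNReal.ofNat_ne_top).induction_on (p := fun h => ‖inner ℂ h (∫ x, g x • e x)‖ ≤ A * ‖h‖)
      h ?_ fun k => ?_
    · exact isClosed_le (by fun_prop) (by fun_prop)
    · have hk2 : MemLp k 2 volume := k.memLp 2 volume
      set κ : V → ℂ := fun ξ => Complex.exp (Complex.I * ((t * φ ξ : ℝ) : ℂ)) * ((ψ ξ : ℂ) * k ξ)
      have hκc : HasCompactSupport κ :=
        hc.mono fun ξ hξ h0 => hξ (by simp [κ, h0])
      set K : SchwartzMap V ℂ := hκc.toSchwartzMap (contDiff_exp_mul_cutoff hψ hφψ t (k.smooth _))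
      have hKκ : (K : V → ℂ) = κ := rfl
      have hinner : ∀ x, ‖inner ℂ (hk2.toLp k) (e x)‖ₑ = ‖𝓕⁻ (K : V → ℂ) x‖ₑ := fun x => by
        rw [hKκ, ← inner_wavePacket_eq_fourierInv hψ.continuous hφ hc t x hk2]
        exact enorm_eq_iff_norm_eq.2 (norm_inner_symm _ _)
      have hKle : eLpNorm K 2 volume ≤ eLpNorm k 2 volume := eLpNorm_mono fun ξ => by
        simp only [hKκ, κ, norm_mul, Complex.norm_real, Real.norm_eq_abs]
        rw [mul_comm Complex.I, Complex.norm_exp_ofReal_mul_I, one_mul]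
        exact mul_le_of_le_one_left (norm_nonneg _) (hψ1 ξ)
      have hle : ‖inner ℂ (hk2.toLp k) (∫ x, g x • e x)‖ₑ ≤
          eLpNorm g 2 volume * eLpNorm k 2 volume := by
        rw [← integral_inner (𝕜 := ℂ) hint]
        simp only [inner_smul_right]
        calc _ ≤ ∫⁻ x, ‖g x‖ₑ * ‖𝓕⁻ (K : V → ℂ) x‖ₑ := by
              refine (enorm_integral_le_lintegral_enorm _).trans_eq ?_
              simp only [enorm_mul, hinner]
          _ ≤ eLpNorm g 2 volume * eLpNorm (𝓕⁻ (K : V → ℂ)) 2 volume := by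
              refine lintegral_enorm_mul_le_eLpNorm_two hg.1 ?_
              rw [← SchwartzMap.fourierInv_coe]
              exact (SchwartzMap.continuous _).aestronglyMeasurable
          _ ≤ _ := by
              rw [SchwartzMap.eLpNorm_fourierInv]
              gcongr
      have := ENNReal.toReal_mono (ENNReal.mul_ne_top htop hk2.2.ne) hle
      rw [toReal_enorm, ENNReal.toReal_mul, ← Lp.norm_toLp _ hk2] at this
      exact this
  have hself := key (∫ x, g x • e x)
  rw [inner_self_eq_norm_sq_to_K, norm_pow, RCLike.norm_ofReal, abs_norm, sq] at hself
  rw [← ofReal_norm, ← ENNReal.ofReal_toReal htop]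
  refine ENNReal.ofReal_le_ofReal ?_
  rcases (norm_nonneg (∫ x, g x • e x)).eq_or_lt with h0 | h0
  · rw [← h0]
    exact ENNReal.toReal_nonneg
  · exact le_of_mul_le_mul_right hself h0

end WavePacket

/-- A smooth cutoff, equal to one on `[1/2, 2]` and supported in `[1/3, 3]`. -/
noncomputable def annulusBump : ContDiffBump (5/4 : ℝ) where
  rIn := 3/4
  rOut := 11/12
  rIn_pos := by norm_num
  rIn_lt_rOut := by norm_num

lemma annulusBump_eq_one {ρ : ℝ} (h₁ : 1/2 ≤ ρ) (h₂ : ρ ≤ 2) : annulusBump ρ = 1 := by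
  refine annulusBump.one_of_mem_closedBall ?_
  rw [Metric.mem_closedBall, Real.dist_eq, abs_le]
  simp only [annulusBump]
  constructor <;> linarith

lemma annulusBump_eq_zero {ρ : ℝ} (h : ρ ∉ Set.Icc (1/3 : ℝ) 3) : annulusBump ρ = 0 := by
  refine annulusBump.zero_of_le_dist ?_
  by_contra! h'
  rw [Real.dist_eq, abs_lt] at h'
  simp only [annulusBump] at h'
  exact h ⟨by linarith [h'.1], by linarith [h'.2]⟩

lemma contDiffAt_comp_norm {V : Type*} [NormedAddCommGroup V] [InnerProductSpace ℝ V] {f : ℝ → ℝ}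
    {ξ : V} (hξ : ξ ≠ 0) (hf : ContDiffAt ℝ (⊤ : ℕ∞) f ‖ξ‖) :
    ContDiffAt ℝ (⊤ : ℕ∞) (fun ξ => f ‖ξ‖) ξ :=
  hf.comp ξ (contDiffAt_norm ℝ hξ)

section AnnulusCutoff

variable {V : Type*} [NormedAddCommGroup V]

/-- The cutoff to frequencies of size `R`. -/
noncomputable def annulusCutoff (R : ℝ) (ξ : V) : ℝ := annulusBump (‖ξ‖ / R)

lemma annulusCutoff_eq_zero {R : ℝ} (hR : 0 < R) {ξ : V} (h : ‖ξ‖ < R / 3 ∨ 3 * R < ‖ξ‖) :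
    annulusCutoff R ξ = 0 := by
  refine annulusBump_eq_zero fun h' => ?_
  rw [Set.mem_Icc, le_div_iff₀ hR, div_le_iff₀ hR] at h'
  rcases h with h | h <;> linarith [h'.1, h'.2]

lemma abs_annulusCutoff_le_one (R : ℝ) (ξ : V) : |annulusCutoff R ξ| ≤ 1 := by
  rw [annulusCutoff, abs_of_nonneg annulusBump.nonneg]
  exact annulusBump.le_one

lemma ne_zero_of_mem_tsupport_annulusCutoff {R : ℝ} (hR : 0 < R) {ξ : V}
    (hξ : ξ ∈ tsupport (annulusCutoff (V := V) R)) : ξ ≠ 0 := by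
  rintro rfl
  refine notMem_tsupport_iff_eventuallyEq.2 ?_ hξ
  filter_upwards [Metric.ball_mem_nhds (0 : V) (by positivity : 0 < R / 3)] with η hη
  exact annulusCutoff_eq_zero hR (.inl (by simpa using hη))

variable [InnerProductSpace ℝ V]

lemma contDiff_annulusCutoff {R : ℝ} (hR : 0 < R) :
    ContDiff ℝ (⊤ : ℕ∞) (annulusCutoff (V := V) R) := by
  refine contDiff_iff_contDiffAt.2 fun ξ => ?_
  by_cases hξ : ξ ∈ tsupport (annulusCutoff (V := V) R)
  · exact contDiffAt_comp_norm (f := fun ρ => annulusBump (ρ / R))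
      (ne_zero_of_mem_tsupport_annulusCutoff hR hξ)
      (annulusBump.contDiff.comp (contDiff_id.div_const R)).contDiffAt
  · exact (contDiffAt_const (c := (0:ℝ))).congr_of_eventuallyEq
      (notMem_tsupport_iff_eventuallyEq.1 hξ)

lemma hasCompactSupport_annulusCutoff [FiniteDimensional ℝ V] {R : ℝ} (hR : 0 < R) :
    HasCompactSupport (annulusCutoff (V := V) R) :=
  HasCompactSupport.intro (isCompact_closedBall 0 (3 * R)) fun ξ hξ =>
    annulusCutoff_eq_zero hR (.inr (by simpa using hξ))

end AnnulusCutoff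

lemma contDiffAt_bogoliubov (ε κ ρ : ℝ) : ContDiffAt ℝ (⊤ : ℕ∞) (bogoliubov ε κ) ρ := by
  unfold bogoliubov
  refine ContDiffAt.mul (by fun_prop) (ContDiffAt.sqrt (by fun_prop) (by positivity))

/-- The acoustic wave packets at frequency `R`. -/
noncomputable def acousticWavePacket (n : ℕ) (ε κ : ℝ) {R : ℝ} (hR : 0 < R) :
    ℝ × EuclideanSpace ℝ (Fin (n + 2)) → Lp (α := EuclideanSpace ℝ (Fin (n + 2))) ℂ 2 :=
  wavePacket (contDiff_annulusCutoff hR).continuous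
    ((continuous_bogoliubov ε κ).comp continuous_norm) (hasCompactSupport_annulusCutoff hR)

theorem exists_isDispersiveFamily_acousticWavePacket (n : ℕ) {κ : ℝ} (hκ : 0 < κ) :
    ∃ C, 0 < C ∧ ∀ ε R, 0 < ε → ∀ hR : 0 < R,
      IsDispersiveFamily volume (ENNReal.ofReal (C * smoothingSymbol ε κ R ^ ((n:ℝ)/2)))
        (((n:ℝ)+2)/2) (acousticWavePacket n ε κ hR) := by
  obtain ⟨C, hC, h⟩ := exists_norm_bogoliubov_integral_le n (W := fun ρ => annulusBump ρ ^ 2)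
    (annulusBump.contDiff.pow 2) (fun ρ hρ => by simp [annulusBump_eq_zero hρ]) hκ
  refine ⟨C + 1, by positivity, fun ε R hε hR => ⟨?_, ?_, ?_, ?_⟩⟩
  · exact (continuous_wavePacket _ _ _).stronglyMeasurable
  · exact ⟨_, fun z => (norm_wavePacket _ _ _ z).le⟩
  · exact fun t g hg => enorm_integral_smul_wavePacket_sq_le (contDiff_annulusCutoff hR) _ _
      (abs_annulusCutoff_le_one R) (fun ξ hξ => contDiffAt_comp_norm
        (ne_zero_of_mem_tsupport_annulusCutoff hR hξ) (contDiffAt_bogoliubov ε κ _)) t hg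
  · intro s t x y
    have hm := Real.rpow_pos_of_pos (smoothingSymbol_pos hε hκ hR) ((n:ℝ)/2)
    rcases eq_or_ne s t with rfl | hst
    · rw [sub_self, enorm_zero, ENNReal.zero_rpow_of_neg
        (by have : (0:ℝ) ≤ n := n.cast_nonneg
            linarith), ENNReal.mul_top (by simpa using by positivity)]
      exact le_top
    · have hts : 0 < |t - s| := abs_pos.2 (sub_ne_zero.2 hst.symm)
      have := h ε R (s - t) hε hR (sub_ne_zero.2 hst) ((2 * Real.pi) • (x - y))
      rw [acousticWavePacket, inner_wavePacket_wavePacket, ← ofReal_norm,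
        Real.enorm_eq_ofReal_abs, ENNReal.ofReal_rpow_of_pos hts, ← ENNReal.ofReal_mul (by positivity)]
      refine ENNReal.ofReal_le_ofReal (this.trans ?_)
      rw [abs_sub_comm s t]
      gcongr
      linarith

/-- The Strichartz estimate in terms of real exponents, with the optimal gain. -/
theorem exists_strichartz_acousticWavePacket (n : ℕ) {κ : ℝ} (hκ : 0 < κ) {P q : ℝ} (hP : 2 ≤ P)
    (hq : 2 < q) (hadm : 2 / P = ((n:ℝ)+2)/2 * (1 - 2 / q)) :
    ∃ C : ℝ, 0 < C ∧ ∀ ε R, 0 < ε → ∀ hR : 0 < R,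
      ∀ g : Lp (α := EuclideanSpace ℝ (Fin (n + 2))) ℂ 2,
      (∫⁻ t : ℝ, (∫⁻ x, ‖inner ℂ (acousticWavePacket n ε κ hR (t, x)) g‖ₑ ^ q) ^ (P / q)) ^ (1 / P)
        ≤ ENNReal.ofReal (C * smoothingSymbol ε κ R ^ ((n:ℝ)/2 * (1/2 - 1/q))) * ‖g‖ₑ := by
  obtain ⟨C, hC, h⟩ := exists_isDispersiveFamily_acousticWavePacket n hκ
  have hn : (0:ℝ) ≤ n := n.cast_nonneg
  have hσ : 2 / P < ((n:ℝ)+2)/2 := by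
    rw [hadm]
    have : 0 < 2 / q := by positivity
    nlinarith
  set A := strichartzConst (((n:ℝ)+2)/2) P with hA
  have hAtop : A ≠ ⊤ := strichartzConst_ne_top hP hσ
  have he : 0 ≤ 1/2 - 1/q := by
    rw [sub_nonneg]
    gcongr
  refine ⟨(A.toReal + 1) * C ^ (1/2 - 1/q), by positivity, fun ε R hε hR g => ?_⟩
  have hm := smoothingSymbol_pos hε hκ hR
  have hB : 0 < C * smoothingSymbol ε κ R ^ ((n:ℝ)/2) := by positivity
  refine ((h ε R hε hR).lintegral_inner_rpow_le (by simpa using hB) ENNReal.ofReal_ne_top hP hσ hq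
    hadm g).trans ?_
  gcongr
  calc A * ENNReal.ofReal (C * smoothingSymbol ε κ R ^ ((n:ℝ)/2)) ^ (1/2 - 1/q)
    _ = ENNReal.ofReal (A.toReal * (C ^ (1/2 - 1/q) *
          smoothingSymbol ε κ R ^ ((n:ℝ)/2 * (1/2 - 1/q)))) := by
      rw [ENNReal.ofReal_rpow_of_pos hB, ENNReal.ofReal_mul ENNReal.toReal_nonneg,
        ENNReal.ofReal_toReal hAtop, Real.mul_rpow hC.le (by positivity), ← Real.rpow_mul hm.le]
    _ ≤ _ := by
      rw [← mul_assoc]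
      gcongr
      linarith

lemma two_lt_of_admissible {d : ℕ} (hd : 2 ≤ d) {p q : ℝ≥0∞} (hp2 : 2 ≤ p) (hq2 : 2 ≤ q)
    (hpfin : p < ⊤) (hadm : 2 / p + (d : ℝ≥0∞) / q = (d : ℝ≥0∞) / 2)
    (hne : ¬(p = 2 ∧ q = ⊤ ∧ d = 2)) :
    2 ≤ p.toReal ∧ q ≠ ⊤ ∧ 2 < q.toReal ∧
      2 / p.toReal = (d : ℝ) / 2 * (1 - 2 / q.toReal) := by
  have hP : 2 ≤ p.toReal := by
    simpa using ENNReal.toReal_mono hpfin.ne hp2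
  have hd' : (2:ℝ) ≤ d := by exact_mod_cast hd
  have hp0 : p ≠ 0 := (two_pos.trans_le hp2).ne'
  have hq0 : q ≠ 0 := (two_pos.trans_le hq2).ne'
  have hreal : 2 / p.toReal + d / q.toReal = (d : ℝ) / 2 := by
    have := congrArg ENNReal.toReal hadm
    rwa [ENNReal.toReal_add (ENNReal.div_ne_top (by simp) hp0) (ENNReal.div_ne_top (by simp) hq0),
      ENNReal.toReal_div, ENNReal.toReal_div, ENNReal.toReal_div, ENNReal.toReal_natCast,
      ENNReal.toReal_ofNat] at this
  have hqtop : q ≠ ⊤ := by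
    rintro rfl
    rw [ENNReal.toReal_top, _root_.div_zero, _root_.add_zero, div_eq_div_iff (by positivity) two_ne_zero] at hreal
    have hp' : p.toReal = 2 := by nlinarith
    have hd2 : (d:ℝ) = 2 := by nlinarith
    refine hne ⟨?_, rfl, by exact_mod_cast hd2⟩
    rw [← ENNReal.ofReal_toReal hpfin.ne, hp']
    simp
  have hqpos : 0 < q.toReal := ENNReal.toReal_pos hq0 hqtop
  refine ⟨hP, hqtop, ?_, ?_⟩
  · have : 0 < 2 / p.toReal := by positivity
    have : (d:ℝ) / q.toReal < d / 2 := by linarith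
    rwa [div_lt_div_iff_of_pos_left (by positivity) hqpos two_pos] at this
  · rw [eq_sub_of_add_eq hreal]
    field_simp

lemma SchwartzMap.fourierInv_bogoliubov_eq_inner {n : ℕ} {ε κ R : ℝ} (hR : 0 < R)
    {f : SchwartzMap (EuclideanSpace ℝ (Fin (n + 2))) ℂ}
    (hf : Function.support (𝓕 ⇑f) ⊆ {ξ | R / 2 ≤ ‖ξ‖ ∧ ‖ξ‖ ≤ 2 * R}) (t : ℝ)
    (x : EuclideanSpace ℝ (Fin (n + 2))) :
    𝓕⁻ (fun ξ => Complex.exp (Complex.I * ((t * bogoliubov ε κ ‖ξ‖ : ℝ) : ℂ)) * 𝓕 (⇑f) ξ) x =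
      inner ℂ (acousticWavePacket n ε κ hR (t, x)) ((𝓕 f).toLp 2 volume) := by
  have hmem : MemLp (⇑(𝓕 f : SchwartzMap (EuclideanSpace ℝ (Fin (n + 2))) ℂ)) 2 volume :=
    (𝓕 f : SchwartzMap (EuclideanSpace ℝ (Fin (n + 2))) ℂ).memLp 2 volume
  refine Eq.trans ?_ (inner_wavePacket_eq_fourierInv _ _ _ t x hmem).symm
  rw [SchwartzMap.fourier_coe]
  refine congrFun (congrArg _ (funext fun ξ => ?_)) x
  by_cases hξ : ξ ∈ Function.support (𝓕 ⇑f)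
  · have h := hf hξ
    rw [annulusCutoff, annulusBump_eq_one ((le_div_iff₀ hR).2 (by linarith [h.1]))
      ((div_le_iff₀ hR).2 h.2), Complex.ofReal_one, one_mul]
    rfl
  · rw [Function.notMem_support.1 hξ]
    simp

/-- Frequency-localized homogeneous Strichartz estimate with the ε-gain for the
Bogoliubov propagator `e^{itH_ε}` (Fourier multiplier `e^{itω_{ε,κ}(ξ)}` with
`ω_{ε,κ}(ξ) = (1/ε)‖ξ‖√(1+ε²κ²‖ξ‖²)`): for a Schrödinger-admissible pair `(p,q)`
with `p < ∞` (`2 ≤ p, q`, `2/p + d/q = d/2`, `(p,q,d) ≠ (2,∞,2)`) and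
`0 ≤ δ ≤ (d−2)/2`, there is `C > 0` depending only on `d, κ, δ, p, q` such that for all
`ε, R > 0` and all Schwartz `f` with `𝓕f` supported in the annulus `{R/2 ≤ ‖ξ‖ ≤ 2R}`,
`(∫_ℝ ‖e^{itH_ε}f‖_{L^q}^p dt)^{1/p} ≤ C (εκR/√(1+ε²κ²R²))^{δ(1/2−1/q)} ‖f‖_{L²}`. -/
theorem stmt_18 (d : ℕ) (hd : 2 ≤ d) (κ : ℝ) (hκ : 0 < κ)
    (δ : ℝ) (hδ0 : 0 ≤ δ) (hδ : δ ≤ ((d : ℝ) - 2) / 2)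
    (p q : ℝ≥0∞) (hp2 : 2 ≤ p) (hq2 : 2 ≤ q) (hpfin : p < ⊤)
    (hadm : 2 / p + (d : ℝ≥0∞) / q = (d : ℝ≥0∞) / 2)
    (hne : ¬(p = 2 ∧ q = ⊤ ∧ d = 2)) :
    ∃ C : ℝ, 0 < C ∧ ∀ (ε R : ℝ), 0 < ε → 0 < R →
      ∀ f : SchwartzMap (EuclideanSpace ℝ (Fin d)) ℂ,
        Function.support (𝓕 ⇑f) ⊆ {ξ : EuclideanSpace ℝ (Fin d) | R / 2 ≤ ‖ξ‖ ∧ ‖ξ‖ ≤ 2 * R} →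
        (∫⁻ t : ℝ,
            (eLpNorm (𝓕⁻ fun ξ : EuclideanSpace ℝ (Fin d) =>
                Complex.exp (Complex.I *
                  ((t * ((1 / ε) * ‖ξ‖ * Real.sqrt (1 + ε ^ 2 * κ ^ 2 * ‖ξ‖ ^ 2)) : ℝ) : ℂ)) *
                  𝓕 (⇑f) ξ) q volume) ^ p.toReal) ^ (1 / p.toReal) ≤
          ENNReal.ofReal (C * (ε * κ * R / Real.sqrt (1 + ε ^ 2 * κ ^ 2 * R ^ 2)) ^
              (δ * (1 / 2 - (1 / q).toReal))) *
            eLpNorm (⇑f) 2 volume := by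
  obtain ⟨n, rfl⟩ := Nat.exists_eq_add_of_le' hd
  obtain ⟨hP, hqtop, hq, hadm'⟩ := two_lt_of_admissible hd hp2 hq2 hpfin hadm hne
  obtain ⟨C, hC, h⟩ := exists_strichartz_acousticWavePacket n hκ hP hq (by exact_mod_cast hadm')
  refine ⟨C, hC, fun ε R hε hR f hf => ?_⟩
  have hm := smoothingSymbol_pos hε hκ hR
  have hnorm : ‖(𝓕 f).toLp 2 volume‖ₑ = eLpNorm f 2 volume := by
    rw [SchwartzMap.toLp, Lp.enorm_toLp, SchwartzMap.fourier_coe, SchwartzMap.eLpNorm_fourier]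
  have hmain := h ε R hε hR ((𝓕 f).toLp 2 volume)
  rw [hnorm] at hmain
  simp only [← SchwartzMap.fourierInv_bogoliubov_eq_inner hR hf] at hmain
  have hLq : ∀ F : EuclideanSpace ℝ (Fin (n + 2)) → ℂ, eLpNorm F q volume ^ p.toReal =
      (∫⁻ x, ‖F x‖ₑ ^ q.toReal) ^ (p.toReal / q.toReal) := fun F => by
    rw [eLpNorm_eq_lintegral_rpow_enorm_toReal (two_pos.trans_le hq2).ne' hqtop,
      ← ENNReal.rpow_mul, one_div_mul_eq_div]
  simp only [hLq]
  refine hmain.trans ?_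
  gcongr ENNReal.ofReal (C * ?_) * _
  rw [ENNReal.toReal_div, ENNReal.toReal_one]
  refine Real.rpow_le_rpow_of_exponent_ge hm (smoothingSymbol_le_one hε hκ hR) ?_
  have he : 0 ≤ 1 / 2 - 1 / q.toReal := by
    rw [sub_nonneg]
    gcongr
  push_cast at hδ
  gcongr
  linarith
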